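/- Fix T ∈ (0,∞), d ∈ ℕ, a probability measure ν on ℝ^d, and Borel functions a^{ij}, b^i, c : [0,T]×ℝ^d → ℝ with c ≤ 0 and A(t,x) := (a^{ij}(t,x)) symmetric nonnegative definite. Assume (H1) and (H2), and that for some p > d+2 one has b^i ∈ L^p_loc([0,T]×ℝ^d, dt dx) and c ∈ L^{p/2}_loc([0,T]×ℝ^d, dt dx). Suppose there exists a positive function V ∈ C²(ℝ^d) with V(x) → +∞ as |x| → +∞ and a constant C ∈ (0,∞) such that L₀V(t,x) ≤ C + C·V(x) for all (t,x) ∈ [0,T]×ℝ^d. Then any two elements of 𝓢𝓟_ν coincide for Lebesgue-a.e. t ∈ [0,T]. -/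

import Mathlib

open MeasureTheory Set

noncomputable section

/-- Euclidean space `ℝ^d`. -/
abbrev Rd (d : ℕ) := EuclideanSpace ℝ (Fin d)

/-- First partial derivative `∂_{x_i} φ`. -/
def pd {d : ℕ} (i : Fin d) (φ : Rd d → ℝ) (x : Rd d) : ℝ :=
  fderiv ℝ φ x (EuclideanSpace.single i 1)

/-- Second partial derivative `∂_{x_i} ∂_{x_j} φ`. -/
def pd2 {d : ℕ} (i j : Fin d) (φ : Rd d → ℝ) (x : Rd d) : ℝ :=
  fderiv ℝ (fun y => fderiv ℝ φ y (EuclideanSpace.single j 1)) x (EuclideanSpace.single i 1)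

/-- `C_c^∞` test functions on `ℝ^d`. -/
def IsTest {d : ℕ} (φ : Rd d → ℝ) : Prop :=
  ContDiff ℝ (⊤ : ℕ∞) φ ∧ HasCompactSupport φ

/-- The Kolmogorov operator
`L₀φ(t,x) = Σ a^{ij}(t,x) ∂_i∂_j φ(x) + Σ b^i(t,x) ∂_i φ(x) + c(t,x) φ(x)`. -/
def L0 {d : ℕ} (a : Fin d → Fin d → ℝ × Rd d → ℝ) (b : Fin d → ℝ × Rd d → ℝ)
    (c : ℝ × Rd d → ℝ) (φ : Rd d → ℝ) (z : ℝ × Rd d) : ℝ :=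
  (∑ i, ∑ j, a i j z * pd2 i j φ z.2) + (∑ i, b i z * pd i φ z.2) + c z * φ z.2

/-- Local strict ellipticity and local boundedness (H1): on each ball `U` there are
`γ(U), M(U) ∈ (0,∞)` with `γ(U)·I ≤ A(t,x) ≤ M(U)·I` for `t ∈ [0,T]`, `x ∈ U`. -/
def CondH1 {d : ℕ} (T : ℝ) (a : Fin d → Fin d → ℝ × Rd d → ℝ) : Prop :=
  ∀ R : ℝ, 0 < R → ∃ γ M : ℝ, 0 < γ ∧ 0 < M ∧
    ∀ t ∈ Set.Icc (0 : ℝ) T, ∀ x ∈ Metric.ball (0 : Rd d) R, ∀ ξ : Fin d → ℝ,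
      γ * ∑ i, ξ i ^ 2 ≤ (∑ i, ∑ j, a i j (t, x) * ξ i * ξ j) ∧
      (∑ i, ∑ j, a i j (t, x) * ξ i * ξ j) ≤ M * ∑ i, ξ i ^ 2

/-- Membership in the class `𝓢𝓟_ν` of subprobability solutions to the FPKE on `[0,T]`. -/
def MemSP {d : ℕ} (T : ℝ) (a : Fin d → Fin d → ℝ × Rd d → ℝ)
    (b : Fin d → ℝ × Rd d → ℝ) (c : ℝ × Rd d → ℝ)
    (ν : Measure (Rd d)) (μ : ℝ → Measure (Rd d)) : Prop :=
  (∀ A : Set (Rd d), MeasurableSet A → Measurable fun t => μ t A) ∧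
  (∀ t ∈ Set.Icc (0 : ℝ) T, μ t Set.univ ≤ 1) ∧
  -- a^{ij}, b^i, c ∈ L¹_loc([0,T] × ℝ^d, μ_t dt)
  (∀ R : ℝ, 0 < R → ∀ i j : Fin d,
    ∫⁻ t in Set.Icc (0 : ℝ) T, ∫⁻ x in Metric.ball (0 : Rd d) R,
      ENNReal.ofReal |a i j (t, x)| ∂(μ t) < ⊤) ∧
  (∀ R : ℝ, 0 < R → ∀ i : Fin d,
    ∫⁻ t in Set.Icc (0 : ℝ) T, ∫⁻ x in Metric.ball (0 : Rd d) R,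
      ENNReal.ofReal |b i (t, x)| ∂(μ t) < ⊤) ∧
  (∀ R : ℝ, 0 < R →
    ∫⁻ t in Set.Icc (0 : ℝ) T, ∫⁻ x in Metric.ball (0 : Rd d) R,
      ENNReal.ofReal |c (t, x)| ∂(μ t) < ⊤) ∧
  -- the Fokker–Planck–Kolmogorov equation
  (∀ φ : Rd d → ℝ, IsTest φ →
    ∀ᵐ t ∂(volume.restrict (Set.Icc (0 : ℝ) T)),
      ∫ x, φ x ∂(μ t)
        = ∫ x, φ x ∂ν + ∫ s in (0 : ℝ)..t, ∫ x, L0 a b c φ (s, x) ∂(μ s)) ∧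
  -- c ∈ L¹([0,T] × ℝ^d, μ_t dt)
  (∫⁻ t in Set.Icc (0 : ℝ) T, ∫⁻ x, ENNReal.ofReal |c (t, x)| ∂(μ t) < ⊤) ∧
  -- b ∈ L²([0,T] × U, μ_t dt; ℝ^d) for every ball U
  (∀ R : ℝ, 0 < R →
    ∫⁻ t in Set.Icc (0 : ℝ) T, ∫⁻ x in Metric.ball (0 : Rd d) R,
      ENNReal.ofReal (∑ i, b i (t, x) ^ 2) ∂(μ t) < ⊤) ∧
  μ 0 = ν ∧
  (∀ᵐ t ∂(volume.restrict (Set.Icc (0 : ℝ) T)),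
    (μ t Set.univ).toReal
      ≤ (ν Set.univ).toReal + ∫ s in (0 : ℝ)..t, ∫ x, c (s, x) ∂(μ s))

/-- Local Lipschitz continuity of the diffusion coefficients (H2). -/
def CondH2 {d : ℕ} (T : ℝ) (a : Fin d → Fin d → ℝ × Rd d → ℝ) : Prop :=
  ∀ R : ℝ, 0 < R → ∃ Λ : ℝ, 0 < Λ ∧
    ∀ t ∈ Set.Icc (0 : ℝ) T, ∀ x ∈ Metric.ball (0 : Rd d) R,
      ∀ y ∈ Metric.ball (0 : Rd d) R, ∀ i j : Fin d,
        |a i j (t, x) - a i j (t, y)| ≤ Λ * dist x y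

/-- `g ∈ L^p_loc([0,T] × ℝ^d, dt dx)`. -/
def MemLplocDtDx {d : ℕ} (T : ℝ) (p : ℝ) (g : ℝ × Rd d → ℝ) : Prop :=
  ∀ R : ℝ, 0 < R →
    ∫⁻ t in Set.Icc (0 : ℝ) T, ∫⁻ x in Metric.ball (0 : Rd d) R,
      ENNReal.ofReal (|g (t, x)| ^ p) ∂(volume) ∂(volume) < ⊤

section Auxiliary
open ProbabilityTheory Filter Topology

theorem AbsolutelyContinuousOnInterval.inv_of_le {f : ℝ → ℝ} {a b δ : ℝ} (hδ : 0 < δ)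
    (hf : AbsolutelyContinuousOnInterval f a b) (hle : ∀ t ∈ uIcc a b, δ ≤ f t) :
    AbsolutelyContinuousOnInterval (fun t => (f t)⁻¹) a b := by
  rw [absolutelyContinuousOnInterval_iff] at hf ⊢
  intro ε hε
  obtain ⟨r, hr, h⟩ := hf (ε * δ ^ 2) (by positivity)
  refine ⟨r, hr, fun E hE hlt => ?_⟩
  have h1 := h E hE hlt
  have h2 : ∑ i ∈ Finset.range E.1, dist (f (E.2 i).1)⁻¹ (f (E.2 i).2)⁻¹
      ≤ ∑ i ∈ Finset.range E.1, (δ ^ 2)⁻¹ * dist (f (E.2 i).1) (f (E.2 i).2) := by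
    refine Finset.sum_le_sum fun i hi => ?_
    have hx := hle _ (hE.1 i hi).1
    have hy := hle _ (hE.1 i hi).2
    have hx0 := hδ.trans_le hx
    have hy0 := hδ.trans_le hy
    rw [dist_inv_inv₀ hx0.ne' hy0.ne', Real.norm_of_nonneg hx0.le, Real.norm_of_nonneg hy0.le,
      div_eq_inv_mul]
    gcongr
    nlinarith
  rw [← Finset.mul_sum] at h2
  calc _ ≤ _ := h2
    _ < (δ ^ 2)⁻¹ * (ε * δ ^ 2) := by gcongr
    _ = ε := by field_simp

/-- Integrated chain rule for `m - w² / (m + δ)` along absolutely continuous `w`, `m`. -/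
theorem integral_sub_sq_div_eq {T : ℝ} (hT : 0 < T) {F G w m : ℝ → ℝ} {m₀ δ : ℝ} (hδ : 0 < δ)
    (hF : IntervalIntegrable F volume 0 T) (hG : IntervalIntegrable G volume 0 T)
    (hw : ∀ᵐ t ∂(volume.restrict (Icc 0 T)), w t = ∫ s in (0 : ℝ)..t, F s)
    (hm : ∀ᵐ t ∂(volume.restrict (Icc 0 T)), m t = m₀ + ∫ s in (0 : ℝ)..t, G s)
    (hm_nonneg : ∀ t, 0 ≤ m t) :
    ∫ t in Icc 0 T, (m t - w t ^ 2 / (m t + δ))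
      = T * m₀ + ∫ t in Icc 0 T, (T - t) *
          ((1 + (w t / (m t + δ)) ^ 2) * G t - 2 * (w t / (m t + δ)) * F t) := by
  set W : ℝ → ℝ := fun t => ∫ s in (0 : ℝ)..t, F s with hW
  set N : ℝ → ℝ := fun t => m₀ + ∫ s in (0 : ℝ)..t, G s with hN
  have hu : uIcc 0 T = Icc 0 T := uIcc_of_le hT.le
  have hWac : AbsolutelyContinuousOnInterval W 0 T :=
    hF.absolutelyContinuousOnInterval_intervalIntegral (by simp)
  have hNac : AbsolutelyContinuousOnInterval N 0 T :=
    (contDiff_const.contDiffOn.absolutelyContinuousOnInterval).fun_add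
      (hG.absolutelyContinuousOnInterval_intervalIntegral (by simp))
  have hN0 : ∀ t ∈ uIcc 0 T, 0 ≤ N t := by
    have hc := hNac.continuousOn
    rw [hu] at hc ⊢
    by_contra! hcon
    obtain ⟨t, ht, hlt⟩ := hcon
    have hev := hc t ht (Iio_mem_nhds hlt)
    rw [Filter.mem_map, mem_nhdsWithin] at hev
    obtain ⟨O, hO, htO, hsub⟩ := hev
    have hz : volume (O ∩ Icc 0 T) = 0 := by
      have : ∀ᵐ s ∂(volume.restrict (Icc 0 T)), s ∉ O := by
        filter_upwards [hm, ae_restrict_mem measurableSet_Icc] with s hs hsI hsO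
        have h1 : N s < 0 := hsub ⟨hsO, hsI⟩
        have h2 := hm_nonneg s
        rw [hs] at h2
        exact absurd h1 (not_lt.2 h2)
      rw [ae_iff] at this
      simpa [Measure.restrict_apply hO.measurableSet] using this
    have hcl : t ∈ closure (interior (Icc 0 T)) := by
      rw [interior_Icc, closure_Ioo hT.ne]; exact ht
    obtain ⟨s, hsO, hsI⟩ := mem_closure_iff.1 hcl O hO htO
    have hpos := (hO.inter isOpen_interior).measure_pos (μ := (volume : Measure ℝ)) ⟨s, hsO, hsI⟩
    exact hpos.ne' (measure_mono_null (inter_subset_inter_right _ interior_subset) hz)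
  have hDac : AbsolutelyContinuousOnInterval (fun t => N t + δ) 0 T :=
    hNac.fun_add contDiff_const.contDiffOn.absolutelyContinuousOnInterval
  have hIac := hDac.inv_of_le hδ fun t ht => by linarith [hN0 t ht]
  set Z : ℝ → ℝ := fun t => N t - W t * W t * (N t + δ)⁻¹ with hZ
  have hZac : AbsolutelyContinuousOnInterval Z 0 T :=
    hNac.fun_sub ((hWac.fun_mul hWac).fun_mul hIac)
  have hlin : AbsolutelyContinuousOnInterval (fun t : ℝ => T - t) 0 T :=
    ((contDiff_const.sub contDiff_id).contDiffOn).absolutelyContinuousOnInterval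
  have key := hlin.integral_mul_deriv_eq_deriv_mul hZac
  have hZ0 : Z 0 = m₀ := by simp [hZ, hW, hN]
  have hd : ∀ t : ℝ, deriv (fun t : ℝ => T - t) t = -1 := fun t => by
    simp
  simp only [hd, hZ0, sub_self, zero_mul, sub_zero, neg_one_mul, intervalIntegral.integral_neg]
    at key
  rw [intervalIntegral.integral_of_le hT.le, intervalIntegral.integral_of_le hT.le,
    ← integral_Icc_eq_integral_Ioc, ← integral_Icc_eq_integral_Ioc] at key
  have e1 : ∫ t in Icc 0 T, (m t - w t ^ 2 / (m t + δ)) = ∫ t in Icc 0 T, Z t := by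
    refine integral_congr_ae ?_
    filter_upwards [hw, hm] with t h1 h2
    simp only [hZ, hW, hN, h1, h2]
    rw [div_eq_mul_inv, sq]
  have e2 : ∫ t in Icc 0 T, (T - t) *
          ((1 + (w t / (m t + δ)) ^ 2) * G t - 2 * (w t / (m t + δ)) * F t)
      = ∫ t in Icc 0 T, (T - t) * deriv Z t := by
    refine integral_congr_ae ?_
    have hFd := ae_restrict_of_ae (s := Icc 0 T) hF.ae_hasDerivAt_integral
    have hGd := ae_restrict_of_ae (s := Icc 0 T) hG.ae_hasDerivAt_integral
    filter_upwards [hw, hm, hFd, hGd, ae_restrict_mem measurableSet_Icc] with t h1 h2 h3 h4 ht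
    rw [hu] at h3 h4
    have hWd : HasDerivAt W (F t) t := h3 ht 0 ⟨le_rfl, hT.le⟩
    have hNd : HasDerivAt N (G t) t := (h4 ht 0 ⟨le_rfl, hT.le⟩).const_add m₀
    have hpos : N t + δ ≠ 0 := by linarith [hN0 t (hu ▸ ht)]
    have hZd := hNd.sub ((hWd.mul hWd).mul ((hNd.add_const δ).inv hpos))
    have : deriv Z t = _ := hZd.deriv
    rw [this]
    have h1' : w t = W t := h1
    have h2' : m t = N t := h2
    rw [h1', h2']
    simp only [Pi.mul_apply, Pi.inv_apply]
    field_simp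
    ring
  rw [e1, e2]
  linarith

section PartialDerivatives
variable {d : ℕ}

theorem pd2_eq (i j : Fin d) (φ : Rd d → ℝ) : pd2 i j φ = pd i (pd j φ) := rfl

theorem ContDiff.pd {n m : WithTop ℕ∞} {φ : Rd d → ℝ} (hφ : ContDiff ℝ n φ) (hmn : m + 1 ≤ n)
    (i : Fin d) : ContDiff ℝ m (pd i φ) :=
  (hφ.fderiv_right hmn).clm_apply contDiff_const

theorem support_pd_subset (i : Fin d) (φ : Rd d → ℝ) :
    Function.support (pd i φ) ⊆ tsupport φ := by
  intro x hx
  by_contra h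
  exact hx (by simp [pd, fderiv_of_notMem_tsupport ℝ h])

theorem tsupport_pd_subset (i : Fin d) (φ : Rd d → ℝ) : tsupport (pd i φ) ⊆ tsupport φ :=
  closure_minimal (support_pd_subset i φ) (isClosed_tsupport φ)

theorem HasCompactSupport.pd {φ : Rd d → ℝ} (h : HasCompactSupport φ) (i : Fin d) :
    HasCompactSupport (pd i φ) :=
  h.of_isClosed_subset (isClosed_tsupport _) (tsupport_pd_subset i φ)

theorem pd_mul {f g : Rd d → ℝ} {x : Rd d} (i : Fin d) (hf : DifferentiableAt ℝ f x)
    (hg : DifferentiableAt ℝ g x) :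
    pd i (fun y => f y * g y) x = pd i f x * g x + f x * pd i g x := by
  simp only [pd]
  rw [fderiv_fun_mul hf hg]
  simp [mul_comm, add_comm]

theorem pd_comp_sub_right (i : Fin d) (f : Rd d → ℝ) (y : Rd d) :
    pd i (fun x => f (x - y)) = fun x => pd i f (x - y) := by
  funext x
  simp only [pd]
  rw [fderiv_comp_sub]

theorem pd_comp_sub_left (i : Fin d) {f : Rd d → ℝ} (hf : Differentiable ℝ f) (x : Rd d) :
    pd i (fun y => f (x - y)) = fun y => -pd i f (x - y) := by
  funext y
  simp only [pd]
  have h : HasFDerivAt (fun y => f (x - y))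
      ((fderiv ℝ f (x - y)).comp (-(ContinuousLinearMap.id ℝ (Rd d)))) y :=
    (hf (x - y)).hasFDerivAt.comp y ((hasFDerivAt_id y).const_sub x)
  rw [h.fderiv]
  simp

/-- Integration by parts against a compactly supported factor. -/
theorem integral_mul_pd_eq_neg {f g : Rd d → ℝ} (hf : ContDiff ℝ 1 f) (hg : ContDiff ℝ 1 g)
    (hfc : HasCompactSupport f) (i : Fin d) :
    ∫ x, f x * pd i g x = -∫ x, pd i f x * g x := by
  have cf := hf.continuous
  have cg := hg.continuous
  have cf' : Continuous (pd i f) := (hf.pd (m := 0) (by simp) i).continuous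
  have cg' : Continuous (pd i g) := (hg.pd (m := 0) (by simp) i).continuous
  exact integral_mul_fderiv_eq_neg_fderiv_mul_of_integrable
    ((cf'.mul cg).integrable_of_hasCompactSupport (hfc.pd i).mul_right)
    ((cf.mul cg').integrable_of_hasCompactSupport hfc.mul_right)
    ((cf.mul cg).integrable_of_hasCompactSupport hfc.mul_right)
    (fun x _ => hf.differentiable one_ne_zero x) (fun x _ => hg.differentiable one_ne_zero x)

/-- Double integration by parts in which only one derivative lands on the `C¹` factor `q`. -/
theorem integral_mul_mul_pd2 {φ q g : Rd d → ℝ} (hφ : ContDiff ℝ 2 φ) (hφc : HasCompactSupport φ)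
    (hq : ContDiff ℝ 1 q) (hg : ContDiff ℝ 2 g) (i j : Fin d) :
    ∫ x, φ x * q x * pd2 i j g x
      = (∫ x, (pd2 j i φ x * q x + pd i φ x * pd j q x) * g x)
        - ∫ x, φ x * pd i q x * pd j g x := by
  have hφ1 : ContDiff ℝ 1 φ := hφ.of_le (by norm_num)
  have hdφ : ContDiff ℝ 1 (pd i φ) := hφ.pd (by norm_num) i
  have hdg : ContDiff ℝ 1 (pd j g) := hg.pd (by norm_num) j
  have dφ : Differentiable ℝ φ := hφ1.differentiable one_ne_zero
  have dq : Differentiable ℝ q := hq.differentiable one_ne_zero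
  have ddφ : Differentiable ℝ (pd i φ) := hdφ.differentiable one_ne_zero
  have cq' : Continuous (pd i q) := (hq.pd (m := 0) (by simp) i).continuous
  have h1 := integral_mul_pd_eq_neg (hφ1.mul hq) hdg hφc.mul_right i
  have h2 := integral_mul_pd_eq_neg (hdφ.mul hq) (hg.of_le (by norm_num)) (hφc.pd i).mul_right j
  have e1 : ∀ x, pd i (fun y => φ y * q y) x = pd i φ x * q x + φ x * pd i q x := fun x =>
    pd_mul i (dφ x) (dq x)
  have e2 : ∀ x, pd j (fun y => pd i φ y * q y) x = pd j (pd i φ) x * q x + pd i φ x * pd j q x :=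
    fun x => pd_mul j (ddφ x) (dq x)
  simp only [e1] at h1
  simp only [e2] at h2
  rw [pd2_eq, pd2_eq, h1, ← neg_eq_iff_eq_neg.2 h2, ← neg_add', neg_inj, ← integral_add]
  · exact integral_congr_ae (Filter.Eventually.of_forall fun x => by ring)
  · exact ((hdφ.continuous.mul hq.continuous).mul hdg.continuous).integrable_of_hasCompactSupport
      (hφc.pd i).mul_right.mul_right
  · exact ((hφ.continuous.mul cq').mul hdg.continuous).integrable_of_hasCompactSupport
      hφc.mul_right.mul_right

end PartialDerivatives

section Mollification
variable {d : ℕ}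

theorem exists_abs_le_of_hasCompactSupport {X : Type*} [TopologicalSpace X] {f : X → ℝ}
    (hf : Continuous f) (hfc : HasCompactSupport f) : ∃ C, 0 ≤ C ∧ ∀ x, |f x| ≤ C := by
  obtain ⟨C, hC⟩ := hfc.exists_bound_of_continuous hf
  exact ⟨max C 0, le_max_right _ _, fun x => (hC x).trans (le_max_left _ _)⟩

theorem integrable_comp_sub_mul {μ : Measure (Rd d)} {f g : Rd d → ℝ} (hf : Continuous f)
    (hfc : HasCompactSupport f) (hg : Integrable g μ) (x : Rd d) :
    Integrable (fun y => f (x - y) * g y) μ := by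
  obtain ⟨C, -, hC⟩ := exists_abs_le_of_hasCompactSupport hf hfc
  exact hg.bdd_mul (c := C) (hf.comp (continuous_const.sub continuous_id)).aestronglyMeasurable
    (Filter.Eventually.of_forall fun y => hC (x - y))

theorem contDiff_integral_comp_sub_mul {μ : Measure (Rd d)} {f g : Rd d → ℝ} {n : ℕ∞}
    (hf : ContDiff ℝ n f) (hfc : HasCompactSupport f) (hg : Integrable g μ) :
    ContDiff ℝ n (fun x => ∫ y, f (x - y) * g y ∂μ) := by
  have := hfc.contDiff_convolution_right (ContinuousLinearMap.mul ℝ ℝ)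
    hg.locallyIntegrable hf
  convert this using 2 with x
  simp [convolution_def, mul_comm]

theorem pd_integral_comp_sub_mul {μ : Measure (Rd d)} {f g : Rd d → ℝ} (hf : ContDiff ℝ 1 f)
    (hfc : HasCompactSupport f) (hg : Integrable g μ) (i : Fin d) (x : Rd d) :
    pd i (fun x => ∫ y, f (x - y) * g y ∂μ) x = ∫ y, pd i f (x - y) * g y ∂μ := by
  have hf' : Continuous (fderiv ℝ f) := hf.continuous_fderiv one_ne_zero
  obtain ⟨C, hC⟩ := (hfc.fderiv (𝕜 := ℝ)).exists_bound_of_continuous hf'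
  have hInt : Integrable (fun y => g y • fderiv ℝ f (x - y)) μ :=
    hg.smul_bdd C (hf'.comp (continuous_const.sub continuous_id)).aestronglyMeasurable
      (Filter.Eventually.of_forall fun y => hC (x - y))
  have h := hasFDerivAt_integral_of_dominated_of_fderiv_le (μ := μ) (𝕜 := ℝ)
    (F := fun x y => f (x - y) * g y) (F' := fun x y => g y • fderiv ℝ f (x - y)) (x₀ := x)
    (bound := fun y => |g y| * C) (s := univ) Filter.univ_mem
    (Filter.Eventually.of_forall fun z =>
      (integrable_comp_sub_mul hf.continuous hfc hg z).aestronglyMeasurable)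
    (integrable_comp_sub_mul hf.continuous hfc hg x) hInt.aestronglyMeasurable
    (Filter.Eventually.of_forall fun y z _ => by
      rw [norm_smul, Real.norm_eq_abs]
      exact mul_le_mul_of_nonneg_left (hC _) (abs_nonneg _))
    (hg.abs.mul_const C)
    (Filter.Eventually.of_forall fun y z _ => by
      have h1 : HasFDerivAt (fun z => f (z - y)) (fderiv ℝ f (z - y)) z := by
        exact (hf.differentiable one_ne_zero (z - y)).hasFDerivAt.comp z
          ((hasFDerivAt_id z).sub_const y)
      exact h1.mul_const (g y))
  rw [pd, h.fderiv, ContinuousLinearMap.integral_apply hInt]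
  exact integral_congr_ae (Filter.Eventually.of_forall fun y => by simp [pd, mul_comm])

/-- Mollification `x ↦ ∫ f(x - y) g(t,y) m_t(dy)` of the path of measures `g m`. -/
def moll (m : Kernel ℝ (Rd d)) (f : Rd d → ℝ) (g : ℝ × Rd d → ℝ) (t : ℝ) (x : Rd d) : ℝ :=
  ∫ y, f (x - y) * g (t, y) ∂(m t)

variable {m : Kernel ℝ (Rd d)} [IsFiniteKernel m]

theorem integrable_slice {μ : Measure (Rd d)} [IsFiniteMeasure μ] {g : ℝ × Rd d → ℝ}
    (hg : Measurable g) (hg1 : ∀ z, |g z| ≤ 1) (t : ℝ) : Integrable (fun y => g (t, y)) μ :=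
  Integrable.of_bound (hg.comp measurable_prodMk_left).aestronglyMeasurable 1
    (Filter.Eventually.of_forall fun y => hg1 (t, y))

theorem measurable_moll {f : Rd d → ℝ} {g : ℝ × Rd d → ℝ} (hf : Continuous f) (hg : Measurable g) :
    Measurable (fun q : ℝ × Rd d => moll m f g q.1 q.2) := by
  have h : Measurable fun p : (ℝ × Rd d) × Rd d => f (p.1.2 - p.2) * g (p.1.1, p.2) := by
    have := hf.measurable
    fun_prop
  exact (h.stronglyMeasurable.integral_kernel_prod_right'
    (κ := Kernel.prodMkRight (Rd d) m)).measurable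

theorem abs_moll_le {f : Rd d → ℝ} {g : ℝ × Rd d → ℝ} {C : ℝ}
    (hfC : ∀ x, |f x| ≤ C) (hg1 : ∀ z, |g z| ≤ 1) (t : ℝ) (x : Rd d) :
    |moll m f g t x| ≤ C * (m t).real univ := by
  have hC : 0 ≤ C := (abs_nonneg _).trans (hfC x)
  refine norm_integral_le_of_norm_le_const (μ := m t) (f := fun y => f (x - y) * g (t, y))
    (Filter.Eventually.of_forall fun y => ?_)
  rw [norm_mul]
  exact (mul_le_mul (hfC _) (hg1 _) (abs_nonneg _) hC).trans_eq (mul_one C)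

theorem exists_abs_moll_le (m : Kernel ℝ (Rd d)) [IsFiniteKernel m] {f : Rd d → ℝ}
    (hf : Continuous f) (hfc : HasCompactSupport f) :
    ∃ C, 0 ≤ C ∧ ∀ g : ℝ × Rd d → ℝ, (∀ z, |g z| ≤ 1) → ∀ t x, |moll m f g t x| ≤ C := by
  obtain ⟨C, hC0, hC⟩ := exists_abs_le_of_hasCompactSupport hf hfc
  refine ⟨C * m.bound.toReal, by positivity, fun g hg t x => (abs_moll_le hC hg t x).trans ?_⟩
  refine mul_le_mul_of_nonneg_left ?_ hC0
  exact ENNReal.toReal_mono (Kernel.bound_ne_top m) (Kernel.measure_le_bound m t univ)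

/-- The regularised density ratio `∫ ω(x - y) u(t,y) m_t(dy) / (∫ ω(x - y) m_t(dy) + δ)`. -/
def mollRatio (m : Kernel ℝ (Rd d)) (ω : Rd d → ℝ) (u : ℝ × Rd d → ℝ) (δ t : ℝ) (x : Rd d) : ℝ :=
  moll m ω u t x / (moll m ω (fun _ => 1) t x + δ)

/-- The `i`-th partial derivative of `mollRatio`. -/
def mollRatioGrad (m : Kernel ℝ (Rd d)) (ω : Rd d → ℝ) (u : ℝ × Rd d → ℝ) (δ : ℝ) (i : Fin d)
    (t : ℝ) (x : Rd d) : ℝ :=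
  (moll m (pd i ω) u t x - mollRatio m ω u δ t x * moll m (pd i ω) (fun _ => 1) t x)
    / (moll m ω (fun _ => 1) t x + δ)

variable {ω : Rd d → ℝ} {u : ℝ × Rd d → ℝ} {δ : ℝ}

omit [IsFiniteKernel m] in
theorem moll_one_nonneg (hω0 : ∀ x, 0 ≤ ω x) (t : ℝ) (x : Rd d) :
    0 ≤ moll m ω (fun _ => 1) t x :=
  integral_nonneg fun _ => mul_nonneg (hω0 _) zero_le_one

omit [IsFiniteKernel m] in
theorem moll_one_add_pos (hω0 : ∀ x, 0 ≤ ω x) (hδ : 0 < δ) (t : ℝ) (x : Rd d) :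
    0 < moll m ω (fun _ => 1) t x + δ :=
  add_pos_of_nonneg_of_pos (moll_one_nonneg hω0 t x) hδ

theorem abs_moll_le_moll_one (hωc : Continuous ω) (hωs : HasCompactSupport ω) (hω0 : ∀ x, 0 ≤ ω x)
    (hu1 : ∀ z, |u z| ≤ 1) (t : ℝ) (x : Rd d) :
    |moll m ω u t x| ≤ moll m ω (fun _ => 1) t x := by
  refine norm_integral_le_of_norm_le (μ := m t) (f := fun y => ω (x - y) * u (t, y))
    (integrable_comp_sub_mul hωc hωs (integrable_const 1) x)
    (Filter.Eventually.of_forall fun y => ?_)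
  rw [norm_mul, Real.norm_of_nonneg (hω0 _)]
  exact mul_le_mul_of_nonneg_left (hu1 _) (hω0 _)

theorem abs_mollRatio_le_one (hωc : Continuous ω) (hωs : HasCompactSupport ω) (hω0 : ∀ x, 0 ≤ ω x)
    (hu1 : ∀ z, |u z| ≤ 1) (hδ : 0 < δ) (t : ℝ) (x : Rd d) :
    |mollRatio m ω u δ t x| ≤ 1 := by
  have h := moll_one_add_pos (m := m) hω0 hδ t x
  rw [mollRatio, abs_div, abs_of_pos h, div_le_one h]
  linarith [abs_moll_le_moll_one (m := m) hωc hωs hω0 hu1 t x]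

theorem measurable_mollRatio (hωc : Continuous ω) (hu : Measurable u) :
    Measurable (fun q : ℝ × Rd d => mollRatio m ω u δ q.1 q.2) :=
  (measurable_moll hωc hu).div ((measurable_moll hωc measurable_const).add_const δ)

theorem measurable_mollRatioGrad (hω : ContDiff ℝ 1 ω) (hu : Measurable u) (i : Fin d) :
    Measurable (fun q : ℝ × Rd d => mollRatioGrad m ω u δ i q.1 q.2) := by
  have hω' : Continuous (pd i ω) := (hω.pd (m := 0) (by simp) i).continuous
  exact ((measurable_moll hω' hu).sub ((measurable_mollRatio hω.continuous hu).mul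
    (measurable_moll hω' measurable_const))).div
    ((measurable_moll hω.continuous measurable_const).add_const δ)

theorem contDiff_mollRatio (hω : ContDiff ℝ 1 ω) (hωs : HasCompactSupport ω)
    (hω0 : ∀ x, 0 ≤ ω x) (hu : Measurable u) (hu1 : ∀ z, |u z| ≤ 1) (hδ : 0 < δ) (t : ℝ) :
    ContDiff ℝ 1 (mollRatio m ω u δ t) :=
  (contDiff_integral_comp_sub_mul (n := 1) hω hωs (integrable_slice hu hu1 t)).div
    ((contDiff_integral_comp_sub_mul (n := 1) hω hωs (integrable_const 1)).add contDiff_const)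
    fun x => (moll_one_add_pos hω0 hδ t x).ne'

theorem pd_mollRatio (hω : ContDiff ℝ 1 ω) (hωs : HasCompactSupport ω)
    (hω0 : ∀ x, 0 ≤ ω x) (hu : Measurable u) (hu1 : ∀ z, |u z| ≤ 1) (hδ : 0 < δ) (i : Fin d)
    (t : ℝ) (x : Rd d) :
    pd i (mollRatio m ω u δ t) x = mollRatioGrad m ω u δ i t x := by
  have hne := (moll_one_add_pos (m := m) hω0 hδ t x).ne'
  have dU : DifferentiableAt ℝ (mollRatio m ω u δ t) x :=
    (contDiff_mollRatio hω hωs hω0 hu hu1 hδ t).differentiable one_ne_zero x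
  have h1 : ContDiff ℝ 1 (moll m ω (fun _ => 1) t) :=
    contDiff_integral_comp_sub_mul (n := 1) hω hωs (integrable_const 1)
  have d1 : DifferentiableAt ℝ (fun y => moll m ω (fun _ => 1) t y + δ) x :=
    (h1.differentiable one_ne_zero x).add_const δ
  have key := pd_mul i dU d1
  have e : (fun y => mollRatio m ω u δ t y * (moll m ω (fun _ => 1) t y + δ))
      = moll m ω u t := by
    funext y
    rw [mollRatio, div_mul_cancel₀ _ (moll_one_add_pos hω0 hδ t y).ne']
  have e1 : pd i (fun y => moll m ω (fun _ => 1) t y + δ) x = moll m (pd i ω) (fun _ => 1) t x := by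
    rw [pd, fderiv_add_const]
    exact pd_integral_comp_sub_mul hω hωs (integrable_const 1) i x
  have e2 : pd i (moll m ω u t) x = moll m (pd i ω) u t x :=
    pd_integral_comp_sub_mul hω hωs (integrable_slice hu hu1 t) i x
  rw [e, e1, e2] at key
  rw [mollRatioGrad, eq_div_iff hne, key]
  ring

theorem exists_abs_mollRatioGrad_le (m : Kernel ℝ (Rd d)) [IsFiniteKernel m]
    (hω : ContDiff ℝ 1 ω) (hωs : HasCompactSupport ω)
    (hω0 : ∀ x, 0 ≤ ω x) (hu1 : ∀ z, |u z| ≤ 1) (hδ : 0 < δ) (i : Fin d) :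
    ∃ C, 0 ≤ C ∧ ∀ t x, |mollRatioGrad m ω u δ i t x| ≤ C := by
  obtain ⟨C, hC0, hC⟩ := exists_abs_moll_le m (hω.pd (m := 0) (by simp) i).continuous (hωs.pd i)
  refine ⟨(C + C) / δ, by positivity, fun t x => ?_⟩
  have h := moll_one_add_pos (m := m) hω0 hδ t x
  rw [mollRatioGrad, abs_div, abs_of_pos h]
  refine div_le_div₀ (by positivity) ?_ hδ (by linarith [moll_one_nonneg (m := m) hω0 t x])
  refine (abs_sub _ _).trans (add_le_add (hC u hu1 t x) ?_)
  rw [abs_mul]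
  exact (mul_le_mul (abs_mollRatio_le_one hω.continuous hωs hω0 hu1 hδ t x)
    (hC _ (by simp) t x) (abs_nonneg _) zero_le_one).trans_eq (one_mul C)

/-- The polynomial `1 - 2 U u + U²` attached to the regularised ratio `U`. -/
def mollQuad (m : Kernel ℝ (Rd d)) (ω : Rd d → ℝ) (u : ℝ × Rd d → ℝ) (δ t : ℝ) (x y : Rd d) : ℝ :=
  1 - 2 * mollRatio m ω u δ t x * u (t, y) + mollRatio m ω u δ t x ^ 2

omit [IsFiniteKernel m] in
theorem mollQuad_eq (t : ℝ) (x y : Rd d) : mollQuad m ω u δ t x y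
    = (1 - u (t, y) ^ 2) + (u (t, y) - mollRatio m ω u δ t x) ^ 2 := by
  rw [mollQuad]; ring

theorem integral_comp_sub_mul_quadratic (hωc : Continuous ω) (hωs : HasCompactSupport ω)
    (hu : Measurable u) (hu1 : ∀ z, |u z| ≤ 1) (t : ℝ) (x : Rd d) (p q r : ℝ) :
    ∫ y, ω (x - y) * (p + q * u (t, y) + r * u (t, y) ^ 2) ∂(m t)
      = p * moll m ω (fun _ => 1) t x + q * moll m ω u t x
        + r * moll m ω (fun z => u z ^ 2) t x := by
  have i1 := integrable_comp_sub_mul (μ := m t) hωc hωs (integrable_const (1 : ℝ)) x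
  have i2 := integrable_comp_sub_mul (μ := m t) hωc hωs (integrable_slice hu hu1 t) x
  have i3 := integrable_comp_sub_mul (μ := m t) hωc hωs (integrable_slice (hu.pow_const 2)
    (fun z => by simpa using hu1 z) t) x
  simp only [moll]
  rw [← integral_const_mul, ← integral_const_mul, ← integral_const_mul,
    ← integral_add (i1.const_mul p) (i2.const_mul q),
    ← integral_add (f := fun y => p * (ω (x - y) * 1) + q * (ω (x - y) * u (t, y)))
      ((i1.const_mul p).add (i2.const_mul q)) (i3.const_mul r)]
  exact integral_congr_ae (Filter.Eventually.of_forall fun y => by ring)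

theorem moll_sub_sq_div_eq (hωc : Continuous ω) (hωs : HasCompactSupport ω) (hω0 : ∀ x, 0 ≤ ω x)
    (hu : Measurable u) (hu1 : ∀ z, |u z| ≤ 1) (hδ : 0 < δ) (t : ℝ) (x : Rd d) :
    moll m ω (fun _ => 1) t x - moll m ω u t x ^ 2 / (moll m ω (fun _ => 1) t x + δ)
      = ∫ y, ω (x - y) * mollQuad m ω u δ t x y ∂(m t) + δ * mollRatio m ω u δ t x ^ 2 := by
  have h := integral_comp_sub_mul_quadratic (m := m) hωc hωs hu hu1 t x
    (1 + mollRatio m ω u δ t x ^ 2) (-2 * mollRatio m ω u δ t x) 0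
  have e : ∀ y, ω (x - y) * mollQuad m ω u δ t x y
      = ω (x - y) * ((1 + mollRatio m ω u δ t x ^ 2) + -2 * mollRatio m ω u δ t x * u (t, y)
        + 0 * u (t, y) ^ 2) := fun y => by rw [mollQuad]; ring
  simp only [e, h]
  have hne := (moll_one_add_pos (m := m) hω0 hδ t x).ne'
  rw [mollRatio]
  field_simp
  ring

/-- `mollRatio` minimises the penalised quadratic functional. -/
theorem integral_mul_sub_mollRatio_sq_le (hωc : Continuous ω) (hωs : HasCompactSupport ω)
    (hω0 : ∀ x, 0 ≤ ω x) (hu : Measurable u) (hu1 : ∀ z, |u z| ≤ 1) (hδ : 0 < δ) (t : ℝ) (x : Rd d)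
    (v : ℝ) :
    ∫ y, ω (x - y) * (u (t, y) - mollRatio m ω u δ t x) ^ 2 ∂(m t)
      ≤ ∫ y, ω (x - y) * (u (t, y) - v) ^ 2 ∂(m t) + δ * v ^ 2 := by
  have h : ∀ v, ∫ y, ω (x - y) * (u (t, y) - v) ^ 2 ∂(m t)
      = v ^ 2 * moll m ω (fun _ => 1) t x + (-2 * v) * moll m ω u t x
        + 1 * moll m ω (fun z => u z ^ 2) t x := fun v => by
    rw [← integral_comp_sub_mul_quadratic hωc hωs hu hu1]
    exact integral_congr_ae (Filter.Eventually.of_forall fun y => by ring)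
  rw [h, h]
  have hpos := moll_one_add_pos (m := m) hω0 hδ t x
  have e : moll m ω u t x = mollRatio m ω u δ t x * (moll m ω (fun _ => 1) t x + δ) := by
    rw [mollRatio, div_mul_cancel₀ _ hpos.ne']
  rw [e]
  nlinarith [mul_nonneg hpos.le (sq_nonneg (v - mollRatio m ω u δ t x)),
    mul_nonneg hδ.le (sq_nonneg (mollRatio m ω u δ t x))]

theorem integral_pd_mul_sub_mollRatio (hω : ContDiff ℝ 1 ω) (hωs : HasCompactSupport ω)
    (hω0 : ∀ x, 0 ≤ ω x) (hu : Measurable u) (hu1 : ∀ z, |u z| ≤ 1) (hδ : 0 < δ) (i : Fin d)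
    (t : ℝ) (x : Rd d) :
    ∫ y, pd i ω (x - y) * (u (t, y) - mollRatio m ω u δ t x) ∂(m t)
      = (moll m ω (fun _ => 1) t x + δ) * mollRatioGrad m ω u δ i t x := by
  have h := integral_comp_sub_mul_quadratic (m := m) (hω.pd (m := 0) (by simp) i).continuous
    (hωs.pd i) hu hu1 t x (-mollRatio m ω u δ t x) 1 0
  have e : ∀ y, pd i ω (x - y) * (u (t, y) - mollRatio m ω u δ t x)
      = pd i ω (x - y) * (-mollRatio m ω u δ t x + 1 * u (t, y) + 0 * u (t, y) ^ 2) :=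
    fun y => by ring
  simp only [e, h]
  rw [mollRatioGrad, mul_div_cancel₀ _ (moll_one_add_pos (m := m) hω0 hδ t x).ne']
  ring

end Mollification

section Fubini
variable {d : ℕ} {σ : Measure ℝ} [IsFiniteMeasure σ] {m : Kernel ℝ (Rd d)} [IsFiniteKernel m]

/-- The exchange `((t, y), x) ↦ ((t, x), y)` of the two space variables. -/
def swapSpace (d : ℕ) : (ℝ × Rd d) × Rd d ≃ᵐ (ℝ × Rd d) × Rd d :=
  MeasurableEquiv.ofInvolutive (fun p => ((p.1.1, p.2), p.1.2)) (fun _ => rfl) (by fun_prop)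

theorem measurePreserving_swapSpace :
    MeasurePreserving (swapSpace d) ((σ ⊗ₘ m).prod volume)
      ((σ.prod volume) ⊗ₘ (Kernel.prodMkRight (Rd d) m)) := by
  refine ⟨(swapSpace d).measurable, Measure.ext_of_lintegral _ fun f hf => ?_⟩
  have hfs : Measurable fun p => f (swapSpace d p) := hf.comp (swapSpace d).measurable
  rw [lintegral_map hf (swapSpace d).measurable, lintegral_prod _ hfs.aemeasurable,
    Measure.lintegral_compProd hfs.lintegral_prod_right',
    Measure.lintegral_compProd hf, lintegral_prod _ (hf.lintegral_kernel_prod_right'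
      (κ := Kernel.prodMkRight (Rd d) m)).aemeasurable]
  refine lintegral_congr fun t => ?_
  rw [lintegral_lintegral_swap]
  · rfl
  · exact (hfs.comp (by fun_prop :
      Measurable fun q : Rd d × Rd d => ((t, q.1), q.2))).aemeasurable

theorem measurePreserving_swapSpace_symm :
    MeasurePreserving (swapSpace d) ((σ.prod volume) ⊗ₘ (Kernel.prodMkRight (Rd d) m))
      ((σ ⊗ₘ m).prod volume) :=
  (measurePreserving_swapSpace (σ := σ) (m := m)).symm

variable {f : (ℝ × Rd d) × Rd d → ℝ}

theorem integrable_swapSpace (hf : Integrable f ((σ ⊗ₘ m).prod volume)) :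
    Integrable (fun q : (ℝ × Rd d) × Rd d => f ((q.1.1, q.2), q.1.2))
      ((σ.prod volume) ⊗ₘ (Kernel.prodMkRight (Rd d) m)) :=
  (measurePreserving_swapSpace_symm.integrable_comp_emb (swapSpace d).measurableEmbedding).2 hf

theorem integrable_integral_swapSpace (hf : Integrable f ((σ ⊗ₘ m).prod volume)) :
    Integrable (fun q : ℝ × Rd d => ∫ y, f ((q.1, y), q.2) ∂(m q.1)) (σ.prod volume) :=
  Integrable.integral_compProd (κ := Kernel.const Unit (σ.prod volume))
    (η := Kernel.prodMkLeft Unit (Kernel.prodMkRight (Rd d) m)) (a := ()) (integrable_swapSpace hf)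

theorem ae_integrable_swapSpace (hf : Integrable f ((σ ⊗ₘ m).prod volume)) :
    ∀ᵐ q : ℝ × Rd d ∂(σ.prod volume), Integrable (fun y => f ((q.1, y), q.2)) (m q.1) :=
  (Measure.integrable_compProd_iff (integrable_swapSpace hf).1).1 (integrable_swapSpace hf) |>.1

theorem integral_swapSpace (hf : Integrable f ((σ ⊗ₘ m).prod volume)) :
    ∫ p, f p ∂((σ ⊗ₘ m).prod volume)
      = ∫ q : ℝ × Rd d, ∫ y, f ((q.1, y), q.2) ∂(m q.1) ∂(σ.prod volume) := by
  rw [← (measurePreserving_swapSpace_symm (σ := σ) (m := m)).integral_comp' f]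
  exact Measure.integral_compProd (integrable_swapSpace hf)

end Fubini

section ConvolutionIntegrability
variable {d : ℕ} {M : Measure (ℝ × Rd d)} [SFinite M]

theorem integrable_mul_comp_sub {g : ℝ × Rd d → ℝ} {k : Rd d → ℝ} (hg : Integrable g M)
    (hk : Integrable k volume) :
    Integrable (fun p : (ℝ × Rd d) × Rd d => g p.1 * k (p.2 - p.1.2)) (M.prod volume) := by
  have hshear : MeasurePreserving (fun p : (ℝ × Rd d) × Rd d => (p.1, p.2 - p.1.2))
      (M.prod volume) (M.prod volume) :=
    (MeasurePreserving.id M).skew_product (g := fun z x => x - z.2) (by fun_prop)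
      (Filter.Eventually.of_forall fun z => (measurePreserving_sub_right volume z.2).map_eq)
  exact hshear.integrable_comp_of_integrable (hg.mul_prod hk)

end ConvolutionIntegrability

section Dilation
variable {d : ℕ}

/-- The `L¹`-normalised dilation `z ↦ s^d k(s z)`. -/
def dil (s : ℝ) (k : Rd d → ℝ) (z : Rd d) : ℝ := s ^ d * k (s • z)

theorem Continuous.dil {k : Rd d → ℝ} (hk : Continuous k) (s : ℝ) : Continuous (dil s k) := by
  unfold _root_.dil; fun_prop

theorem ContDiff.dil {n : WithTop ℕ∞} {k : Rd d → ℝ} (hk : ContDiff ℝ n k) (s : ℝ) :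
    ContDiff ℝ n (dil s k) :=
  contDiff_const.mul (hk.comp (contDiff_const_smul s))

theorem HasCompactSupport.dil {k : Rd d → ℝ} (hk : HasCompactSupport k) {s : ℝ} (hs : 0 < s) :
    HasCompactSupport (dil s k) :=
  (hk.comp_homeomorph (Homeomorph.smulOfNeZero s hs.ne')).mul_left

theorem dil_nonneg {k : Rd d → ℝ} (hk : ∀ z, 0 ≤ k z) {s : ℝ} (hs : 0 < s) (z : Rd d) :
    0 ≤ dil s k z := mul_nonneg (by positivity) (hk _)

theorem integral_dil (k : Rd d → ℝ) {s : ℝ} (hs : 0 < s) : ∫ z, dil s k z = ∫ z, k z := by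
  simp only [dil]
  rw [integral_const_mul, Measure.integral_comp_smul, finrank_euclideanSpace_fin,
    abs_of_nonneg (by positivity), smul_eq_mul, mul_inv_cancel_left₀ (by positivity)]

theorem MeasureTheory.Integrable.dil {k : Rd d → ℝ} (hk : Integrable k volume) {s : ℝ}
    (hs : 0 < s) : Integrable (dil s k) volume :=
  (hk.comp_smul hs.ne').const_mul _

theorem dil_eq_zero {k : Rd d → ℝ} (hk : ∀ z, 1 < ‖z‖ → k z = 0) {s : ℝ} (hs : 0 < s) {z : Rd d}
    (hz : 1 / s < ‖z‖) : dil s k z = 0 := by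
  rw [dil, hk, mul_zero]
  rw [norm_smul, Real.norm_of_nonneg hs.le]
  rwa [div_lt_iff₀' hs] at hz

theorem pd_dil (i : Fin d) {k : Rd d → ℝ} (hk : Differentiable ℝ k) (s : ℝ) (z : Rd d) :
    pd i (dil s k) z = s ^ d * (s * pd i k (s • z)) := by
  have h : HasFDerivAt (fun z => s ^ d * k (s • z))
      (s ^ d • (fderiv ℝ k (s • z)).comp (s • ContinuousLinearMap.id ℝ (Rd d))) z :=
    ((hk (s • z)).hasFDerivAt.comp z ((hasFDerivAt_id z).const_smul s)).const_mul (s ^ d)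
  rw [pd, show dil s k = fun z => s ^ d * k (s • z) from rfl, h.fderiv]
  simp [pd]

variable {M : Measure (ℝ × Rd d)} [SFinite M]

theorem integral_comp_dil {s : ℝ} (hs : 0 < s) {H : (ℝ × Rd d) × Rd d → ℝ}
    (h1 : Integrable (fun p : (ℝ × Rd d) × Rd d => s ^ d * H (p.1, s • (p.2 - p.1.2)))
      (M.prod volume))
    (h2 : Integrable H (M.prod volume)) :
    ∫ p, s ^ d * H (p.1, s • (p.2 - p.1.2)) ∂(M.prod volume) = ∫ p, H p ∂(M.prod volume) := by
  rw [integral_prod _ h1, integral_prod _ h2]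
  refine integral_congr_ae (Eventually.of_forall fun z => ?_)
  have := integral_sub_right_eq_self (μ := (volume : Measure (Rd d)))
    (fun x => s ^ d * H (z, s • x)) z.2
  dsimp only at this ⊢
  rw [this]
  exact integral_dil (fun x => H (z, x)) hs

theorem integral_mul_comp_sub {g : ℝ × Rd d → ℝ} {k : Rd d → ℝ} (hg : Integrable g M)
    (hk : Integrable k volume) :
    ∫ p : (ℝ × Rd d) × Rd d, g p.1 * k (p.2 - p.1.2) ∂(M.prod volume)
      = (∫ z, g z ∂M) * ∫ x, k x := by
  rw [integral_prod _ (integrable_mul_comp_sub hg hk), ← integral_mul_const]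
  refine integral_congr_ae (Eventually.of_forall fun z => ?_)
  dsimp only
  rw [integral_const_mul, integral_sub_right_eq_self (μ := (volume : Measure (Rd d))) k z.2]

/-- Integrability of `g(t,y) k(x - y) h` for bounded measurable `h`. -/
theorem integrable_mul_comp_sub_mul_bdd {g : ℝ × Rd d → ℝ} {k : Rd d → ℝ} (hg : Integrable g M)
    (hk : Integrable k volume) {h : (ℝ × Rd d) × Rd d → ℝ} (hh : Measurable h) {C : ℝ}
    (hC : ∀ p, |h p| ≤ C) :
    Integrable (fun p : (ℝ × Rd d) × Rd d => g p.1 * k (p.2 - p.1.2) * h p) (M.prod volume) :=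
  (integrable_mul_comp_sub hg hk).mul_bdd (c := C) hh.aestronglyMeasurable (Eventually.of_forall hC)

theorem tendsto_integral_mul_comp_sub {g : ℝ × Rd d → ℝ} {k f : Rd d → ℝ} (hg : Integrable g M)
    (hk : Integrable k volume) (hf : Continuous f) {C : ℝ} (hC : ∀ x, |f x| ≤ C) :
    Tendsto (fun n : ℕ => ∫ p : (ℝ × Rd d) × Rd d,
        g p.1 * dil (n + 1) k (p.2 - p.1.2) * f p.2 ∂(M.prod volume)) atTop
      (𝓝 ((∫ z, g z * f z.2 ∂M) * ∫ x, k x)) := by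
  have hgk : Integrable (fun p : (ℝ × Rd d) × Rd d => g p.1 * k p.2) (M.prod volume) :=
    hg.mul_prod hk
  have hm : ∀ n : ℕ, Measurable fun p : (ℝ × Rd d) × Rd d =>
      f (p.1.2 + ((n : ℝ) + 1)⁻¹ • p.2) := fun n => by
    have := hf.measurable; fun_prop
  have e : ∀ n : ℕ, ∫ p : (ℝ × Rd d) × Rd d,
        g p.1 * dil (n + 1) k (p.2 - p.1.2) * f p.2 ∂(M.prod volume)
      = ∫ p : (ℝ × Rd d) × Rd d,
        g p.1 * k p.2 * f (p.1.2 + ((n : ℝ) + 1)⁻¹ • p.2) ∂(M.prod volume) := fun n => by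
    have hs : (0 : ℝ) < n + 1 := by positivity
    have e1 : ∀ p : (ℝ × Rd d) × Rd d, g p.1 * dil (n + 1) k (p.2 - p.1.2) * f p.2
        = ((n : ℝ) + 1) ^ d * (g p.1 * k (((n : ℝ) + 1) • (p.2 - p.1.2)) *
          f (p.1.2 + ((n : ℝ) + 1)⁻¹ • (((n : ℝ) + 1) • (p.2 - p.1.2)))) := fun p => by
      rw [inv_smul_smul₀ hs.ne', add_sub_cancel, dil]; ring
    have i1 := integrable_mul_comp_sub_mul_bdd hg (hk.dil hs) (hf.measurable.comp measurable_snd)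
      (fun p => hC p.2)
    rw [← integral_comp_dil hs
      (H := fun p => g p.1 * k p.2 * f (p.1.2 + ((n : ℝ) + 1)⁻¹ • p.2))
      (i1.congr (Eventually.of_forall e1)) (hgk.mul_bdd (c := C) (hm n).aestronglyMeasurable
      (Eventually.of_forall fun p => hC _))]
    exact integral_congr_ae (Eventually.of_forall e1)
  simp only [e]
  have h2 : (∫ z, g z * f z.2 ∂M) * ∫ x, k x
      = ∫ p : (ℝ × Rd d) × Rd d, g p.1 * k p.2 * f p.1.2 ∂(M.prod volume) := by
    rw [← integral_prod_mul (fun z : ℝ × Rd d => g z * f z.2) k]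
    exact integral_congr_ae (Eventually.of_forall fun p => by ring)
  rw [h2]
  refine tendsto_integral_of_dominated_convergence (fun p => |g p.1 * k p.2| * C)
    (fun n => hgk.1.mul (hm n).aestronglyMeasurable) (hgk.abs.mul_const C)
    (fun n => Eventually.of_forall fun p => ?_) (Eventually.of_forall fun p => ?_)
  · rw [norm_mul]
    exact mul_le_mul_of_nonneg_left (hC _) (abs_nonneg _)
  · refine Tendsto.const_mul _ ((hf.tendsto' _ _ rfl).comp ?_)
    have h0 : Tendsto (fun n : ℕ => ((n : ℝ) + 1)⁻¹) atTop (𝓝 0) := by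
      simpa using tendsto_one_div_add_atTop_nhds_zero_nat (𝕜 := ℝ)
    simpa using (tendsto_const_nhds (x := p.1.2)).add (h0.smul_const p.2)

end Dilation

section Concentration
variable {d : ℕ} {σ : Measure ℝ} [IsFiniteMeasure σ] {m : Kernel ℝ (Rd d)} [IsFiniteKernel m]
  {ω : Rd d → ℝ} {u : ℝ × Rd d → ℝ}

/-- The squared oscillation `(u(t,y) - U(t,x))²` at a point `((t,y),x)`. -/
def sqOsc (m : Kernel ℝ (Rd d)) (ω : Rd d → ℝ) (u : ℝ × Rd d → ℝ) (δ : ℝ)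
    (p : (ℝ × Rd d) × Rd d) : ℝ := (u p.1 - mollRatio m ω u δ p.1.1 p.2) ^ 2

theorem measurable_sqOsc (hωc : Continuous ω) (hu : Measurable u) (δ : ℝ) :
    Measurable (sqOsc m ω u δ) := by
  have h := measurable_mollRatio (m := m) (δ := δ) hωc hu
  have h2 : Measurable fun p : (ℝ × Rd d) × Rd d => mollRatio m ω u δ p.1.1 p.2 :=
    h.comp (by fun_prop : Measurable fun p : (ℝ × Rd d) × Rd d => (p.1.1, p.2))
  unfold sqOsc
  fun_prop

theorem abs_sqOsc_le (hωc : Continuous ω) (hωs : HasCompactSupport ω) (hω0 : ∀ x, 0 ≤ ω x)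
    (hu1 : ∀ z, |u z| ≤ 1) {δ : ℝ} (hδ : 0 < δ) (p : (ℝ × Rd d) × Rd d) :
    |sqOsc m ω u δ p| ≤ 4 := by
  have h1 := abs_le.1 (hu1 p.1)
  have h2 := abs_le.1 (abs_mollRatio_le_one (m := m) hωc hωs hω0 hu1 hδ p.1.1 p.2)
  rw [sqOsc, abs_of_nonneg (sq_nonneg _)]
  nlinarith

theorem integral_comp_sub_mul_sqOsc_le (hωc : Continuous ω) (hωs : HasCompactSupport ω)
    (hω0 : ∀ x, 0 ≤ ω x) (hω1 : ∫ x, ω x = 1) {r : ℝ} (hωr : ∀ z, r < ‖z‖ → ω z = 0)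
    (hu : Measurable u) (hu1 : ∀ z, |u z| ≤ 1) {δ : ℝ} (hδ : 0 < δ)
    {v : ℝ × Rd d → ℝ} (hv : Continuous v) (hvs : HasCompactSupport v) {e : ℝ}
    (he : ∀ t x y, ‖x - y‖ ≤ r → (v (t, y) - v (t, x)) ^ 2 ≤ e) :
    ∫ p, ω (p.2 - p.1.2) * sqOsc m ω u δ p ∂((σ ⊗ₘ m).prod volume)
      ≤ 2 * ∫ z, (u z - v z) ^ 2 ∂(σ ⊗ₘ m) + 2 * e * (σ ⊗ₘ m).real univ
        + δ * ∫ q, v q ^ 2 ∂(σ.prod volume) := by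
  have hωi : Integrable ω volume := hωc.integrable_of_hasCompactSupport hωs
  obtain ⟨Cv, -, hCv⟩ := exists_abs_le_of_hasCompactSupport hv hvs
  have hvm := hv.measurable
  have hi : ∀ h : (ℝ × Rd d) × Rd d → ℝ, Measurable h → ∀ C, (∀ p, |h p| ≤ C) →
      Integrable (fun p : (ℝ × Rd d) × Rd d => ω (p.2 - p.1.2) * h p) ((σ ⊗ₘ m).prod volume) :=
    fun h hh C hC => by
      simpa using integrable_mul_comp_sub_mul_bdd (integrable_const (1 : ℝ)) hωi hh hC
  have i1 := hi _ (measurable_sqOsc hωc hu δ) 4 (abs_sqOsc_le (m := m) hωc hωs hω0 hu1 hδ)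
  have hb : ∀ z z', (u z - v z') ^ 2 ≤ (1 + Cv) ^ 2 := fun z z' =>
    sq_le_sq' (by linarith [(abs_le.1 (hu1 z)).1, (abs_le.1 (hCv z')).2])
      (by linarith [(abs_le.1 (hu1 z)).2, (abs_le.1 (hCv z')).1])
  have i2 := hi (fun p => (u p.1 - v (p.1.1, p.2)) ^ 2) (by fun_prop) ((1 + Cv) ^ 2) fun p => by
    rw [abs_of_nonneg (sq_nonneg _)]; exact hb _ _
  have i3 : Integrable (fun z => (u z - v z) ^ 2) (σ ⊗ₘ m) :=
    Integrable.of_bound (by fun_prop : Measurable fun z => (u z - v z) ^ 2).aestronglyMeasurable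
      ((1 + Cv) ^ 2) (Eventually.of_forall fun z => by
        rw [Real.norm_of_nonneg (sq_nonneg _)]; exact hb _ _)
  have i4 : Integrable (fun q => v q ^ 2) (σ.prod volume) :=
    (hv.pow 2).integrable_of_hasCompactSupport
      (by simpa [pow_two] using hvs.mul_left (f := v))
  have s1 : ∫ p, ω (p.2 - p.1.2) * sqOsc m ω u δ p ∂((σ ⊗ₘ m).prod volume)
      ≤ ∫ p : (ℝ × Rd d) × Rd d, ω (p.2 - p.1.2) * (u p.1 - v (p.1.1, p.2)) ^ 2
          ∂((σ ⊗ₘ m).prod volume)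
        + δ * ∫ q, v q ^ 2 ∂(σ.prod volume) := by
    rw [integral_swapSpace i1, integral_swapSpace i2, ← integral_const_mul,
      ← integral_add (integrable_integral_swapSpace i2) (i4.const_mul δ)]
    refine integral_mono (integrable_integral_swapSpace i1)
      ((integrable_integral_swapSpace i2).add (i4.const_mul δ)) fun q => ?_
    exact integral_mul_sub_mollRatio_sq_le hωc hωs hω0 hu hu1 hδ q.1 q.2 (v q)
  have s2 : ∫ p : (ℝ × Rd d) × Rd d, ω (p.2 - p.1.2) * (u p.1 - v (p.1.1, p.2)) ^ 2
        ∂((σ ⊗ₘ m).prod volume)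
      ≤ ∫ p : (ℝ × Rd d) × Rd d, (2 * (u p.1 - v p.1) ^ 2 + 2 * e) * ω (p.2 - p.1.2)
        ∂((σ ⊗ₘ m).prod volume) := by
    refine integral_mono i2 (integrable_mul_comp_sub ((i3.const_mul 2).add (integrable_const _))
      hωi) fun p => ?_
    dsimp only
    rw [mul_comm]
    by_cases hp : r < ‖p.2 - p.1.2‖
    · simp [hωr _ hp]
    · refine mul_le_mul_of_nonneg_right ?_ (hω0 _)
      have := he p.1.1 p.2 p.1.2 (not_lt.1 hp)
      nlinarith [sq_nonneg ((u p.1 - v p.1) - (v p.1 - v (p.1.1, p.2)))]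
  have s3 := integral_mul_comp_sub (M := σ ⊗ₘ m)
    (g := fun z => 2 * (u z - v z) ^ 2 + 2 * e) ((i3.const_mul 2).add (integrable_const _)) hωi
  have s4 : ∫ z, (2 * (u z - v z) ^ 2 + 2 * e) ∂(σ ⊗ₘ m)
      = 2 * ∫ z, (u z - v z) ^ 2 ∂(σ ⊗ₘ m) + 2 * e * (σ ⊗ₘ m).real univ := by
    rw [integral_add (i3.const_mul 2) (integrable_const _), integral_const_mul, integral_const,
      smul_eq_mul, mul_comm (2 * e)]
  rw [s3, hω1, mul_one, s4] at s2
  linarith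

theorem tendsto_integral_dil_mul_sqOsc (hωc : Continuous ω) (hωs : HasCompactSupport ω)
    (hω0 : ∀ x, 0 ≤ ω x) (hω1 : ∫ x, ω x = 1) (hωr : ∀ z, 1 < ‖z‖ → ω z = 0)
    (hu : Measurable u) (hu1 : ∀ z, |u z| ≤ 1) :
    Tendsto (fun n : ℕ => ∫ p, dil (n + 1) ω (p.2 - p.1.2) *
        sqOsc m (dil (n + 1) ω) u (1 / ((n : ℝ) + 1)) p ∂((σ ⊗ₘ m).prod volume)) atTop (𝓝 0) := by
  have hnn : ∀ n : ℕ, 0 ≤ ∫ p, dil (n + 1) ω (p.2 - p.1.2) *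
        sqOsc m (dil (n + 1) ω) u (1 / ((n : ℝ) + 1)) p ∂((σ ⊗ₘ m).prod volume) := fun n =>
    integral_nonneg fun p => mul_nonneg (dil_nonneg hω0 (by positivity) _) (sq_nonneg _)
  rw [Metric.tendsto_atTop]
  intro ε hε
  have hL : MemLp u (ENNReal.ofReal 2) (σ ⊗ₘ m) :=
    MemLp.of_bound hu.aestronglyMeasurable 1 (Eventually.of_forall hu1)
  obtain ⟨v, hvs, hv2, hvc, -⟩ := hL.exists_hasCompactSupport_integral_rpow_sub_le two_pos
    (ε := ε / 8) (by positivity)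
  have hv2' : ∫ z, (u z - v z) ^ 2 ∂(σ ⊗ₘ m) ≤ ε / 8 := by
    refine le_trans (le_of_eq ?_) hv2
    exact integral_congr_ae (Eventually.of_forall fun z => by simp)
  set A := (σ ⊗ₘ m).real univ with hA
  have hA0 : 0 ≤ A := measureReal_nonneg
  set e := ε / (8 * (A + 1)) with he
  have he0 : 0 < e := by positivity
  obtain ⟨ρ, hρ, hρv⟩ := Metric.uniformContinuous_iff.1
    (hvs.uniformContinuous_of_continuous hvc) (Real.sqrt e) (Real.sqrt_pos.2 he0)
  have hlim : Tendsto (fun n : ℕ => 1 / ((n : ℝ) + 1)) atTop (𝓝 0) :=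
    tendsto_one_div_add_atTop_nhds_zero_nat
  have hlim2 : Tendsto (fun n : ℕ => 1 / ((n : ℝ) + 1) * ∫ q, v q ^ 2 ∂(σ.prod volume))
      atTop (𝓝 0) := by simpa using hlim.mul_const _
  obtain ⟨N, hN⟩ := eventually_atTop.1 ((hlim.eventually (gt_mem_nhds hρ)).and
    (hlim2.eventually (gt_mem_nhds (show 0 < ε / 4 by positivity))))
  refine ⟨N, fun n hn => ?_⟩
  obtain ⟨h1, h2⟩ := hN n hn
  have hs : (0 : ℝ) < n + 1 := by positivity
  rw [Real.dist_0_eq_abs, abs_of_nonneg (hnn n)]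
  refine (integral_comp_sub_mul_sqOsc_le (hωc.dil _) (hωs.dil hs) (dil_nonneg hω0 hs)
    ((integral_dil ω hs).trans hω1) (fun z hz => dil_eq_zero hωr hs hz) hu hu1
    (by positivity) hvc hvs (e := e) fun t x y hxy => ?_).trans_lt ?_
  · have := hρv (a := (t, y)) (b := (t, x)) (by
      rw [Prod.dist_eq, dist_self, max_eq_right dist_nonneg, dist_comm, dist_eq_norm]
      exact hxy.trans_lt h1)
    rw [Real.dist_eq] at this
    rw [← sq_abs, ← Real.sq_sqrt he0.le]
    exact pow_le_pow_left₀ (abs_nonneg _) this.le 2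
  · have h3 : 2 * e * A ≤ ε / 4 := by
      have : e * (A + 1) = ε / 8 := by rw [he]; field_simp
      nlinarith
    linarith

theorem tendsto_integral_mul_dil_mul_sqOsc (hωc : Continuous ω) (hωs : HasCompactSupport ω)
    (hω0 : ∀ x, 0 ≤ ω x) (hω1 : ∫ x, ω x = 1) (hωr : ∀ z, 1 < ‖z‖ → ω z = 0)
    (hu : Measurable u) (hu1 : ∀ z, |u z| ≤ 1) {g : ℝ × Rd d → ℝ} (hg : Integrable g (σ ⊗ₘ m))
    {k f : Rd d → ℝ} (hk : Integrable k volume) (hk0 : ∀ z, ω z = 0 → k z = 0)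
    (hf : Continuous f) {C : ℝ} (hC : ∀ x, |f x| ≤ C) :
    Tendsto (fun n : ℕ => ∫ p, g p.1 * dil (n + 1) k (p.2 - p.1.2) *
        (f p.2 * sqOsc m (dil (n + 1) ω) u (1 / ((n : ℝ) + 1)) p) ∂((σ ⊗ₘ m).prod volume))
      atTop (𝓝 0) := by
  have hC0 : 0 ≤ C := (abs_nonneg _).trans (hC 0)
  set S : ℕ → (ℝ × Rd d) × Rd d → (ℝ × Rd d) × Rd d :=
    fun n p => (p.1, p.1.2 + ((n : ℝ) + 1)⁻¹ • p.2) with hS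
  have hSm : ∀ n, Measurable (S n) := fun n => by simp only [hS]; fun_prop
  have hs : ∀ n : ℕ, (0 : ℝ) < n + 1 := fun n => by positivity
  set O : ℕ → (ℝ × Rd d) × Rd d → ℝ :=
    fun n => sqOsc m (dil (n + 1) ω) u (1 / ((n : ℝ) + 1)) with hO
  have hOm : ∀ n, Measurable (O n) := fun n => measurable_sqOsc (hωc.dil _) hu _
  have hOb : ∀ n p, |O n p| ≤ 4 := fun n p =>
    abs_sqOsc_le (hωc.dil _) (hωs.dil (hs n)) (dil_nonneg hω0 (hs n)) hu1 (by positivity) p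
  have hSid : ∀ n (p : (ℝ × Rd d) × Rd d), S n (p.1, ((n : ℝ) + 1) • (p.2 - p.1.2)) = p :=
    fun n p => by simp only [hS]; rw [inv_smul_smul₀ (hs n).ne', add_sub_cancel]
  have hωi : Integrable ω volume := hωc.integrable_of_hasCompactSupport hωs
  have cv : ∀ (n : ℕ) (g' : ℝ × Rd d → ℝ) (k' : Rd d → ℝ) (h : (ℝ × Rd d) × Rd d → ℝ) (C' : ℝ),
      Integrable g' (σ ⊗ₘ m) → Integrable k' volume → Measurable h → (∀ p, |h p| ≤ C') →
      ∫ p, g' p.1 * dil (n + 1) k' (p.2 - p.1.2) * h p ∂((σ ⊗ₘ m).prod volume)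
        = ∫ p, g' p.1 * k' p.2 * h (S n p) ∂((σ ⊗ₘ m).prod volume) := by
    intro n g' k' h C' hg' hk' hh hC'
    have e1 : ∀ p : (ℝ × Rd d) × Rd d, g' p.1 * dil (n + 1) k' (p.2 - p.1.2) * h p
        = ((n : ℝ) + 1) ^ d * (g' p.1 * k' (((n : ℝ) + 1) • (p.2 - p.1.2)) *
          h (S n (p.1, ((n : ℝ) + 1) • (p.2 - p.1.2)))) := fun p => by
      rw [hSid, dil]; ring
    rw [← integral_comp_dil (hs n) (H := fun p => g' p.1 * k' p.2 * h (S n p))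
      ((integrable_mul_comp_sub_mul_bdd hg' (hk'.dil (hs n)) hh hC').congr
        (Eventually.of_forall e1))
      ((hg'.mul_prod hk').mul_bdd (c := C') (hh.comp (hSm n)).aestronglyMeasurable
        (Eventually.of_forall fun p => hC' _))]
    exact integral_congr_ae (Eventually.of_forall e1)
  have hfO : ∀ n, Measurable fun p : (ℝ × Rd d) × Rd d => f p.2 * O n p := fun n =>
    (hf.measurable.comp measurable_snd).mul (hOm n)
  have hfOb : ∀ n p, |f p.2 * O n p| ≤ C * 4 := fun n p => by
    rw [abs_mul]; exact mul_le_mul (hC _) (hOb n p) (abs_nonneg _) hC0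
  have E0 := tendsto_integral_dil_mul_sqOsc (σ := σ) (m := m) hωc hωs hω0 hω1 hωr hu hu1
  have E1 : Tendsto (fun n => ∫ p, ω p.2 * O n (S n p) ∂((σ ⊗ₘ m).prod volume)) atTop (𝓝 0) := by
    refine E0.congr fun n => ?_
    simpa only [one_mul] using cv n (fun _ => 1) ω (O n) 4 (integrable_const _) hωi (hOm n) (hOb n)
  refine (tendsto_congr fun n => cv n g k _ _ hg hk (hfO n) (hfOb n)).2 ?_
  refine tendsto_of_subseq_tendsto fun ns hns => ?_
  have hInt : ∀ n, Integrable (fun p => ω p.2 * O n (S n p)) ((σ ⊗ₘ m).prod volume) := fun n => by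
    have := ((integrable_const (1 : ℝ)).mul_prod hωi (μ := σ ⊗ₘ m)).mul_bdd (c := 4)
      ((hOm n).comp (hSm n)).aestronglyMeasurable (Eventually.of_forall fun p => hOb n _)
    simpa using this
  have hmeas : TendstoInMeasure ((σ ⊗ₘ m).prod volume)
      (fun k p => ω p.2 * O (ns k) (S (ns k) p)) atTop (fun _ => 0) := by
    refine tendstoInMeasure_of_tendsto_eLpNorm one_ne_zero (fun k => (hInt _).1)
      aestronglyMeasurable_const ?_
    have : ∀ k, eLpNorm ((fun p => ω p.2 * O (ns k) (S (ns k) p)) - fun _ => 0) 1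
        ((σ ⊗ₘ m).prod volume)
        = ENNReal.ofReal (∫ p, ω p.2 * O (ns k) (S (ns k) p) ∂((σ ⊗ₘ m).prod volume)) := fun k => by
      rw [eLpNorm_one_eq_lintegral_enorm, ofReal_integral_eq_lintegral_ofReal (hInt _)
        (Eventually.of_forall fun p => mul_nonneg (hω0 _) (sq_nonneg _))]
      refine lintegral_congr fun p => ?_
      have h : 0 ≤ ω p.2 * O (ns k) (S (ns k) p) := mul_nonneg (hω0 _) (sq_nonneg _)
      rw [Pi.sub_apply, sub_zero, Real.enorm_of_nonneg h]
    simp only [this]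
    simpa using ENNReal.tendsto_ofReal (E1.comp hns)
  obtain ⟨ms, -, hms⟩ := hmeas.exists_seq_tendsto_ae
  refine ⟨ms, ?_⟩
  have := tendsto_integral_of_dominated_convergence (μ := (σ ⊗ₘ m).prod volume)
    (F := fun j p => g p.1 * k p.2 * (f (S (ns (ms j)) p).2 * O (ns (ms j)) (S (ns (ms j)) p)))
    (f := fun _ => 0) (fun p => |g p.1 * k p.2| * (C * 4))
    (fun j => (hg.mul_prod hk).1.mul ((hfO _).comp (hSm _)).aestronglyMeasurable)
    ((hg.mul_prod hk).abs.mul_const _)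
    (fun j => Eventually.of_forall fun p => by
      rw [norm_mul]
      exact mul_le_mul_of_nonneg_left (hfOb _ _) (abs_nonneg _)) ?_
  · simpa using this
  · filter_upwards [hms] with p hp
    by_cases h0 : ω p.2 = 0
    · simp [hk0 _ h0]
    · have h1 : Tendsto (fun j => O (ns (ms j)) (S (ns (ms j)) p)) atTop (𝓝 0) := by
        have := hp.const_mul (ω p.2)⁻¹
        simpa [inv_mul_cancel_left₀ h0] using this
      have h2 : Tendsto (fun j => f (S (ns (ms j)) p).2 * O (ns (ms j)) (S (ns (ms j)) p))
          atTop (𝓝 0) := by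
        refine squeeze_zero_norm (fun j => ?_) (by simpa using h1.abs.const_mul C)
        rw [norm_mul]
        exact mul_le_mul_of_nonneg_right (hC _) (abs_nonneg _)
      simpa using h2.const_mul (g p.1 * k p.2)

end Concentration

section Mollifier
variable {d : ℕ}

/-- A smooth compactly supported mollifier `ω` with a dominating kernel `κ` controlling
`‖z‖² |∂ω|²` by `4 ω κ`. -/
theorem exists_mollifier (d : ℕ) : ∃ ω κ : Rd d → ℝ, ContDiff ℝ (⊤ : ℕ∞) ω ∧ HasCompactSupport ω ∧
    (∀ z, 0 ≤ ω z) ∧ ∫ z, ω z = 1 ∧ (∀ z, 1 < ‖z‖ → ω z = 0) ∧ Continuous κ ∧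
    HasCompactSupport κ ∧ (∀ z, ω z ≤ κ z) ∧ (∀ z, ω z = 0 → κ z = 0) ∧
    ∀ i z, (‖z‖ * pd i ω z) ^ 2 ≤ 4 * ω z * κ z := by
  let f : ContDiffBump (0 : Rd d) := ⟨1 / 2, 1, by norm_num, by norm_num⟩
  have fs : ContDiff ℝ (⊤ : ℕ∞) f := f.contDiff
  have fc : HasCompactSupport f := f.hasCompactSupport
  have fs1 : ContDiff ℝ 1 f := f.contDiff
  have fd : Differentiable ℝ f := fs1.differentiable one_ne_zero
  have f2c : HasCompactSupport fun z => f z * f z := fc.mul_right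
  have f2i : Integrable (fun z => f z * f z) volume :=
    (fs.continuous.mul fs.continuous).integrable_of_hasCompactSupport f2c
  set I := ∫ z, f z * f z with hI
  have hIpos : 0 < I := by
    refine (integral_pos_iff_support_of_nonneg (fun z => mul_self_nonneg _) f2i).2 ?_
    refine IsOpen.measure_pos volume ?_ ⟨0, ?_⟩
    · exact (fs.continuous.mul fs.continuous).isOpen_support
    · rw [Function.mem_support, f.one_of_mem_closedBall (by simp [f])]; norm_num
  have hfd : ∀ i, Continuous (pd i f) := fun i => (fs1.pd (m := 0) (by simp) i).continuous
  have hmin : ∀ i z, f z = 0 → pd i f z = 0 := fun i z hz => by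
    have : IsLocalMin f z := Eventually.of_forall fun y => by rw [hz]; exact f.nonneg
    rw [pd, this.fderiv_eq_zero]; rfl
  have hpd : ∀ i z, pd i (fun z => I⁻¹ * (f z * f z)) z = I⁻¹ * (2 * f z * pd i f z) := by
    intro i z
    rw [pd_mul (f := fun _ => I⁻¹) (g := fun z => f z * f z) i (differentiableAt_const _)
      ((fd z).mul (fd z)), pd_mul i (fd z) (fd z)]
    simp [pd]
    exact Or.inl (by ring)
  refine ⟨fun z => I⁻¹ * (f z * f z),
    fun z => I⁻¹ * (f z * f z + ‖z‖ ^ 2 * ∑ i, (pd i f z) ^ 2), contDiff_const.mul (fs.mul fs),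
    f2c.mul_left, fun z => by have := mul_self_nonneg (f z); positivity, ?_, ?_, ?_, ?_, ?_, ?_, ?_⟩
  · rw [integral_const_mul, inv_mul_cancel₀ hIpos.ne']
  · intro z hz
    dsimp only
    rw [f.zero_of_le_dist (by rw [dist_zero_right]; exact hz.le)]; simp
  · have := fs.continuous; fun_prop
  · refine HasCompactSupport.mul_left (f := fun _ => I⁻¹) (f2c.add ?_)
    refine HasCompactSupport.of_support_subset_isCompact fc fun z hz => ?_
    by_contra h
    refine hz ?_
    have : ∀ i, pd i f z = 0 := fun i => by
      by_contra h'
      exact h (support_pd_subset i f h')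
    simp [this]
  · intro z
    have : 0 ≤ ‖z‖ ^ 2 * ∑ i, (pd i f z) ^ 2 :=
      mul_nonneg (sq_nonneg _) (Finset.sum_nonneg fun i _ => sq_nonneg _)
    exact mul_le_mul_of_nonneg_left (by linarith) (by positivity)
  · intro z hz
    have hz' : f z = 0 := by simpa [hIpos.ne'] using hz
    simp [hz', hmin _ z hz']
  · intro i z
    rw [hpd]
    have h1 : (pd i f z) ^ 2 ≤ ∑ i, (pd i f z) ^ 2 :=
      Finset.single_le_sum (f := fun i => (pd i f z) ^ 2) (fun i _ => sq_nonneg _)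
        (Finset.mem_univ i)
    have h2 : ‖z‖ ^ 2 * (pd i f z) ^ 2 ≤ f z * f z + ‖z‖ ^ 2 * ∑ i, (pd i f z) ^ 2 := by
      nlinarith [mul_self_nonneg (f z), mul_le_mul_of_nonneg_left h1 (sq_nonneg ‖z‖)]
    calc (‖z‖ * (I⁻¹ * (2 * f z * pd i f z))) ^ 2
        = 4 * I⁻¹ ^ 2 * (f z * f z) * (‖z‖ ^ 2 * (pd i f z) ^ 2) := by ring
      _ ≤ 4 * I⁻¹ ^ 2 * (f z * f z) * (f z * f z + ‖z‖ ^ 2 * ∑ i, (pd i f z) ^ 2) :=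
        mul_le_mul_of_nonneg_left h2 (mul_nonneg (by positivity) (mul_self_nonneg _))
      _ = _ := by ring

theorem norm_mul_pd_dil_sq_le {ω κ : Rd d → ℝ} (hω : Differentiable ℝ ω)
    (h : ∀ i z, (‖z‖ * pd i ω z) ^ 2 ≤ 4 * ω z * κ z) {s : ℝ} (hs : 0 < s) (i : Fin d) (z : Rd d) :
    (‖z‖ * pd i (dil s ω) z) ^ 2 ≤ 4 * dil s ω z * dil s κ z := by
  have h1 := mul_le_mul_of_nonneg_left (h i (s • z)) (show 0 ≤ (s ^ d) ^ 2 by positivity)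
  rw [norm_smul, Real.norm_of_nonneg hs.le] at h1
  rw [pd_dil i hω, dil, dil]
  linarith

end Mollifier

section Algebra
variable {d : ℕ}

theorem neg_add_le_two_mul {X P S : ℝ} (hP : 0 ≤ P) (hS : 0 ≤ S) (h : X ^ 2 ≤ P * S) :
    -(P + S) ≤ 2 * X := by
  refine (abs_le.1 (abs_le_of_sq_le_sq (?_ : (2 * X) ^ 2 ≤ (P + S) ^ 2) (add_nonneg hP hS))).1
  nlinarith [sq_nonneg (P - S)]

/-- The first order terms created by moving derivatives off the mollifier, where `q = ∇φ(x)`,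
`v = ∇U(x)`, `p = ∇ω(x - y)`, `w = ω(x - y)` and `r = u(y) - U(x)`. -/
def crossTerm (A : Fin d → Fin d → ℝ) (B q v p : Fin d → ℝ) (φ w r : ℝ) : ℝ :=
  (∑ i, ∑ j, A i j * (q i * (-2 * r * v j) * w - φ * (-2 * r * v i) * p j))
    + ∑ i, B i * (φ * (-2 * r * v i) * w)

theorem neg_le_crossTerm_add {A A' : Fin d → Fin d → ℝ} {B q v p : Fin d → ℝ}
    {φ w k r γ a₀ K Λ Φ : ℝ} (hγ : 0 < γ) (hφ : 0 ≤ φ) (hΦ : φ ≤ Φ) (hw : 0 ≤ w) (hk : w ≤ k)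
    (hK : 0 ≤ K) (hA : ∀ i j, |A i j| ≤ a₀) (hq : ∑ i, q i ^ 2 ≤ K * φ)
    (hp : ∀ i j, ((A i j - A' i j) * p j) ^ 2 ≤ Λ ^ 2 * (4 * w * k)) :
    -((d ^ 2 * a₀ ^ 2 * K + 4 * d ^ 2 * Λ ^ 2 * Φ + Φ) / (2 * γ / (2 * d + 1)) *
        (k * r ^ 2 * (1 + ∑ i, B i ^ 2)))
      ≤ crossTerm A B q v p φ w r - 2 * φ * r * (∑ i, ∑ j, A' i j * v i * p j)
        + 2 * φ * γ * (∑ i, v i ^ 2) * w := by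
  set α := 2 * γ / (2 * d + 1) with hα
  have hα0 : 0 < α := by positivity
  have hαd : (2 * d + 1) * α = 2 * γ := by rw [hα]; field_simp
  have hk0 : 0 ≤ k := hw.trans hk
  have hqi : ∀ i, q i ^ 2 ≤ K * φ := fun i =>
    (Finset.single_le_sum (f := fun i => q i ^ 2) (fun i _ => sq_nonneg _)
      (Finset.mem_univ i)).trans hq
  have hA2 : ∀ i j, A i j ^ 2 ≤ a₀ ^ 2 := fun i j => by
    rw [← sq_abs]; exact pow_le_pow_left₀ (abs_nonneg _) (hA i j) 2
  have t1 : ∀ i j, -(α * φ * v j ^ 2 * w + a₀ ^ 2 * K / α * (k * r ^ 2))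
      ≤ 2 * (-(A i j * q i * r * v j * w)) := fun i j => by
    refine neg_add_le_two_mul (by positivity) (by positivity) ?_
    have h1 : A i j ^ 2 * q i ^ 2 ≤ a₀ ^ 2 * (K * φ) :=
      mul_le_mul (hA2 i j) (hqi i) (sq_nonneg _) (sq_nonneg _)
    calc (-(A i j * q i * r * v j * w)) ^ 2
        = (A i j ^ 2 * q i ^ 2) * (r ^ 2 * v j ^ 2 * w * w) := by ring
      _ ≤ (a₀ ^ 2 * (K * φ)) * (r ^ 2 * v j ^ 2 * w * k) := by gcongr
      _ = _ := by field_simp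
  have t2 : ∀ i j, -(α * φ * v i ^ 2 * w + 4 * Λ ^ 2 * Φ / α * (k * r ^ 2))
      ≤ 2 * (φ * r * v i * ((A i j - A' i j) * p j)) := fun i j => by
    have hΦ0 : 0 ≤ Φ := hφ.trans hΦ
    refine neg_add_le_two_mul (by positivity) (by positivity) ?_
    calc (φ * r * v i * ((A i j - A' i j) * p j)) ^ 2
        = φ * φ * r ^ 2 * v i ^ 2 * ((A i j - A' i j) * p j) ^ 2 := by ring
      _ ≤ φ * Φ * r ^ 2 * v i ^ 2 * (Λ ^ 2 * (4 * w * k)) := by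
          have := hp i j
          gcongr
      _ = _ := by field_simp
  have t3 : ∀ i, -(α * φ * v i ^ 2 * w + Φ / α * (k * r ^ 2 * B i ^ 2))
      ≤ 2 * (-(φ * r * w * B i * v i)) := fun i => by
    have hΦ0 : 0 ≤ Φ := hφ.trans hΦ
    refine neg_add_le_two_mul (by positivity) (by positivity) ?_
    calc (-(φ * r * w * B i * v i)) ^ 2 = φ * φ * r ^ 2 * w * w * B i ^ 2 * v i ^ 2 := by ring
      _ ≤ φ * Φ * r ^ 2 * w * k * B i ^ 2 * v i ^ 2 := by gcongr
      _ = _ := by field_simp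
  have s1 := Finset.sum_le_sum fun i (_ : i ∈ Finset.univ) =>
    Finset.sum_le_sum fun j (_ : j ∈ Finset.univ) => t1 i j
  have s2 := Finset.sum_le_sum fun i (_ : i ∈ Finset.univ) =>
    Finset.sum_le_sum fun j (_ : j ∈ Finset.univ) => t2 i j
  have s3 := Finset.sum_le_sum fun i (_ : i ∈ Finset.univ) => t3 i
  have e1 : ∑ i : Fin d, ∑ j : Fin d, -(α * φ * v j ^ 2 * w + a₀ ^ 2 * K / α * (k * r ^ 2))
      = -(d * (α * φ * (∑ i, v i ^ 2) * w) + d ^ 2 * (a₀ ^ 2 * K / α * (k * r ^ 2))) := by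
    simp only [neg_add, Finset.sum_add_distrib, Finset.sum_neg_distrib, Finset.sum_const,
      Finset.card_univ, Fintype.card_fin, nsmul_eq_mul, ← Finset.mul_sum, ← Finset.sum_mul]
    ring
  have e2 : ∑ i : Fin d, ∑ j : Fin d, -(α * φ * v i ^ 2 * w + 4 * Λ ^ 2 * Φ / α * (k * r ^ 2))
      = -(d * (α * φ * (∑ i, v i ^ 2) * w) + d ^ 2 * (4 * Λ ^ 2 * Φ / α * (k * r ^ 2))) := by
    simp only [neg_add, Finset.sum_add_distrib, Finset.sum_neg_distrib, Finset.sum_const,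
      Finset.card_univ, Fintype.card_fin, nsmul_eq_mul, ← Finset.mul_sum, ← Finset.sum_mul]
    ring
  have e3 : ∑ i : Fin d, -(α * φ * v i ^ 2 * w + Φ / α * (k * r ^ 2 * B i ^ 2))
      = -(α * φ * (∑ i, v i ^ 2) * w + Φ / α * (k * r ^ 2 * ∑ i, B i ^ 2)) := by
    simp only [neg_add, Finset.sum_add_distrib, Finset.sum_neg_distrib,
      ← Finset.mul_sum, ← Finset.sum_mul]
  rw [e1] at s1
  rw [e2] at s2
  rw [e3] at s3
  have e4 : crossTerm A B q v p φ w r - 2 * φ * r * (∑ i, ∑ j, A' i j * v i * p j)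
      = (∑ i, ∑ j, 2 * (-(A i j * q i * r * v j * w)))
        + (∑ i, ∑ j, 2 * (φ * r * v i * ((A i j - A' i j) * p j)))
        + ∑ i, 2 * (-(φ * r * w * B i * v i)) := by
    rw [crossTerm]
    have : 2 * φ * r * (∑ i, ∑ j, A' i j * v i * p j)
        = ∑ i, ∑ j, 2 * φ * r * (A' i j * v i * p j) := by simp only [Finset.mul_sum]
    rw [this, add_sub_right_comm, ← Finset.sum_sub_distrib]
    congr 1
    · rw [← Finset.sum_add_distrib]
      refine Finset.sum_congr rfl fun i _ => ?_
      rw [← Finset.sum_sub_distrib, ← Finset.sum_add_distrib]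
      exact Finset.sum_congr rfl fun j _ => by ring
    · exact Finset.sum_congr rfl fun i _ => by ring
  rw [e4]
  have hS : 0 ≤ ∑ i, B i ^ 2 := Finset.sum_nonneg fun i _ => sq_nonneg _
  set SB := ∑ i, B i ^ 2
  set SV := ∑ i, v i ^ 2
  have hΦ0 : 0 ≤ Φ := hφ.trans hΦ
  have e5 : 2 * φ * γ * SV * w = d * (α * φ * SV * w) + d * (α * φ * SV * w) + α * φ * SV * w := by
    rw [show 2 * φ * γ * SV * w = φ * SV * w * (2 * γ) by ring, ← hαd]; ring
  have e6 : (d ^ 2 * a₀ ^ 2 * K + 4 * d ^ 2 * Λ ^ 2 * Φ + Φ) / α * (k * r ^ 2 * (1 + SB))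
      = d ^ 2 * (a₀ ^ 2 * K / α * (k * r ^ 2)) + d ^ 2 * (4 * Λ ^ 2 * Φ / α * (k * r ^ 2))
        + Φ / α * (k * r ^ 2 * SB)
        + (Φ / α * (k * r ^ 2) + (d ^ 2 * a₀ ^ 2 * K + 4 * d ^ 2 * Λ ^ 2 * Φ) / α *
          (k * r ^ 2 * SB)) := by ring
  have h7 : 0 ≤ Φ / α * (k * r ^ 2) + (d ^ 2 * a₀ ^ 2 * K + 4 * d ^ 2 * Λ ^ 2 * Φ) / α *
      (k * r ^ 2 * SB) := by positivity
  rw [e6, e5]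
  linarith

end Algebra

section StaticIntegration
variable {d : ℕ}

/-- The operator `L₀` with coefficients frozen at one point. -/
def constL (A : Fin d → Fin d → ℝ) (B : Fin d → ℝ) (c : ℝ) (φ : Rd d → ℝ) (x : Rd d) : ℝ :=
  (∑ i, ∑ j, A i j * pd2 i j φ x) + (∑ i, B i * pd i φ x) + c * φ x

theorem constL_comp_sub_left {ω : Rd d → ℝ} (hω : ContDiff ℝ 2 ω) (A : Fin d → Fin d → ℝ)
    (B : Fin d → ℝ) (c : ℝ) (x y : Rd d) :
    constL A B c (fun y => ω (x - y)) y
      = (∑ i, ∑ j, A i j * pd2 i j ω (x - y)) - (∑ i, B i * pd i ω (x - y)) + c * ω (x - y) := by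
  have h1 : ∀ i, pd i (fun y => ω (x - y)) = fun y => -pd i ω (x - y) := fun i =>
    pd_comp_sub_left i (hω.differentiable (by norm_num)) x
  have h2 : ∀ i j, pd2 i j (fun y => ω (x - y)) y = pd2 i j ω (x - y) := fun i j => by
    have h3 : Differentiable ℝ (pd j ω) :=
      (hω.pd (m := 1) (by norm_num) j).differentiable one_ne_zero
    rw [pd2_eq, h1, pd2_eq]
    have : pd i (fun y => -pd j ω (x - y)) y = -pd i (fun y => pd j ω (x - y)) y := by
      simp only [pd]
      rw [fderiv_fun_neg]; rfl
    rw [this, pd_comp_sub_left i h3 x, neg_neg]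
  simp only [constL, h1, h2, mul_neg, Finset.sum_neg_distrib]
  ring

theorem pd_quadratic {U : Rd d → ℝ} (hU : Differentiable ℝ U) (i : Fin d) (v : ℝ) (x : Rd d) :
    pd i (fun x => 1 - 2 * U x * v + U x ^ 2) x = -2 * (v - U x) * pd i U x := by
  have h := (((hU x).hasFDerivAt.const_mul (2 : ℝ)).mul_const v).const_sub 1 |>.add
    ((hU x).hasFDerivAt.pow 2)
  have h' : HasFDerivAt (fun x => 1 - 2 * U x * v + U x ^ 2) _ x := h
  rw [pd, h'.fderiv]
  simp [pd]
  ring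

/-- Moving two derivatives off the mollifier. -/
theorem integral_mul_constL {A : Fin d → Fin d → ℝ} (hA : ∀ i j, A i j = A j i) (B : Fin d → ℝ)
    (c : ℝ) {φ U ω : Rd d → ℝ} (hφ : ContDiff ℝ 2 φ) (hφs : HasCompactSupport φ)
    (hU : ContDiff ℝ 1 U) (hω : ContDiff ℝ 2 ω) (y : Rd d) (v : ℝ) :
    ∫ x, φ x * (1 - 2 * U x * v + U x ^ 2) * constL A B c (fun y => ω (x - y)) y
      = ∫ x, (ω (x - y) * (1 - 2 * U x * v + U x ^ 2) * constL A B c φ x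
        + crossTerm A B (fun i => pd i φ x) (fun i => pd i U x) (fun i => pd i ω (x - y)) (φ x)
          (ω (x - y)) (v - U x)) := by
  set Q : Rd d → ℝ := fun x => 1 - 2 * U x * v + U x ^ 2 with hQ
  set g : Rd d → ℝ := fun x => ω (x - y) with hg
  have hQ1 : ContDiff ℝ 1 Q := by rw [hQ]; fun_prop
  have hg2 : ContDiff ℝ 2 g := hω.comp (contDiff_id.sub contDiff_const)
  have hg1 : ContDiff ℝ 1 g := hg2.of_le (by norm_num)
  have hφ1 : ContDiff ℝ 1 φ := hφ.of_le (by norm_num)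
  have cφ := hφ.continuous
  have cQ := hQ1.continuous
  have cg := hg2.continuous
  have cφ1 : ∀ i, Continuous (pd i φ) := fun i => (hφ1.pd (m := 0) (by simp) i).continuous
  have cφ2 : ∀ i j, Continuous (pd2 i j φ) := fun i j =>
    ((hφ.pd (m := 1) (by norm_num) j).pd (m := 0) (by simp) i).continuous
  have cQ1 : ∀ i, Continuous (pd i Q) := fun i => (hQ1.pd (m := 0) (by simp) i).continuous
  have cg1 : ∀ i, Continuous (pd i g) := fun i => (hg1.pd (m := 0) (by simp) i).continuous
  have cg2 : ∀ i j, Continuous (pd2 i j g) := fun i j =>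
    ((hg2.pd (m := 1) (by norm_num) j).pd (m := 0) (by simp) i).continuous
  have key : ∀ (f h : Rd d → ℝ), Continuous f → HasCompactSupport f → Continuous h →
      Integrable (fun x => f x * h x) volume := fun f h hf hfs hh =>
    (hf.mul hh).integrable_of_hasCompactSupport hfs.mul_right
  have sφ1 : ∀ i, HasCompactSupport (pd i φ) := fun i => hφs.pd i
  have sφ2 : ∀ i j, HasCompactSupport (pd2 i j φ) := fun i j => (hφs.pd j).pd i
  have i1 : ∀ i j, Integrable (fun x => φ x * (Q x * pd2 i j g x)) volume := fun i j =>
    key _ _ cφ hφs (cQ.mul (cg2 i j))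
  have i2 : ∀ i j, Integrable (fun x => pd2 j i φ x * (Q x * g x)) volume := fun i j =>
    key _ _ (cφ2 j i) (sφ2 j i) (cQ.mul cg)
  have i3 : ∀ i j, Integrable (fun x => pd i φ x * (pd j Q x * g x)) volume := fun i j =>
    key _ _ (cφ1 i) (sφ1 i) ((cQ1 j).mul cg)
  have i4 : ∀ i j, Integrable (fun x => φ x * (pd i Q x * pd j g x)) volume := fun i j =>
    key _ _ cφ hφs ((cQ1 i).mul (cg1 j))
  have i5 : ∀ i, Integrable (fun x => φ x * (Q x * pd i g x)) volume := fun i =>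
    key _ _ cφ hφs (cQ.mul (cg1 i))
  have i6 : ∀ i, Integrable (fun x => pd i φ x * (Q x * g x)) volume := fun i =>
    key _ _ (cφ1 i) (sφ1 i) (cQ.mul cg)
  have i7 : ∀ i, Integrable (fun x => φ x * (pd i Q x * g x)) volume := fun i =>
    key _ _ cφ hφs ((cQ1 i).mul cg)
  have i8 : Integrable (fun x => φ x * (Q x * g x)) volume := key _ _ cφ hφs (cQ.mul cg)
  have D : ∀ i j, ∫ x, φ x * (Q x * pd2 i j g x)
      = ∫ x, (pd2 j i φ x * (Q x * g x) + pd i φ x * (pd j Q x * g x)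
        - φ x * (pd i Q x * pd j g x)) := fun i j => by
    have := integral_mul_mul_pd2 hφ hφs hQ1 hg2 i j
    rw [integral_sub (f := fun x => pd2 j i φ x * (Q x * g x) + pd i φ x * (pd j Q x * g x))
      ((i2 i j).add (i3 i j)) (i4 i j)]
    simpa only [mul_assoc, add_mul] using this
  have E : ∀ i, ∫ x, φ x * (Q x * pd i g x)
      = -∫ x, (pd i φ x * (Q x * g x) + φ x * (pd i Q x * g x)) := fun i => by
    have := integral_mul_pd_eq_neg (hφ1.mul hQ1) hg1 hφs.mul_right i
    simp only [← mul_assoc]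
    rw [this]
    congr 1
    refine integral_congr_ae (Eventually.of_forall fun x => ?_)
    dsimp only
    rw [pd_mul i (hφ1.differentiable one_ne_zero x) (hQ1.differentiable one_ne_zero x)]
    ring
  have hpg : ∀ i x, pd i ω (x - y) = pd i g x := fun i x => by
    rw [hg, pd_comp_sub_right]
  have hpg2 : ∀ i j x, pd2 i j ω (x - y) = pd2 i j g x := fun i j x => by
    rw [pd2_eq, pd2_eq, hg, pd_comp_sub_right, pd_comp_sub_right]
  have hpQ : ∀ i x, pd i Q x = -2 * (v - U x) * pd i U x := fun i x =>
    pd_quadratic (hU.differentiable one_ne_zero) i v x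
  have eL : ∀ x, φ x * Q x * constL A B c (fun y => ω (x - y)) y
      = (∑ i, ∑ j, A i j * (φ x * (Q x * pd2 i j g x))) + ((∑ i, -B i * (φ x * (Q x * pd i g x)))
        + c * (φ x * (Q x * g x))) := fun x => by
    rw [constL_comp_sub_left hω]
    simp only [hpg, hpg2, mul_add, mul_sub, Finset.mul_sum]
    rw [sub_eq_add_neg, ← Finset.sum_neg_distrib, add_assoc]
    refine congr_arg₂ _ ?_ (congr_arg₂ _ ?_ ?_)
    · exact Finset.sum_congr rfl fun i _ => Finset.sum_congr rfl fun j _ => by ring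
    · exact Finset.sum_congr rfl fun i _ => by ring
    · ring
  have eR : ∀ x, g x * Q x * constL A B c φ x
        + crossTerm A B (fun i => pd i φ x) (fun i => pd i U x) (fun i => pd i ω (x - y)) (φ x)
          (g x) (v - U x)
      = (∑ i, ∑ j, A i j * (pd2 j i φ x * (Q x * g x) + pd i φ x * (pd j Q x * g x)
        - φ x * (pd i Q x * pd j g x))) + ((∑ i, B i * (pd i φ x * (Q x * g x)
        + φ x * (pd i Q x * g x))) + c * (φ x * (Q x * g x))) := fun x => by
    have hs : ∑ i, ∑ j, A i j * pd2 i j φ x = ∑ i, ∑ j, A i j * pd2 j i φ x := by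
      rw [Finset.sum_comm]
      exact Finset.sum_congr rfl fun i _ => Finset.sum_congr rfl fun j _ => by rw [hA]
    have a1 : g x * Q x * (∑ i, ∑ j, A i j * pd2 j i φ x)
        + (∑ i, ∑ j, A i j * (pd i φ x * (-2 * (v - U x) * pd j U x) * g x
          - φ x * (-2 * (v - U x) * pd i U x) * pd j g x))
        = ∑ i, ∑ j, A i j * (pd2 j i φ x * (Q x * g x) + pd i φ x * (pd j Q x * g x)
          - φ x * (pd i Q x * pd j g x)) := by
      simp only [Finset.mul_sum]
      rw [← Finset.sum_add_distrib]
      refine Finset.sum_congr rfl fun i _ => ?_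
      rw [← Finset.sum_add_distrib]
      exact Finset.sum_congr rfl fun j _ => by rw [hpQ, hpQ]; ring
    have a2 : g x * Q x * (∑ i, B i * pd i φ x)
        + (∑ i, B i * (φ x * (-2 * (v - U x) * pd i U x) * g x))
        = ∑ i, B i * (pd i φ x * (Q x * g x) + φ x * (pd i Q x * g x)) := by
      simp only [Finset.mul_sum]
      rw [← Finset.sum_add_distrib]
      exact Finset.sum_congr rfl fun i _ => by rw [hpQ]; ring
    rw [constL, crossTerm, hs, ← a1, ← a2]
    simp only [hpg]
    ring
  have hInt : ∀ (F : Fin d → Fin d → Rd d → ℝ) (G : Fin d → Rd d → ℝ) (H : Rd d → ℝ)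
      (B : Fin d → ℝ), (∀ i j, Integrable (F i j) volume) → (∀ i, Integrable (G i) volume) →
      Integrable H volume →
      ∫ x, ((∑ i, ∑ j, A i j * F i j x) + ((∑ i, B i * G i x) + c * H x))
        = (∑ i, ∑ j, A i j * ∫ x, F i j x) + ((∑ i, B i * ∫ x, G i x) + c * ∫ x, H x) := by
    intro F G H B hF hG hH
    rw [integral_add, integral_add, integral_finsetSum, integral_finsetSum, integral_const_mul]
    · simp only [integral_const_mul]
      congr 1
      refine Finset.sum_congr rfl fun i _ => ?_
      rw [integral_finsetSum]
      · simp only [integral_const_mul]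
      · exact fun j _ => (hF i j).const_mul _
    · exact fun i _ => (hG i).const_mul _
    · exact fun i _ => integrable_finsetSum _ fun j _ => (hF i j).const_mul _
    · exact integrable_finsetSum _ fun i _ => (hG i).const_mul _
    · exact hH.const_mul _
    · exact integrable_finsetSum _ fun i _ => integrable_finsetSum _ fun j _ => (hF i j).const_mul _
    · exact (integrable_finsetSum _ fun i _ => (hG i).const_mul _).add (hH.const_mul _)
  calc _ = _ := integral_congr_ae (Eventually.of_forall eL)
    _ = _ := hInt _ _ _ _ i1 i5 i8
    _ = _ := by
      simp only [D, E, neg_mul_neg]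
      rfl
    _ = _ := (hInt _ _ _ _ (fun i j => ((i2 i j).add (i3 i j)).sub (i4 i j))
        (fun i => (i6 i).add (i7 i)) i8).symm
    _ = _ := integral_congr_ae (Eventually.of_forall fun x => (eR x).symm)

end StaticIntegration

section TimeIntegration
variable {d : ℕ} {T : ℝ} {m : Kernel ℝ (Rd d)} [IsFiniteKernel m]
  {a : Fin d → Fin d → ℝ × Rd d → ℝ} {b : Fin d → ℝ × Rd d → ℝ} {c : ℝ × Rd d → ℝ}

theorem integrable_integral_kernel {σ : Measure ℝ} [IsFiniteMeasure σ] {f : ℝ × Rd d → ℝ}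
    (hf : Integrable f (σ ⊗ₘ m)) : Integrable (fun t => ∫ y, f (t, y) ∂(m t)) σ :=
  Integrable.integral_compProd (κ := Kernel.const Unit σ)
    (η := Kernel.prodMkLeft Unit m) (a := ()) hf

theorem continuous_pd2 {φ : Rd d → ℝ} (hφ : ContDiff ℝ 2 φ) (i j : Fin d) :
    Continuous (pd2 i j φ) :=
  ((hφ.pd (m := 1) (by norm_num) j).pd (m := 0) (by simp) i).continuous

theorem continuous_pd {φ : Rd d → ℝ} (hφ : ContDiff ℝ 1 φ) (i : Fin d) :
    Continuous (pd i φ) := (hφ.pd (m := 0) (by simp) i).continuous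

/-- Integrability of `L₀ψ` for compactly supported `ψ`. -/
theorem integrable_L0 {M : Measure (ℝ × Rd d)} (ha : ∀ i j, Integrable (a i j) M)
    (hb : ∀ i, Integrable (b i) M) (hc : Integrable c M) {ψ : Rd d → ℝ} (hψ : ContDiff ℝ 2 ψ)
    (hψs : HasCompactSupport ψ) : Integrable (L0 a b c ψ) M := by
  have key : ∀ (g : ℝ × Rd d → ℝ) (f : Rd d → ℝ), Integrable g M → Continuous f →
      HasCompactSupport f → Integrable (fun z => g z * f z.2) M := by
    intro g f hg hf hfs
    obtain ⟨C, -, hC⟩ := exists_abs_le_of_hasCompactSupport hf hfs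
    exact hg.mul_bdd (c := C) (hf.measurable.comp measurable_snd).aestronglyMeasurable
      (Eventually.of_forall fun z => hC z.2)
  refine ((integrable_finsetSum _ fun i _ => integrable_finsetSum _ fun j _ => ?_).add
    (integrable_finsetSum _ fun i _ => ?_)).add ?_
  · exact key _ _ (ha i j) (continuous_pd2 hψ i j) ((hψs.pd j).pd i)
  · exact key _ _ (hb i) (continuous_pd (hψ.of_le (by norm_num)) i) (hψs.pd i)
  · exact key _ _ hc hψ.continuous hψs

theorem hasCompactSupport_comp_sub_left {ω : Rd d → ℝ} (hωs : HasCompactSupport ω) (x : Rd d) :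
    HasCompactSupport fun y => ω (x - y) :=
  hωs.comp_homeomorph (Homeomorph.subLeft x)

/-- The entropy identity at a fixed point `x` of the mollified equation. -/
theorem entropy_inequality_at (hT : 0 < T)
    (ha : ∀ i j, Integrable (a i j) (volume.restrict (Icc 0 T) ⊗ₘ m))
    (hb : ∀ i, Integrable (b i) (volume.restrict (Icc 0 T) ⊗ₘ m))
    (hc : Integrable c (volume.restrict (Icc 0 T) ⊗ₘ m)) {ω : Rd d → ℝ} (hω : ContDiff ℝ 2 ω)
    (hωs : HasCompactSupport ω) (hω0 : ∀ x, 0 ≤ ω x) {u : ℝ × Rd d → ℝ} (hu : Measurable u)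
    (hu1 : ∀ z, |u z| ≤ 1) {δ m₀ : ℝ} (hδ : 0 < δ) {x : Rd d}
    (hw : ∀ᵐ t ∂(volume.restrict (Icc 0 T)), moll m ω u t x
      = ∫ s in (0 : ℝ)..t, ∫ y, L0 a b c (fun y => ω (x - y)) (s, y) * u (s, y) ∂(m s))
    (hm : ∀ᵐ t ∂(volume.restrict (Icc 0 T)), moll m ω (fun _ => 1) t x
      = m₀ + ∫ s in (0 : ℝ)..t, ∫ y, L0 a b c (fun y => ω (x - y)) (s, y) ∂(m s)) :
    T * m₀ + ∫ t in Icc 0 T, (T - t) *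
        ∫ y, mollQuad m ω u δ t x y * L0 a b c (fun y => ω (x - y)) (t, y) ∂(m t)
      ≤ (∫ t in Icc 0 T, ∫ y, ω (x - y) * mollQuad m ω u δ t x y ∂(m t)) + δ * T := by
  set ψ : Rd d → ℝ := fun y => ω (x - y) with hψ
  have hψ2 : ContDiff ℝ 2 ψ := hω.comp (contDiff_const.sub contDiff_id)
  have hψs : HasCompactSupport ψ := hasCompactSupport_comp_sub_left hωs x
  have hLi : Integrable (L0 a b c ψ) (volume.restrict (Icc 0 T) ⊗ₘ m) :=
    integrable_L0 ha hb hc hψ2 hψs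
  have hLu : Integrable (fun z => L0 a b c ψ z * u z) (volume.restrict (Icc 0 T) ⊗ₘ m) :=
    hLi.mul_bdd (c := 1) hu.aestronglyMeasurable (Eventually.of_forall hu1)
  have hωc := hω.continuous
  have hU1 := fun t => abs_mollRatio_le_one (m := m) hωc hωs hω0 hu1 hδ t x
  have hII : ∀ f : ℝ → ℝ, Integrable f (volume.restrict (Icc 0 T)) →
      IntervalIntegrable f volume 0 T := fun f hf =>
    (intervalIntegrable_iff_integrableOn_Icc_of_le hT.le).2 hf
  have hE := integral_sub_sq_div_eq hT hδ (hII _ (integrable_integral_kernel hLu))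
    (hII _ (integrable_integral_kernel hLi)) hw hm (fun t => moll_one_nonneg hω0 t x)
  have hae := (Measure.integrable_compProd_iff hLi.1).1 hLi |>.1
  have e1 : ∫ t in Icc 0 T, (T - t) * ∫ y, mollQuad m ω u δ t x y * L0 a b c ψ (t, y) ∂(m t)
      = ∫ t in Icc 0 T, (T - t) *
          ((1 + (moll m ω u t x / (moll m ω (fun _ => 1) t x + δ)) ^ 2)
            * (∫ y, L0 a b c ψ (t, y) ∂(m t))
          - 2 * (moll m ω u t x / (moll m ω (fun _ => 1) t x + δ))
            * ∫ y, L0 a b c ψ (t, y) * u (t, y) ∂(m t)) := by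
    refine integral_congr_ae ?_
    filter_upwards [hae] with t ht
    have ht2 : Integrable (fun y => L0 a b c ψ (t, y) * u (t, y)) (m t) :=
      ht.mul_bdd (c := 1) (hu.comp measurable_prodMk_left).aestronglyMeasurable
        (Eventually.of_forall fun y => hu1 (t, y))
    congr 1
    rw [← integral_const_mul, ← integral_const_mul, ← integral_sub (ht.const_mul _)
      (ht2.const_mul _)]
    refine integral_congr_ae (Eventually.of_forall fun y => ?_)
    simp only [mollQuad, mollRatio]
    ring
  rw [e1, ← hE]
  have hmeas : Measurable fun t => mollRatio m ω u δ t x :=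
    (measurable_mollRatio hωc hu).comp measurable_prodMk_right
  have hUi : Integrable (fun t => δ * mollRatio m ω u δ t x ^ 2) (volume.restrict (Icc 0 T)) := by
    refine Integrable.of_bound ((hmeas.pow_const 2).const_mul δ).aestronglyMeasurable δ
      (Eventually.of_forall fun t => ?_)
    rw [Real.norm_eq_abs, abs_mul, abs_of_pos hδ, abs_pow]
    exact mul_le_of_le_one_right hδ.le (pow_le_one₀ (abs_nonneg _) (hU1 t))
  obtain ⟨C, hC0, hC⟩ := exists_abs_moll_le m hωc hωs
  have e2 := fun t => moll_sub_sq_div_eq (m := m) hωc hωs hω0 hu hu1 hδ t x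
  have hQi : Integrable (fun t => ∫ y, ω (x - y) * mollQuad m ω u δ t x y ∂(m t))
      (volume.restrict (Icc 0 T)) := by
    refine Integrable.congr (f := fun t => moll m ω (fun _ => 1) t x - mollRatio m ω u δ t x
      * moll m ω u t x - δ * mollRatio m ω u δ t x ^ 2) ?_ (Eventually.of_forall fun t => ?_)
    · refine Integrable.sub (Integrable.sub ?_ ?_) hUi
      · exact Integrable.of_bound ((measurable_moll hωc measurable_const).comp
          measurable_prodMk_right).aestronglyMeasurable C
          (Eventually.of_forall fun t => hC _ (by simp) t x)
      · refine Integrable.bdd_mul (c := 1) ?_ hmeas.aestronglyMeasurable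
          (Eventually.of_forall hU1)
        exact Integrable.of_bound ((measurable_moll hωc hu).comp
          measurable_prodMk_right).aestronglyMeasurable C
          (Eventually.of_forall fun t => hC _ hu1 t x)
    · dsimp only
      rw [eq_comm, ← sub_eq_iff_eq_add.2 (e2 t), mollRatio]
      ring
  simp only [e2]
  rw [integral_add hQi hUi]
  gcongr
  calc ∫ t in Icc 0 T, δ * mollRatio m ω u δ t x ^ 2
      ≤ ∫ t in Icc 0 T, δ := by
        refine integral_mono hUi (integrable_const _) fun t => ?_
        have := (sq_le_one_iff_abs_le_one _).2 (hU1 t)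
        exact mul_le_of_le_one_right hδ.le this
    _ = δ * T := by simp [hT.le, mul_comm]

end TimeIntegration

section Coercivity
variable {d : ℕ} {m : Kernel ℝ (Rd d)} [IsFiniteKernel m]
  {a : Fin d → Fin d → ℝ × Rd d → ℝ} {b : Fin d → ℝ × Rd d → ℝ}
  {ω κ : Rd d → ℝ} {u : ℝ × Rd d → ℝ} {δ : ℝ}

/-- The constant in the coercivity estimate for `crossTerm`. -/
def energyConst (d : ℕ) (a₀ K Λ Φ γ : ℝ) : ℝ :=
  (d ^ 2 * a₀ ^ 2 * K + 4 * d ^ 2 * Λ ^ 2 * Φ + Φ) / (2 * γ / (2 * d + 1))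

theorem energyConst_nonneg {a₀ K Λ Φ γ : ℝ} (hK : 0 ≤ K) (hΦ : 0 ≤ Φ) (hγ : 0 < γ) :
    0 ≤ energyConst d a₀ K Λ Φ γ := by
  rw [energyConst]; positivity

theorem mul_pd_sq_le (hω1 : ∀ z, 1 < ‖z‖ → ω z = 0)
    (hκ : ∀ i z, (‖z‖ * pd i ω z) ^ 2 ≤ 4 * ω z * κ z) {Λ r : ℝ} {z : Rd d}
    (hr : ‖z‖ ≤ 1 → |r| ≤ Λ * ‖z‖) (j : Fin d) :
    (r * pd j ω z) ^ 2 ≤ Λ ^ 2 * (4 * ω z * κ z) := by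
  rcases le_or_gt ‖z‖ 1 with h | h
  · have h1 : r ^ 2 ≤ (Λ * ‖z‖) ^ 2 := by
      rw [← sq_abs]; exact pow_le_pow_left₀ (abs_nonneg _) (hr h) 2
    calc (r * pd j ω z) ^ 2 = r ^ 2 * pd j ω z ^ 2 := by ring
      _ ≤ (Λ * ‖z‖) ^ 2 * pd j ω z ^ 2 := by gcongr
      _ = Λ ^ 2 * (‖z‖ * pd j ω z) ^ 2 := by ring
      _ ≤ _ := by gcongr; exact hκ j z
  · have h2 := hκ j z
    have h0 := hω1 z h
    rw [h0, mul_zero, zero_mul] at h2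
    have h3 : ‖z‖ * pd j ω z = 0 := pow_eq_zero_iff two_ne_zero |>.1 (h2.antisymm (sq_nonneg _))
    have h4 : pd j ω z = 0 := (mul_eq_zero.1 h3).resolve_left (by linarith)
    simp [h4, h0]

theorem neg_le_integral_crossTerm (hω : ContDiff ℝ 1 ω) (hωs : HasCompactSupport ω)
    (hω0 : ∀ z, 0 ≤ ω z) (hω1 : ∀ z, 1 < ‖z‖ → ω z = 0) (hk : ∀ z, ω z ≤ κ z)
    (hκ : ∀ i z, (‖z‖ * pd i ω z) ^ 2 ≤ 4 * ω z * κ z) (hu : Measurable u)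
    (hu1 : ∀ z, |u z| ≤ 1) (hδ : 0 < δ) {a₀ K Λ Φ γ f t : ℝ} {x : Rd d} {q : Fin d → ℝ}
    (hγ : 0 < γ) (hf : 0 ≤ f) (hΦ : f ≤ Φ) (hK : 0 ≤ K) (ha : ∀ i j z, |a i j z| ≤ a₀)
    (hq : ∑ i, q i ^ 2 ≤ K * f)
    (hell : ∀ ξ : Fin d → ℝ, γ * ∑ i, ξ i ^ 2 ≤ ∑ i, ∑ j, a i j (t, x) * ξ i * ξ j)
    (hlip : ∀ y i j, dist x y ≤ 1 → |a i j (t, y) - a i j (t, x)| ≤ Λ * dist x y)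
    (hi : Integrable (fun y => crossTerm (fun i j => a i j (t, y)) (fun i => b i (t, y)) q
      (fun i => mollRatioGrad m ω u δ i t x) (fun i => pd i ω (x - y)) f (ω (x - y))
      (u (t, y) - mollRatio m ω u δ t x)) (m t))
    (hi' : Integrable (fun y => κ (x - y) * (u (t, y) - mollRatio m ω u δ t x) ^ 2
      * (1 + ∑ i, b i (t, y) ^ 2)) (m t)) :
    -(energyConst d a₀ K Λ Φ γ * ∫ y, κ (x - y) * (u (t, y) - mollRatio m ω u δ t x) ^ 2
      * (1 + ∑ i, b i (t, y) ^ 2) ∂(m t))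
    ≤ ∫ y, crossTerm (fun i j => a i j (t, y)) (fun i => b i (t, y)) q
      (fun i => mollRatioGrad m ω u δ i t x) (fun i => pd i ω (x - y)) f (ω (x - y))
      (u (t, y) - mollRatio m ω u δ t x) ∂(m t) := by
  set U := mollRatio m ω u δ t x with hU
  set v : Fin d → ℝ := fun i => mollRatioGrad m ω u δ i t x with hv
  set cr : Rd d → ℝ := fun y => crossTerm (fun i j => a i j (t, y)) (fun i => b i (t, y)) q
      v (fun i => pd i ω (x - y)) f (ω (x - y)) (u (t, y) - U) with hcr
  have hωi : Integrable (fun y => ω (x - y)) (m t) := by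
    simpa using integrable_comp_sub_mul hω.continuous hωs (integrable_const (μ := m t) (1 : ℝ)) x
  have hr1 : Integrable (fun y => u (t, y) - U) (m t) :=
    (integrable_slice hu hu1 t).sub (integrable_const _)
  have hpi : ∀ j, Integrable (fun y => pd j ω (x - y) * (u (t, y) - U)) (m t) := fun j =>
    integrable_comp_sub_mul (continuous_pd hω j) (hωs.pd j) hr1 x
  have hEi : Integrable (fun y => ∑ i, ∑ j, (2 * f * a i j (t, x) * v i) *
      (pd j ω (x - y) * (u (t, y) - U))) (m t) :=
    integrable_finsetSum _ fun i _ => integrable_finsetSum _ fun j _ => (hpi j).const_mul _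
  have hpt : ∀ y, -(energyConst d a₀ K Λ Φ γ * (κ (x - y) * (u (t, y) - U) ^ 2
      * (1 + ∑ i, b i (t, y) ^ 2)))
      ≤ cr y - (∑ i, ∑ j, (2 * f * a i j (t, x) * v i) * (pd j ω (x - y) * (u (t, y) - U)))
        + (2 * f * γ * ∑ i, v i ^ 2) * ω (x - y) := by
    intro y
    have h := neg_le_crossTerm_add (A := fun i j => a i j (t, y)) (A' := fun i j => a i j (t, x))
      (B := fun i => b i (t, y)) (q := q) (v := v) (p := fun i => pd i ω (x - y))
      (φ := f) (w := ω (x - y)) (k := κ (x - y)) (r := u (t, y) - U) (Λ := Λ) hγ hf hΦ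
      (hω0 _) (hk _) hK (fun i j => ha i j _) hq (fun i j =>
        mul_pd_sq_le hω1 hκ (fun hz => by
          rw [← dist_eq_norm] at hz ⊢; exact hlip y i j hz) j)
    have e : 2 * f * (u (t, y) - U) * (∑ i, ∑ j, a i j (t, x) * v i * pd j ω (x - y))
        = ∑ i, ∑ j, (2 * f * a i j (t, x) * v i) * (pd j ω (x - y) * (u (t, y) - U)) := by
      simp only [Finset.mul_sum]
      exact Finset.sum_congr rfl fun i _ => Finset.sum_congr rfl fun j _ => by ring
    rw [e] at h
    exact h
  have hInt := integral_mono (hi'.const_mul _).neg ((hi.sub hEi).add (hωi.const_mul _)) hpt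
  have e1 : ∫ y, (cr y - (∑ i, ∑ j, (2 * f * a i j (t, x) * v i) *
        (pd j ω (x - y) * (u (t, y) - U))) + (2 * f * γ * ∑ i, v i ^ 2) * ω (x - y)) ∂(m t)
      = (∫ y, cr y ∂(m t)) - 2 * f * (moll m ω (fun _ => 1) t x + δ) *
        (∑ i, ∑ j, a i j (t, x) * v i * v j)
        + 2 * f * γ * (∑ i, v i ^ 2) * moll m ω (fun _ => 1) t x := by
    rw [integral_add (f := fun y => cr y - ∑ i, ∑ j, (2 * f * a i j (t, x) * v i) *
        (pd j ω (x - y) * (u (t, y) - U))) (hi.sub hEi) (hωi.const_mul _), integral_sub hi hEi,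
      integral_const_mul,
      integral_finsetSum _ fun i _ => integrable_finsetSum _ fun j _ => (hpi j).const_mul _]
    congr 1
    · congr 1
      rw [Finset.mul_sum]
      refine Finset.sum_congr rfl fun i _ => ?_
      rw [integral_finsetSum _ fun j _ => (hpi j).const_mul _, Finset.mul_sum]
      refine Finset.sum_congr rfl fun j _ => ?_
      rw [integral_const_mul, integral_pd_mul_sub_mollRatio hω hωs hω0 hu hu1 hδ]
      simp only [hv]
      ring
    · simp [moll]
  have hInt' : -(energyConst d a₀ K Λ Φ γ * ∫ y, κ (x - y) * (u (t, y) - U) ^ 2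
      * (1 + ∑ i, b i (t, y) ^ 2) ∂(m t))
      ≤ (∫ y, cr y ∂(m t)) - 2 * f * (moll m ω (fun _ => 1) t x + δ) *
        (∑ i, ∑ j, a i j (t, x) * v i * v j)
        + 2 * f * γ * (∑ i, v i ^ 2) * moll m ω (fun _ => 1) t x := by
    rw [← integral_const_mul, ← integral_neg]
    exact hInt.trans_eq e1
  refine hInt'.trans ?_
  have h1 := moll_one_nonneg (m := m) hω0 t x
  have h2 := hell v
  have h3 : 0 ≤ ∑ i, v i ^ 2 := Finset.sum_nonneg fun i _ => sq_nonneg _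
  have h4 : γ * (∑ i, v i ^ 2) * moll m ω (fun _ => 1) t x
      ≤ (moll m ω (fun _ => 1) t x + δ) * ∑ i, ∑ j, a i j (t, x) * v i * v j := by
    have h5 : 0 ≤ γ * ∑ i, v i ^ 2 := by positivity
    nlinarith [mul_le_mul_of_nonneg_left h2 (add_nonneg h1 hδ.le), mul_nonneg hδ.le h5]
  have h6 := mul_le_mul_of_nonneg_left h4 (by linarith : 0 ≤ 2 * f)
  linarith

end Coercivity

section BoundedMeasurable
variable {X : Type*} [MeasurableSpace X] {d : ℕ}

/-- Bounded measurable real functions. -/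
def BddMeas (h : X → ℝ) : Prop := Measurable h ∧ ∃ C, ∀ p, |h p| ≤ C

theorem BddMeas.mul {f g : X → ℝ} (hf : BddMeas f) (hg : BddMeas g) :
    BddMeas fun p => f p * g p := by
  obtain ⟨hf, C, hC⟩ := hf
  obtain ⟨hg, D, hD⟩ := hg
  refine ⟨hf.mul hg, C * D, fun p => ?_⟩
  rw [abs_mul]
  exact mul_le_mul (hC p) (hD p) (abs_nonneg _) ((abs_nonneg _).trans (hC p))

theorem BddMeas.sub {f g : X → ℝ} (hf : BddMeas f) (hg : BddMeas g) :
    BddMeas fun p => f p - g p := by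
  obtain ⟨hf, C, hC⟩ := hf
  obtain ⟨hg, D, hD⟩ := hg
  exact ⟨hf.sub hg, C + D, fun p => (abs_sub _ _).trans (add_le_add (hC p) (hD p))⟩

theorem BddMeas.add {f g : X → ℝ} (hf : BddMeas f) (hg : BddMeas g) :
    BddMeas fun p => f p + g p := by
  obtain ⟨hf, C, hC⟩ := hf
  obtain ⟨hg, D, hD⟩ := hg
  exact ⟨hf.add hg, C + D, fun p => (abs_add_le _ _).trans (add_le_add (hC p) (hD p))⟩

theorem bddMeas_const (r : ℝ) : BddMeas fun _ : X => r := ⟨measurable_const, |r|, fun _ => le_rfl⟩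

theorem bddMeas_snd {f : Rd d → ℝ} (hf : Continuous f) (hfs : HasCompactSupport f) :
    BddMeas fun p : X × Rd d => f p.2 := by
  obtain ⟨C, -, hC⟩ := exists_abs_le_of_hasCompactSupport hf hfs
  exact ⟨hf.measurable.comp measurable_snd, C, fun p => hC p.2⟩

end BoundedMeasurable

section EnergyInequality
variable {d : ℕ} {T : ℝ} {m : Kernel ℝ (Rd d)} [IsFiniteKernel m]
  {a : Fin d → Fin d → ℝ × Rd d → ℝ} {b : Fin d → ℝ × Rd d → ℝ} {c : ℝ × Rd d → ℝ}
  {φ ω κ : Rd d → ℝ} {u : ℝ × Rd d → ℝ} {δ : ℝ}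

omit [IsFiniteKernel m] in
theorem ae_fst_mem_Icc : ∀ᵐ z ∂(volume.restrict (Icc 0 T) ⊗ₘ m), z.1 ∈ Icc 0 T := by
  refine Measure.ae_compProd_of_ae_ae (measurable_fst measurableSet_Icc) ?_
  filter_upwards [ae_restrict_mem measurableSet_Icc] with t ht
  exact Eventually.of_forall fun _ => ht

omit [IsFiniteKernel m] in
theorem integrable_sub_fst_mul {g : ℝ × Rd d → ℝ}
    (hg : Integrable g (volume.restrict (Icc 0 T) ⊗ₘ m)) :
    Integrable (fun z => (T - z.1) * g z) (volume.restrict (Icc 0 T) ⊗ₘ m) := by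
  refine hg.bdd_mul (c := T) (by fun_prop) ?_
  filter_upwards [ae_fst_mem_Icc] with z hz
  rw [Real.norm_eq_abs, abs_le]
  constructor <;> linarith [hz.1, hz.2]

theorem integral_prod_swapSpace {σ : Measure ℝ} [IsFiniteMeasure σ] {f : (ℝ × Rd d) × Rd d → ℝ}
    (hf : Integrable f ((σ ⊗ₘ m).prod volume)) :
    ∫ p, f p ∂((σ ⊗ₘ m).prod volume) = ∫ x, ∫ t, ∫ y, f ((t, y), x) ∂(m t) ∂σ := by
  rw [integral_swapSpace hf, integral_prod_symm _ (integrable_integral_swapSpace hf)]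

theorem bddMeas_mollRatio (hωc : Continuous ω) (hωs : HasCompactSupport ω) (hω0 : ∀ z, 0 ≤ ω z)
    (hu : Measurable u) (hu1 : ∀ z, |u z| ≤ 1) (hδ : 0 < δ) :
    BddMeas fun p : (ℝ × Rd d) × Rd d => mollRatio m ω u δ p.1.1 p.2 :=
  ⟨(measurable_mollRatio hωc hu).comp
    (by fun_prop : Measurable fun p : (ℝ × Rd d) × Rd d => (p.1.1, p.2)), 1,
    fun _ => abs_mollRatio_le_one hωc hωs hω0 hu1 hδ _ _⟩

theorem bddMeas_mollQuad (hωc : Continuous ω) (hωs : HasCompactSupport ω) (hω0 : ∀ z, 0 ≤ ω z)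
    (hu : Measurable u) (hu1 : ∀ z, |u z| ≤ 1) (hδ : 0 < δ) :
    BddMeas fun p : (ℝ × Rd d) × Rd d => mollQuad m ω u δ p.1.1 p.2 p.1.2 := by
  have bu : BddMeas fun p : (ℝ × Rd d) × Rd d => u p.1 :=
    ⟨hu.comp measurable_fst, 1, fun p => hu1 p.1⟩
  have bU := bddMeas_mollRatio (m := m) hωc hωs hω0 hu hu1 hδ
  have := ((bddMeas_const (1 : ℝ)).sub (((bddMeas_const (2 : ℝ)).mul bU).mul bu)).add (bU.mul bU)
  simpa only [mollQuad, pow_two] using this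

theorem energy_inequality (hT : 0 < T) (hasymm : ∀ i j z, a i j z = a j i z) {a₀ : ℝ}
    (ham : ∀ i j, Measurable (a i j)) (ha : ∀ i j z, |a i j z| ≤ a₀)
    (hbm : ∀ i, Measurable (b i))
    (hb : Integrable (fun z => ∑ i, b i z ^ 2) (volume.restrict (Icc 0 T) ⊗ₘ m))
    (hc : Integrable c (volume.restrict (Icc 0 T) ⊗ₘ m))
    (hφ : ContDiff ℝ 2 φ) (hφs : HasCompactSupport φ) (hφ0 : ∀ x, 0 ≤ φ x) {Φ K : ℝ}
    (hΦ : ∀ x, φ x ≤ Φ) (hK : 0 ≤ K) (hφK : ∀ x, ∑ i, pd i φ x ^ 2 ≤ K * φ x) {γ Λ : ℝ}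
    (hγ : 0 < γ) (hell : ∀ t ∈ Icc 0 T, ∀ x, φ x ≠ 0 → ∀ ξ : Fin d → ℝ,
      γ * ∑ i, ξ i ^ 2 ≤ ∑ i, ∑ j, a i j (t, x) * ξ i * ξ j)
    (hlip : ∀ t ∈ Icc 0 T, ∀ x, φ x ≠ 0 → ∀ y i j, dist x y ≤ 1 →
      |a i j (t, y) - a i j (t, x)| ≤ Λ * dist x y)
    (hω : ContDiff ℝ 2 ω) (hωs : HasCompactSupport ω) (hω0 : ∀ z, 0 ≤ ω z)
    (hω1 : ∀ z, 1 < ‖z‖ → ω z = 0) (hk : ∀ z, ω z ≤ κ z) (hκc : Continuous κ)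
    (hκs : HasCompactSupport κ) (hκ : ∀ i z, (‖z‖ * pd i ω z) ^ 2 ≤ 4 * ω z * κ z)
    (hu : Measurable u) (hu1 : ∀ z, |u z| ≤ 1) (hδ : 0 < δ) {N : Rd d → ℝ} (hN : Continuous N)
    (hw : ∀ x, φ x ≠ 0 → ∀ᵐ t ∂(volume.restrict (Icc 0 T)), moll m ω u t x
      = ∫ s in (0 : ℝ)..t, ∫ y, L0 a b c (fun y => ω (x - y)) (s, y) * u (s, y) ∂(m s))
    (hm : ∀ x, φ x ≠ 0 → ∀ᵐ t ∂(volume.restrict (Icc 0 T)), moll m ω (fun _ => 1) t x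
      = N x + ∫ s in (0 : ℝ)..t, ∫ y, L0 a b c (fun y => ω (x - y)) (s, y) ∂(m s)) :
    T * (∫ x, φ x * N x) + ∫ p, (T - p.1.1) * (ω (p.2 - p.1.2) *
        mollQuad m ω u δ p.1.1 p.2 p.1.2 * constL (fun i j => a i j p.1) (fun i => b i p.1)
          (c p.1) φ p.2) ∂((volume.restrict (Icc 0 T) ⊗ₘ m).prod volume)
      ≤ (∫ p, ω (p.2 - p.1.2) * (φ p.2 * mollQuad m ω u δ p.1.1 p.2 p.1.2)
          ∂((volume.restrict (Icc 0 T) ⊗ₘ m).prod volume))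
        + δ * T * (∫ x, φ x) + energyConst d a₀ K Λ Φ γ *
          ∫ p, (T - p.1.1) * (1 + ∑ i, b i p.1 ^ 2) * κ (p.2 - p.1.2) * sqOsc m ω u δ p
          ∂((volume.restrict (Icc 0 T) ⊗ₘ m).prod volume) := by
  set M := volume.restrict (Icc 0 T) ⊗ₘ m with hM
  have hωc := hω.continuous
  have hω' : ContDiff ℝ 1 ω := hω.of_le (by norm_num)
  have hφ' : ContDiff ℝ 1 φ := hφ.of_le (by norm_num)
  have iφ : Integrable φ volume := hφ.continuous.integrable_of_hasCompactSupport hφs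
  have iφN : Integrable (fun x => φ x * N x) volume :=
    (hφ.continuous.mul hN).integrable_of_hasCompactSupport hφs.mul_right
  have iω : Integrable ω volume := hωc.integrable_of_hasCompactSupport hωs
  have iκ : Integrable κ volume := hκc.integrable_of_hasCompactSupport hκs
  have iω1 : ∀ i, Integrable (pd i ω) volume := fun i =>
    (continuous_pd hω' i).integrable_of_hasCompactSupport (hωs.pd i)
  have iω2 : ∀ i j, Integrable (pd2 i j ω) volume := fun i j =>
    (continuous_pd2 hω i j).integrable_of_hasCompactSupport ((hωs.pd j).pd i)
  have ia : ∀ i j, Integrable (a i j) M := fun i j =>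
    Integrable.of_bound (ham i j).aestronglyMeasurable a₀ (Eventually.of_forall (ha i j))
  have ib1 : Integrable (fun z => 1 + ∑ i, b i z ^ 2) M := (integrable_const _).add hb
  have ib : ∀ i, Integrable (b i) M := fun i => by
    refine ib1.mono' (hbm i).aestronglyMeasurable (Eventually.of_forall fun z => ?_)
    have h1 : b i z ^ 2 ≤ ∑ i, b i z ^ 2 :=
      Finset.single_le_sum (f := fun i => b i z ^ 2) (fun i _ => sq_nonneg _) (Finset.mem_univ i)
    rw [Real.norm_eq_abs]
    nlinarith [sq_nonneg (|b i z| - 1), sq_abs (b i z)]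
  have bu : BddMeas fun p : (ℝ × Rd d) × Rd d => u p.1 :=
    ⟨hu.comp measurable_fst, 1, fun p => hu1 p.1⟩
  have bU := bddMeas_mollRatio (m := m) hωc hωs hω0 hu hu1 hδ
  have bV : ∀ i, BddMeas fun p : (ℝ × Rd d) × Rd d => mollRatioGrad m ω u δ i p.1.1 p.2 :=
    fun i => by
    obtain ⟨C, -, hC⟩ := exists_abs_mollRatioGrad_le m hω' hωs hω0 hu1 hδ i
    exact ⟨(measurable_mollRatioGrad hω' hu i).comp
      (by fun_prop : Measurable fun p : (ℝ × Rd d) × Rd d => (p.1.1, p.2)), C, fun p => hC _ _⟩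
  have bR := bu.sub bU
  have bQ := bddMeas_mollQuad (m := m) hωc hωs hω0 hu hu1 hδ
  have bφ : BddMeas fun p : (ℝ × Rd d) × Rd d => φ p.2 := bddMeas_snd hφ.continuous hφs
  have bφ1 : ∀ i, BddMeas fun p : (ℝ × Rd d) × Rd d => pd i φ p.2 := fun i =>
    bddMeas_snd (continuous_pd hφ' i) (hφs.pd i)
  have bφ2 : ∀ i j, BddMeas fun p : (ℝ × Rd d) × Rd d => pd2 i j φ p.2 := fun i j =>
    bddMeas_snd (continuous_pd2 hφ i j) ((hφs.pd j).pd i)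
  have I : ∀ {g : ℝ × Rd d → ℝ} {k : Rd d → ℝ} {h : (ℝ × Rd d) × Rd d → ℝ}, Integrable g M →
      Integrable k volume → BddMeas h → Integrable (fun p => g p.1 * k (p.2 - p.1.2) * h p)
        (M.prod volume) := fun hg hk hh => by
    obtain ⟨hh, C, hC⟩ := hh
    exact integrable_mul_comp_sub_mul_bdd hg hk hh hC
  have iF1 : Integrable (fun p : (ℝ × Rd d) × Rd d => (T - p.1.1) * (φ p.2 *
      mollQuad m ω u δ p.1.1 p.2 p.1.2 * L0 a b c (fun y => ω (p.2 - y)) p.1)) (M.prod volume) := by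
    refine (((integrable_finsetSum Finset.univ fun i _ => integrable_finsetSum Finset.univ
      fun j _ => I (integrable_sub_fst_mul (ia i j)) (iω2 i j) (bφ.mul bQ)).sub
      (integrable_finsetSum Finset.univ fun i _ => I (integrable_sub_fst_mul (ib i)) (iω1 i)
      (bφ.mul bQ))).add (I (integrable_sub_fst_mul hc) iω (bφ.mul bQ))).congr
      (Eventually.of_forall fun p => ?_)
    have := constL_comp_sub_left hω (fun i j => a i j p.1) (fun i => b i p.1) (c p.1) p.2 p.1.2
    have h' : L0 a b c (fun y => ω (p.2 - y)) p.1 = _ := this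
    dsimp only
    rw [h']
    simp only [Pi.add_apply, Pi.sub_apply, mul_add, mul_sub, Finset.mul_sum]
    refine congr_arg₂ _ (congr_arg₂ _ ?_ ?_) ?_
    · exact Finset.sum_congr rfl fun i _ => Finset.sum_congr rfl fun j _ => by ring
    · exact Finset.sum_congr rfl fun i _ => by ring
    · ring
  have iF2 : Integrable (fun p : (ℝ × Rd d) × Rd d => (T - p.1.1) * (ω (p.2 - p.1.2) *
        mollQuad m ω u δ p.1.1 p.2 p.1.2 * constL (fun i j => a i j p.1) (fun i => b i p.1)
          (c p.1) φ p.2)) (M.prod volume) := by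
    refine (((integrable_finsetSum Finset.univ fun i _ => integrable_finsetSum Finset.univ
      fun j _ => I (integrable_sub_fst_mul (ia i j)) iω (bQ.mul (bφ2 i j))).add
      (integrable_finsetSum Finset.univ fun i _ => I (integrable_sub_fst_mul (ib i)) iω
      (bQ.mul (bφ1 i)))).add (I (integrable_sub_fst_mul hc) iω (bQ.mul bφ))).congr
      (Eventually.of_forall fun p => ?_)
    simp only [constL, Pi.add_apply, mul_add, Finset.mul_sum]
    refine congr_arg₂ _ (congr_arg₂ _ ?_ ?_) ?_
    · exact Finset.sum_congr rfl fun i _ => Finset.sum_congr rfl fun j _ => by ring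
    · exact Finset.sum_congr rfl fun i _ => by ring
    · ring
  have iF3 : Integrable (fun p : (ℝ × Rd d) × Rd d => (T - p.1.1) *
      crossTerm (fun i j => a i j p.1) (fun i => b i p.1) (fun i => pd i φ p.2)
        (fun i => mollRatioGrad m ω u δ i p.1.1 p.2) (fun i => pd i ω (p.2 - p.1.2)) (φ p.2)
        (ω (p.2 - p.1.2)) (u p.1 - mollRatio m ω u δ p.1.1 p.2)) (M.prod volume) := by
    have b2 := (bddMeas_const (X := (ℝ × Rd d) × Rd d) (-2 : ℝ)).mul bR
    refine ((integrable_finsetSum Finset.univ fun i _ => integrable_finsetSum Finset.univ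
      fun j _ => (I (integrable_sub_fst_mul (ia i j)) iω ((bφ1 i).mul (b2.mul (bV j)))).sub
        (I (integrable_sub_fst_mul (ia i j)) (iω1 j) (bφ.mul (b2.mul (bV i))))).add
      (integrable_finsetSum Finset.univ fun i _ => I (integrable_sub_fst_mul (ib i)) iω
      (bφ.mul (b2.mul (bV i))))).congr (Eventually.of_forall fun p => ?_)
    simp only [crossTerm, Pi.add_apply, Pi.sub_apply, mul_add, Finset.mul_sum]
    refine congr_arg₂ _ ?_ ?_
    · exact Finset.sum_congr rfl fun i _ => Finset.sum_congr rfl fun j _ => by ring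
    · exact Finset.sum_congr rfl fun i _ => by ring
  have iF4 : Integrable (fun p : (ℝ × Rd d) × Rd d => ω (p.2 - p.1.2) *
      (φ p.2 * mollQuad m ω u δ p.1.1 p.2 p.1.2)) (M.prod volume) := by
    simpa using I (integrable_const (1 : ℝ)) iω (bφ.mul bQ)
  have iF5 : Integrable (fun p : (ℝ × Rd d) × Rd d => (T - p.1.1) * (1 + ∑ i, b i p.1 ^ 2) *
      κ (p.2 - p.1.2) * sqOsc m ω u δ p) (M.prod volume) := by
    have := I (integrable_sub_fst_mul ib1) iκ (bR.mul bR)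
    simpa only [sqOsc, pow_two] using this
  have hE : 0 ≤ energyConst d a₀ K Λ Φ γ := energyConst_nonneg hK ((hφ0 0).trans (hΦ 0)) hγ
  have hA : ∀ x, φ x * (T * N x) + ∫ t in Icc 0 T, ∫ y, (T - t) * (φ x *
      mollQuad m ω u δ t x y * L0 a b c (fun y => ω (x - y)) (t, y)) ∂(m t)
      ≤ (∫ t in Icc 0 T, ∫ y, ω (x - y) * (φ x * mollQuad m ω u δ t x y) ∂(m t))
        + δ * T * φ x := by
    intro x
    by_cases hx : φ x = 0
    · simp [hx]
    have h := mul_le_mul_of_nonneg_left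
      (entropy_inequality_at hT ia ib hc hω hωs hω0 hu hu1 hδ (hw x hx) (hm x hx)) (hφ0 x)
    rw [mul_add, mul_add, ← integral_const_mul, ← integral_const_mul] at h
    have e1 : ∀ t, ∫ y, (T - t) * (φ x * mollQuad m ω u δ t x y *
        L0 a b c (fun y => ω (x - y)) (t, y)) ∂(m t) = φ x * ((T - t) *
        ∫ y, mollQuad m ω u δ t x y * L0 a b c (fun y => ω (x - y)) (t, y) ∂(m t)) := fun t => by
      rw [← integral_const_mul, ← integral_const_mul]
      exact integral_congr_ae (Eventually.of_forall fun y => by dsimp only; ring)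
    have e2 : ∀ t, ∫ y, ω (x - y) * (φ x * mollQuad m ω u δ t x y) ∂(m t)
        = φ x * ∫ y, ω (x - y) * mollQuad m ω u δ t x y ∂(m t) := fun t => by
      rw [← integral_const_mul]
      exact integral_congr_ae (Eventually.of_forall fun y => by dsimp only; ring)
    simp only [e1, e2]
    linarith
  have hB : T * (∫ x, φ x * N x) + ∫ p, (T - p.1.1) * (φ p.2 * mollQuad m ω u δ p.1.1 p.2 p.1.2 *
        L0 a b c (fun y => ω (p.2 - y)) p.1) ∂(M.prod volume)
      ≤ (∫ p, ω (p.2 - p.1.2) * (φ p.2 * mollQuad m ω u δ p.1.1 p.2 p.1.2) ∂(M.prod volume))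
        + δ * T * (∫ x, φ x) := by
    rw [integral_prod_swapSpace iF1, integral_prod_swapSpace iF4, ← integral_const_mul,
      ← integral_const_mul]
    have j1 := (integrable_integral_swapSpace iF1).integral_prod_right
    have j4 := (integrable_integral_swapSpace iF4).integral_prod_right
    rw [← integral_add (iφN.const_mul T) j1, ← integral_add j4 (iφ.const_mul _)]
    refine integral_mono ((iφN.const_mul T).add j1) (j4.add (iφ.const_mul _)) fun x => ?_
    have := hA x
    dsimp only
    linarith
  have hC : ∫ p, (T - p.1.1) * (φ p.2 * mollQuad m ω u δ p.1.1 p.2 p.1.2 *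
        L0 a b c (fun y => ω (p.2 - y)) p.1) ∂(M.prod volume)
      = (∫ p, (T - p.1.1) * (ω (p.2 - p.1.2) *
        mollQuad m ω u δ p.1.1 p.2 p.1.2 * constL (fun i j => a i j p.1) (fun i => b i p.1)
          (c p.1) φ p.2) ∂(M.prod volume)) + ∫ p, (T - p.1.1) *
      crossTerm (fun i j => a i j p.1) (fun i => b i p.1) (fun i => pd i φ p.2)
        (fun i => mollRatioGrad m ω u δ i p.1.1 p.2) (fun i => pd i ω (p.2 - p.1.2)) (φ p.2)
        (ω (p.2 - p.1.2)) (u p.1 - mollRatio m ω u δ p.1.1 p.2) ∂(M.prod volume) := by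
    rw [← integral_add iF2 iF3, integral_prod _ iF1, integral_prod]
    swap
    · exact iF2.add iF3
    refine integral_congr_ae (Eventually.of_forall fun z => ?_)
    have h := integral_mul_constL (fun i j => hasymm i j z) (fun i => b i z) (c z) hφ hφs
      ((contDiff_mollRatio hω' hωs hω0 hu hu1 hδ z.1 : ContDiff ℝ 1 (mollRatio m ω u δ z.1)))
      hω z.2 (u z)
    simp only [pd_mollRatio hω' hωs hω0 hu hu1 hδ] at h
    dsimp only [Pi.add_apply]
    simp only [← mul_add]
    rw [integral_const_mul, integral_const_mul]
    exact congrArg _ h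
  have hD : -(energyConst d a₀ K Λ Φ γ *
      ∫ p, (T - p.1.1) * (1 + ∑ i, b i p.1 ^ 2) * κ (p.2 - p.1.2) * sqOsc m ω u δ p
        ∂(M.prod volume)) ≤ ∫ p, (T - p.1.1) *
      crossTerm (fun i j => a i j p.1) (fun i => b i p.1) (fun i => pd i φ p.2)
        (fun i => mollRatioGrad m ω u δ i p.1.1 p.2) (fun i => pd i ω (p.2 - p.1.2)) (φ p.2)
        (ω (p.2 - p.1.2)) (u p.1 - mollRatio m ω u δ p.1.1 p.2) ∂(M.prod volume) := by
    rw [integral_swapSpace iF3, integral_swapSpace iF5, ← integral_const_mul, ← integral_neg]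
    refine integral_mono_ae ((integrable_integral_swapSpace iF5).const_mul _).neg
      (integrable_integral_swapSpace iF3) ?_
    have hIcc : ∀ᵐ q : ℝ × Rd d ∂((volume.restrict (Icc 0 T)).prod volume), q.1 ∈ Icc 0 T :=
      Measure.quasiMeasurePreserving_fst.ae (ae_restrict_mem measurableSet_Icc)
    filter_upwards [hIcc, ae_integrable_swapSpace iF3, ae_integrable_swapSpace iF5] with
      ⟨t, x⟩ ht h3 h5
    dsimp only at ht h3 h5 ⊢
    have e5 : ∀ y, (T - t) * (1 + ∑ i, b i (t, y) ^ 2) * κ (x - y) * sqOsc m ω u δ ((t, y), x)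
        = (T - t) * (κ (x - y) * (u (t, y) - mollRatio m ω u δ t x) ^ 2
      * (1 + ∑ i, b i (t, y) ^ 2)) := fun y => by rw [sqOsc]; ring
    simp only [e5] at h5 ⊢
    rw [integral_const_mul, integral_const_mul]
    rcases eq_or_lt_of_le ht.2 with hTt | hTt
    · simp [hTt]
    have hTt' : 0 < T - t := sub_pos.2 hTt
    have h3' := (integrable_const_mul_iff (IsUnit.mk0 _ hTt'.ne') _).1 h3
    have h5' := (integrable_const_mul_iff (IsUnit.mk0 _ hTt'.ne') _).1 h5
    have key : -(energyConst d a₀ K Λ Φ γ * ∫ y, κ (x - y) *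
        (u (t, y) - mollRatio m ω u δ t x) ^ 2 * (1 + ∑ i, b i (t, y) ^ 2) ∂(m t))
        ≤ ∫ y, crossTerm (fun i j => a i j (t, y)) (fun i => b i (t, y)) (fun i => pd i φ x)
      (fun i => mollRatioGrad m ω u δ i t x) (fun i => pd i ω (x - y)) (φ x) (ω (x - y))
      (u (t, y) - mollRatio m ω u δ t x) ∂(m t) := by
      by_cases hx : φ x = 0
      · have hpd : ∀ i, pd i φ x = 0 := fun i => by
          have h1 : pd i φ x ^ 2 ≤ ∑ i, pd i φ x ^ 2 := Finset.single_le_sum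
            (f := fun i => pd i φ x ^ 2) (fun i _ => sq_nonneg _) (Finset.mem_univ i)
          have h2 := hφK x
          rw [hx, mul_zero] at h2
          exact pow_eq_zero_iff two_ne_zero |>.1 (le_antisymm (h1.trans h2) (sq_nonneg _))
        simp only [hx, hpd, crossTerm, zero_mul, mul_zero, sub_zero, Finset.sum_const_zero,
          add_zero, integral_zero]
        refine neg_nonpos.2 (mul_nonneg hE (integral_nonneg fun y => ?_))
        have : 0 ≤ κ (x - y) := (hω0 _).trans (hk _)
        have : 0 ≤ ∑ i, b i (t, y) ^ 2 := Finset.sum_nonneg fun i _ => sq_nonneg _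
        dsimp only [Pi.zero_apply]
        positivity
      · exact neg_le_integral_crossTerm hω' hωs hω0 hω1 hk hκ hu hu1 hδ hγ (hφ0 x) (hΦ x) hK ha
          (hφK x) (hell t ht x hx) (hlip t ht x hx) h3' h5'
    nlinarith [mul_le_mul_of_nonneg_left key hTt'.le]
  linarith

end EnergyInequality

section LimitInequality
variable {d : ℕ} {T : ℝ} {m : Kernel ℝ (Rd d)} [IsFiniteKernel m]
  {a : Fin d → Fin d → ℝ × Rd d → ℝ} {b : Fin d → ℝ × Rd d → ℝ} {c : ℝ × Rd d → ℝ}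
  {φ ω : Rd d → ℝ} {u : ℝ × Rd d → ℝ}

theorem measurable_sub_sq (hu : Measurable u) : Measurable fun z => 1 - u z ^ 2 := by fun_prop

omit [IsFiniteKernel m] in
theorem abs_one_sub_sq_le (hu1 : ∀ z, |u z| ≤ 1) (z : ℝ × Rd d) : |1 - u z ^ 2| ≤ 1 := by
  have := (sq_le_one_iff_abs_le_one _).2 (hu1 z)
  rw [abs_le]
  constructor <;> nlinarith [sq_nonneg (u z)]

theorem tendsto_integral_mul_dil_mul_mollQuad {σ : Measure ℝ} [IsFiniteMeasure σ]
    (hωc : Continuous ω) (hωs : HasCompactSupport ω)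
    (hω0 : ∀ x, 0 ≤ ω x) (hω1 : ∫ x, ω x = 1) (hωr : ∀ z, 1 < ‖z‖ → ω z = 0)
    (hu : Measurable u) (hu1 : ∀ z, |u z| ≤ 1) {g : ℝ × Rd d → ℝ} (hg : Integrable g (σ ⊗ₘ m))
    {f : Rd d → ℝ} (hf : Continuous f) (hfs : HasCompactSupport f) :
    Tendsto (fun n : ℕ => ∫ p, g p.1 * dil (n + 1) ω (p.2 - p.1.2) * (f p.2 *
      mollQuad m (dil (n + 1) ω) u (1 / ((n : ℝ) + 1)) p.1.1 p.2 p.1.2) ∂((σ ⊗ₘ m).prod volume))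
      atTop (𝓝 (∫ z, g z * (1 - u z ^ 2) * f z.2 ∂(σ ⊗ₘ m))) := by
  obtain ⟨C, -, hC⟩ := exists_abs_le_of_hasCompactSupport hf hfs
  have iω : Integrable ω volume := hωc.integrable_of_hasCompactSupport hωs
  have hs : ∀ n : ℕ, (0 : ℝ) < n + 1 := fun n => by positivity
  have hg' : Integrable (fun z => g z * (1 - u z ^ 2)) (σ ⊗ₘ m) :=
    hg.mul_bdd (c := 1) (measurable_sub_sq hu).aestronglyMeasurable
      (Eventually.of_forall (abs_one_sub_sq_le hu1))
  have h1 := tendsto_integral_mul_comp_sub hg' iω hf hC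
  have h2 := tendsto_integral_mul_dil_mul_sqOsc hωc hωs hω0 hω1 hωr hu hu1 hg iω (fun _ h => h)
    hf hC
  have h3 := h1.add h2
  rw [hω1, mul_one, add_zero] at h3
  refine h3.congr fun n => ?_
  rw [← integral_add]
  · refine integral_congr_ae (Eventually.of_forall fun p => ?_)
    dsimp only
    rw [mollQuad_eq, sqOsc]
    ring
  · exact integrable_mul_comp_sub_mul_bdd hg' (iω.dil (hs n)) (hf.measurable.comp measurable_snd)
      fun p => hC p.2
  · refine integrable_mul_comp_sub_mul_bdd hg (iω.dil (hs n))
      ((hf.measurable.comp measurable_snd).mul (measurable_sqOsc (hωc.dil _) hu _)) (C := C * 4)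
      fun p => ?_
    rw [abs_mul]
    exact mul_le_mul (hC _) (abs_sqOsc_le (hωc.dil _) (hωs.dil (hs n)) (dil_nonneg hω0 (hs n)) hu1
      (by positivity) p) (abs_nonneg _) ((abs_nonneg _).trans (hC p.2))

theorem tendsto_integral_mul_integral_dil {ν : Measure (Rd d)} [IsFiniteMeasure ν]
    (hωc : Continuous ω) (hωs : HasCompactSupport ω) (hω1 : ∫ x, ω x = 1)
    (hφ : Continuous φ) (hφs : HasCompactSupport φ) :
    Tendsto (fun n : ℕ => ∫ x, φ x * ∫ y, dil (n + 1) ω (x - y) ∂ν) atTop (𝓝 (∫ x, φ x ∂ν)) := by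
  obtain ⟨C, -, hC⟩ := exists_abs_le_of_hasCompactSupport hφ hφs
  have iω : Integrable ω volume := hωc.integrable_of_hasCompactSupport hωs
  have hmk : Measurable (Prod.mk (0 : ℝ) : Rd d → ℝ × Rd d) := measurable_prodMk_left
  have h := tendsto_integral_mul_comp_sub (M := ν.map (Prod.mk (0 : ℝ)))
    (integrable_const (1 : ℝ)) iω hφ hC
  rw [hω1, mul_one, integral_map hmk.aemeasurable
    (by have := hφ.measurable; exact Measurable.aestronglyMeasurable (by fun_prop))] at h
  simp only [one_mul] at h
  refine h.congr fun n => ?_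
  have hi := integrable_mul_comp_sub_mul_bdd (M := ν.map (Prod.mk (0 : ℝ)))
    (integrable_const (1 : ℝ)) (iω.dil (s := (n : ℝ) + 1) (by positivity))
    (hφ.measurable.comp measurable_snd) fun p => hC p.2
  simp only [one_mul, Function.comp_apply] at hi
  rw [integral_prod_symm _ hi]
  refine integral_congr_ae (Eventually.of_forall fun x => ?_)
  dsimp only
  rw [integral_map hmk.aemeasurable, integral_mul_const, mul_comm]
  have := (hωc.dil ((n : ℝ) + 1)).measurable
  exact Measurable.aestronglyMeasurable (by fun_prop)

theorem tsupport_comp_sub_left_subset (hωr : ∀ z, 1 < ‖z‖ → ω z = 0) (x : Rd d) :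
    tsupport (fun y => ω (x - y)) ⊆ Metric.closedBall x 1 := by
  refine closure_minimal (fun y hy => ?_) Metric.isClosed_closedBall
  rw [Metric.mem_closedBall', dist_eq_norm]
  exact not_lt.1 fun h => hy (hωr _ h)

omit [IsFiniteKernel m] in
theorem integral_sum_add_sum_add {X : Type*} [MeasurableSpace X] {P : Measure X}
    {f : Fin d → Fin d → X → ℝ} {g : Fin d → X → ℝ} {h : X → ℝ} (hf : ∀ i j, Integrable (f i j) P)
    (hg : ∀ i, Integrable (g i) P) (hh : Integrable h P) :
    ∫ p, ((∑ i, ∑ j, f i j p) + ∑ i, g i p) + h p ∂P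
      = ((∑ i, ∑ j, ∫ p, f i j p ∂P) + ∑ i, ∫ p, g i p ∂P) + ∫ p, h p ∂P := by
  have h1 : ∀ i, Integrable (fun p => ∑ j, f i j p) P := fun i =>
    integrable_finsetSum _ fun j _ => hf i j
  have h2 : Integrable (fun p => ∑ i, ∑ j, f i j p) P := integrable_finsetSum _ fun i _ => h1 i
  have h3 : Integrable (fun p => ∑ i, g i p) P := integrable_finsetSum _ fun i _ => hg i
  rw [integral_add (f := fun p => (∑ i, ∑ j, f i j p) + ∑ i, g i p) (h2.add h3) hh,
    integral_add h2 h3, integral_finsetSum _ fun i _ => h1 i, integral_finsetSum _ fun i _ => hg i]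
  simp only [integral_finsetSum _ fun j _ => hf _ j]

theorem weighted_inequality (hT : 0 < T) (hasymm : ∀ i j z, a i j z = a j i z) {a₀ : ℝ}
    (ham : ∀ i j, Measurable (a i j)) (ha : ∀ i j z, |a i j z| ≤ a₀)
    (hbm : ∀ i, Measurable (b i))
    (hb : Integrable (fun z => ∑ i, b i z ^ 2) (volume.restrict (Icc 0 T) ⊗ₘ m))
    (hc : Integrable c (volume.restrict (Icc 0 T) ⊗ₘ m))
    (hφ : ContDiff ℝ 2 φ) (hφs : HasCompactSupport φ) (hφ0 : ∀ x, 0 ≤ φ x) {Φ K : ℝ}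
    (hΦ : ∀ x, φ x ≤ Φ) (hK : 0 ≤ K) (hφK : ∀ x, ∑ i, pd i φ x ^ 2 ≤ K * φ x) {γ Λ : ℝ}
    (hγ : 0 < γ) (hell : ∀ t ∈ Icc 0 T, ∀ x, φ x ≠ 0 → ∀ ξ : Fin d → ℝ,
      γ * ∑ i, ξ i ^ 2 ≤ ∑ i, ∑ j, a i j (t, x) * ξ i * ξ j)
    (hlip : ∀ t ∈ Icc 0 T, ∀ x, φ x ≠ 0 → ∀ y i j, dist x y ≤ 1 →
      |a i j (t, y) - a i j (t, x)| ≤ Λ * dist x y)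
    (hu : Measurable u) (hu1 : ∀ z, |u z| ≤ 1) {ν : Measure (Rd d)} [IsFiniteMeasure ν]
    {B : Set (Rd d)} (hB : ∀ x, φ x ≠ 0 → Metric.closedBall x 1 ⊆ B)
    (hw : ∀ ψ : Rd d → ℝ, IsTest ψ → tsupport ψ ⊆ B → ∀ᵐ t ∂(volume.restrict (Icc 0 T)),
      ∫ y, ψ y * u (t, y) ∂(m t)
        = ∫ s in (0 : ℝ)..t, ∫ y, L0 a b c ψ (s, y) * u (s, y) ∂(m s))
    (hm : ∀ ψ : Rd d → ℝ, IsTest ψ → tsupport ψ ⊆ B → ∀ᵐ t ∂(volume.restrict (Icc 0 T)),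
      ∫ y, ψ y ∂(m t) = ∫ y, ψ y ∂ν + ∫ s in (0 : ℝ)..t, ∫ y, L0 a b c ψ (s, y) ∂(m s)) :
    T * (∫ x, φ x ∂ν) + ∫ z, (T - z.1) * (1 - u z ^ 2) * L0 a b c φ z
        ∂(volume.restrict (Icc 0 T) ⊗ₘ m)
      ≤ ∫ z, (1 - u z ^ 2) * φ z.2 ∂(volume.restrict (Icc 0 T) ⊗ₘ m) := by
  obtain ⟨ω, κ, hω, hωs, hω0, hω1, hωr, hκc, hκs, hωκ, hκ0, hκ⟩ := exists_mollifier d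
  set M := volume.restrict (Icc 0 T) ⊗ₘ m with hM
  have hωc := hω.continuous
  have hω2 : ContDiff ℝ 2 ω := by exact_mod_cast contDiff_infty.1 hω 2
  have hφ' : ContDiff ℝ 1 φ := hφ.of_le (by norm_num)
  have iω : Integrable ω volume := hωc.integrable_of_hasCompactSupport hωs
  have iκ : Integrable κ volume := hκc.integrable_of_hasCompactSupport hκs
  have hs : ∀ n : ℕ, (0 : ℝ) < n + 1 := fun n => by positivity
  have hωr' : ∀ (n : ℕ) z, 1 < ‖z‖ → dil (n + 1) ω z = 0 := fun n z hz =>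
    dil_eq_zero hωr (hs n) (lt_of_le_of_lt (by
      rw [div_le_one (hs n)]; linarith [(Nat.cast_nonneg n : (0 : ℝ) ≤ n)]) hz)
  have ia : ∀ i j, Integrable (a i j) M := fun i j =>
    Integrable.of_bound (ham i j).aestronglyMeasurable a₀ (Eventually.of_forall (ha i j))
  have ib1 : Integrable (fun z => 1 + ∑ i, b i z ^ 2) M := (integrable_const _).add hb
  have ib : ∀ i, Integrable (b i) M := fun i => by
    refine ib1.mono' (hbm i).aestronglyMeasurable (Eventually.of_forall fun z => ?_)
    have h1 : b i z ^ 2 ≤ ∑ i, b i z ^ 2 :=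
      Finset.single_le_sum (f := fun i => b i z ^ 2) (fun i _ => sq_nonneg _) (Finset.mem_univ i)
    rw [Real.norm_eq_abs]
    nlinarith [sq_nonneg (|b i z| - 1), sq_abs (b i z)]
  have hineq := fun n : ℕ => energy_inequality (m := m) (ω := dil (n + 1) ω) (κ := dil (n + 1) κ)
    (δ := 1 / ((n : ℝ) + 1)) (N := fun x => ∫ y, dil (n + 1) ω (x - y) ∂ν)
    hT hasymm ham ha hbm hb hc hφ hφs hφ0 hΦ hK hφK hγ hell hlip
    (hω2.dil _) (hωs.dil (hs n)) (dil_nonneg hω0 (hs n)) (hωr' n)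
    (fun z => mul_le_mul_of_nonneg_left (hωκ _) (by positivity)) (hκc.dil _) (hκs.dil (hs n))
    (norm_mul_pd_dil_sq_le (hω2.differentiable two_ne_zero) hκ (hs n)) hu hu1 (by positivity)
    (by
      have := (contDiff_integral_comp_sub_mul (μ := ν) (n := 0)
        (hf := contDiff_zero.2 (hωc.dil (n + 1)))
        (hωs.dil (hs n)) (integrable_const (1 : ℝ))).continuous
      simpa using this)
    (fun x hx => hw _ ⟨(hω.dil _).comp (contDiff_const.sub contDiff_id),
      hasCompactSupport_comp_sub_left (hωs.dil (hs n)) x⟩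
      ((tsupport_comp_sub_left_subset (hωr' n) x).trans (hB x hx)))
    (fun x hx => by
      simpa only [moll, mul_one] using hm (fun y => dil (n + 1) ω (x - y))
        ⟨(hω.dil _).comp (contDiff_const.sub contDiff_id),
        hasCompactSupport_comp_sub_left (hωs.dil (hs n)) x⟩
        ((tsupport_comp_sub_left_subset (hωr' n) x).trans (hB x hx)))
  have lim := fun {g : ℝ × Rd d → ℝ} (hg : Integrable g M) {f : Rd d → ℝ} (hf : Continuous f)
    (hfs : HasCompactSupport f) => tendsto_integral_mul_dil_mul_mollQuad hωc hωs hω0 hω1 hωr hu hu1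
      hg hf hfs
  have l4 := lim (integrable_const (1 : ℝ)) hφ.continuous hφs
  have l5 := tendsto_integral_mul_dil_mul_sqOsc hωc hωs hω0 hω1 hωr hu hu1
    (integrable_sub_fst_mul ib1) iκ hκ0 (continuous_const (y := (1 : ℝ))) (C := 1) (by simp)
  have lN := tendsto_integral_mul_integral_dil (ν := ν) hωc hωs hω1 hφ.continuous hφs
  have lδ : Tendsto (fun n : ℕ => 1 / ((n : ℝ) + 1)) atTop (𝓝 0) :=
    tendsto_one_div_add_atTop_nhds_zero_nat
  have l2 : Tendsto (fun n : ℕ => ∫ p, (T - p.1.1) * (dil (n + 1) ω (p.2 - p.1.2) *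
        mollQuad m (dil (n + 1) ω) u (1 / ((n : ℝ) + 1)) p.1.1 p.2 p.1.2 *
        constL (fun i j => a i j p.1) (fun i => b i p.1) (c p.1) φ p.2) ∂(M.prod volume)) atTop
      (𝓝 (∫ z, (T - z.1) * (1 - u z ^ 2) * L0 a b c φ z ∂M)) := by
    have l2a := fun i j => lim (integrable_sub_fst_mul (ia i j)) (continuous_pd2 hφ i j)
      ((hφs.pd j).pd i)
    have l2b := fun i => lim (integrable_sub_fst_mul (ib i)) (continuous_pd hφ' i) (hφs.pd i)
    have l2c := lim (integrable_sub_fst_mul hc) hφ.continuous hφs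
    have l := ((tendsto_finsetSum Finset.univ fun i _ => tendsto_finsetSum Finset.univ
      fun j _ => l2a i j).add (tendsto_finsetSum Finset.univ fun i _ => l2b i)).add l2c
    have J1 : ∀ {g : ℝ × Rd d → ℝ} (_ : Integrable g M) {f : Rd d → ℝ} (_ : Continuous f)
        (_ : HasCompactSupport f), Integrable (fun z => g z * (1 - u z ^ 2) * f z.2) M :=
      fun {_} hg {f} hf hfs => by
      obtain ⟨C, -, hC⟩ := exists_abs_le_of_hasCompactSupport hf hfs
      exact (hg.mul_bdd (c := 1) (measurable_sub_sq hu).aestronglyMeasurable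
        (Eventually.of_forall (abs_one_sub_sq_le hu1))).mul_bdd (c := C)
        (hf.measurable.comp measurable_snd).aestronglyMeasurable
        (Eventually.of_forall fun z => hC z.2)
    have J2 : ∀ {g : ℝ × Rd d → ℝ} (_ : Integrable g M) {f : Rd d → ℝ} (_ : Continuous f)
        (_ : HasCompactSupport f) (n : ℕ), Integrable (fun p => g p.1 *
          dil (n + 1) ω (p.2 - p.1.2) * (f p.2 * mollQuad m (dil (n + 1) ω) u
          (1 / ((n : ℝ) + 1)) p.1.1 p.2 p.1.2)) (M.prod volume) := fun {_} hg {f} hf hfs n => by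
      obtain ⟨hh, C, hC⟩ := (bddMeas_snd (X := ℝ × Rd d) hf hfs).mul
        (bddMeas_mollQuad (m := m) (hωc.dil ((n : ℝ) + 1)) (hωs.dil (hs n))
          (dil_nonneg hω0 (hs n)) hu hu1 (δ := 1 / ((n : ℝ) + 1)) (by positivity))
      exact integrable_mul_comp_sub_mul_bdd hg (iω.dil (hs n)) hh hC
    rw [← integral_sum_add_sum_add
      (fun i j => J1 (integrable_sub_fst_mul (ia i j)) (continuous_pd2 hφ i j) ((hφs.pd j).pd i))
      (fun i => J1 (integrable_sub_fst_mul (ib i)) (continuous_pd hφ' i) (hφs.pd i))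
      (J1 (integrable_sub_fst_mul hc) hφ.continuous hφs)] at l
    have e : ∀ z : ℝ × Rd d, (T - z.1) * (1 - u z ^ 2) * L0 a b c φ z
        = ((∑ i, ∑ j, (T - z.1) * a i j z * (1 - u z ^ 2) * pd2 i j φ z.2)
          + ∑ i, (T - z.1) * b i z * (1 - u z ^ 2) * pd i φ z.2)
          + (T - z.1) * c z * (1 - u z ^ 2) * φ z.2 := fun z => by
      simp only [L0, mul_add, Finset.mul_sum]
      refine congr_arg₂ _ (congr_arg₂ _ ?_ ?_) ?_
      · exact Finset.sum_congr rfl fun i _ => Finset.sum_congr rfl fun j _ => by ring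
      · exact Finset.sum_congr rfl fun i _ => by ring
      · ring
    simp only [e]
    refine l.congr fun n => ?_
    rw [← integral_sum_add_sum_add
      (fun i j => J2 (integrable_sub_fst_mul (ia i j)) (continuous_pd2 hφ i j)
        ((hφs.pd j).pd i) n)
      (fun i => J2 (integrable_sub_fst_mul (ib i)) (continuous_pd hφ' i) (hφs.pd i) n)
      (J2 (integrable_sub_fst_mul hc) hφ.continuous hφs n)]
    refine integral_congr_ae (Eventually.of_forall fun p => ?_)
    simp only [constL, mul_add, Finset.mul_sum]
    refine congr_arg₂ _ (congr_arg₂ _ ?_ ?_) ?_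
    · exact Finset.sum_congr rfl fun i _ => Finset.sum_congr rfl fun j _ => by ring
    · exact Finset.sum_congr rfl fun i _ => by ring
    · ring
  have lL := (lN.const_mul T).add l2
  have lR := (l4.add ((lδ.mul_const T).mul_const (∫ x, φ x))).add
    (l5.const_mul (energyConst d a₀ K Λ Φ γ))
  simp only [one_mul, zero_mul, mul_zero, add_zero] at lL lR
  refine le_of_tendsto_of_tendsto' lL lR fun n => ?_
  have h := hineq n
  simp only [mul_assoc] at h ⊢
  linarith

end LimitInequality

section Cutoff

theorem hasDerivAt_max_zero_pow (n : ℕ) (s : ℝ) :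
    HasDerivAt (fun s : ℝ => max s 0 ^ (n + 2)) ((n + 2) * max s 0 ^ (n + 1)) s := by
  rcases lt_trichotomy s 0 with hs | rfl | hs
  · have h : (fun s : ℝ => max s 0 ^ (n + 2)) =ᶠ[𝓝 s] fun _ => 0 := by
      filter_upwards [gt_mem_nhds hs] with r hr
      simp [max_eq_right hr.le]
    simpa [max_eq_right hs.le] using (hasDerivAt_const s (0 : ℝ)).congr_of_eventuallyEq h
  · have h : HasDerivAt (fun s : ℝ => max s 0 ^ (n + 2)) 0 0 := by
      rw [hasDerivAt_iff_isLittleO_nhds_zero]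
      simp only [zero_add, max_self, smul_zero, sub_zero, ne_eq, Nat.add_eq_zero_iff,
        OfNat.ofNat_ne_zero, and_false, not_false_eq_true, zero_pow]
      refine Asymptotics.IsBigO.trans_isLittleO (g := fun s : ℝ => s ^ (n + 2)) ?_
        (Asymptotics.isLittleO_pow_id (by omega))
      refine Asymptotics.isBigO_of_le _ fun s => ?_
      rw [Real.norm_eq_abs, Real.norm_eq_abs, abs_pow, abs_pow]
      refine pow_le_pow_left₀ (abs_nonneg _) ?_ _
      rcases le_total s 0 with h | h
      · simp [max_eq_right h]
      · simp [max_eq_left h]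
    simpa using h
  · have h : (fun s : ℝ => max s 0 ^ (n + 2)) =ᶠ[𝓝 s] fun s => s ^ (n + 2) := by
      filter_upwards [lt_mem_nhds hs] with r hr
      simp [max_eq_left hr.le]
    have := (hasDerivAt_pow (n + 2) s).congr_of_eventuallyEq h
    simpa [max_eq_left hs.le] using this

/-- The `C²` cutoff profile `s ↦ (1 - s/N)₊³`. -/
def cubeCutoff (N s : ℝ) : ℝ := max (1 - s / N) 0 ^ 3

theorem hasDerivAt_max_one_sub_pow (n : ℕ) (N s : ℝ) :
    HasDerivAt (fun s : ℝ => max (1 - s / N) 0 ^ (n + 2))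
      (-((n + 2) / N) * max (1 - s / N) 0 ^ (n + 1)) s := by
  have h1 : HasDerivAt (fun s : ℝ => 1 - s / N) (-(1 / N)) s := by
    simpa using ((hasDerivAt_id s).div_const N).const_sub 1
  have := (hasDerivAt_max_zero_pow n (1 - s / N)).comp s h1
  exact this.congr_deriv (by ring)

theorem deriv_cubeCutoff (N : ℝ) :
    deriv (cubeCutoff N) = fun s => -(3 / N) * max (1 - s / N) 0 ^ 2 := by
  funext s
  have := (hasDerivAt_max_one_sub_pow 1 N s).deriv
  norm_num at this
  rw [neg_mul]
  exact this

theorem deriv_deriv_cubeCutoff (N : ℝ) :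
    deriv (deriv (cubeCutoff N)) = fun s => 6 / N ^ 2 * max (1 - s / N) 0 := by
  funext s
  rw [deriv_cubeCutoff]
  have := ((hasDerivAt_max_one_sub_pow 0 N s).const_mul (-(3 / N))).deriv
  norm_num at this ⊢
  rw [this]
  ring

theorem contDiff_cubeCutoff (N : ℝ) : ContDiff ℝ 2 (cubeCutoff N) := by
  have h0 : ContDiff ℝ 0 (deriv (deriv (cubeCutoff N))) := by
    rw [deriv_deriv_cubeCutoff, contDiff_zero]
    fun_prop
  have h1 : ContDiff ℝ 1 (deriv (cubeCutoff N)) := by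
    rw [show (1 : WithTop ℕ∞) = 0 + 1 from rfl, contDiff_succ_iff_deriv]
    refine ⟨fun s => ?_, by simp, h0⟩
    rw [deriv_cubeCutoff]
    exact ((hasDerivAt_max_one_sub_pow 0 N s).const_mul _).differentiableAt
  rw [show (2 : WithTop ℕ∞) = 1 + 1 from rfl, contDiff_succ_iff_deriv]
  exact ⟨fun s => (hasDerivAt_max_one_sub_pow 1 N s).differentiableAt, by simp, h1⟩

variable {d : ℕ} {G : ℝ → ℝ} {V : Rd d → ℝ}

theorem pd_comp (hG : Differentiable ℝ G) (hV : Differentiable ℝ V) (i : Fin d) :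
    pd i (fun x => G (V x)) = fun x => deriv G (V x) * pd i V x := by
  funext x
  have := ((hG (V x)).hasDerivAt.comp_hasFDerivAt x (hV x).hasFDerivAt).fderiv
  simp only [pd]
  change fderiv ℝ (G ∘ V) x _ = _
  rw [this]
  simp

theorem pd2_comp (hG : ContDiff ℝ 2 G) (hV : ContDiff ℝ 2 V) (i j : Fin d) (x : Rd d) :
    pd2 i j (fun x => G (V x)) x
      = deriv (deriv G) (V x) * (pd i V x * pd j V x) + deriv G (V x) * pd2 i j V x := by
  have hVd : Differentiable ℝ V := hV.differentiable two_ne_zero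
  have hG' : ContDiff ℝ 1 (deriv G) := by
    rw [show (2 : WithTop ℕ∞) = 1 + 1 from rfl, contDiff_succ_iff_deriv] at hG
    exact hG.2.2
  have hGd : Differentiable ℝ (deriv G) := hG'.differentiable one_ne_zero
  have hVp : Differentiable ℝ (pd j V) :=
    (ContDiff.pd (m := 1) hV (by norm_num) j).differentiable one_ne_zero
  rw [pd2_eq, pd_comp (hG.differentiable two_ne_zero) hVd, pd_mul (f := fun y => deriv G (V y)) i
    (hGd.comp hVd x) (hVp x),
    pd_comp hGd hVd, pd2_eq]
  ring

theorem L0_comp {a : Fin d → Fin d → ℝ × Rd d → ℝ} {b : Fin d → ℝ × Rd d → ℝ}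
    {c : ℝ × Rd d → ℝ} (hG : ContDiff ℝ 2 G) (hV : ContDiff ℝ 2 V) (z : ℝ × Rd d) :
    L0 a b c (fun x => G (V x)) z = deriv (deriv G) (V z.2) *
        (∑ i, ∑ j, a i j z * pd i V z.2 * pd j V z.2)
      + deriv G (V z.2) * (L0 a b c V z - c z * V z.2) + c z * G (V z.2) := by
  have hVd : Differentiable ℝ V := hV.differentiable two_ne_zero
  simp only [L0, pd2_comp hG hV, pd_comp (hG.differentiable two_ne_zero) hVd, mul_add,
    add_sub_cancel_right, Finset.mul_sum, Finset.sum_add_distrib]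
  have e1 : ∀ i j, a i j z * (deriv (deriv G) (V z.2) * (pd i V z.2 * pd j V z.2))
      = deriv (deriv G) (V z.2) * (a i j z * pd i V z.2 * pd j V z.2) := fun i j => by ring
  have e2 : ∀ i j, a i j z * (deriv G (V z.2) * pd2 i j V z.2)
      = deriv G (V z.2) * (a i j z * pd2 i j V z.2) := fun i j => by ring
  have e3 : ∀ i, b i z * (deriv G (V z.2) * pd i V z.2)
      = deriv G (V z.2) * (b i z * pd i V z.2) := fun i => by ring
  simp only [e1, e2, e3]
  ring

theorem le_L0_cubeCutoff {a : Fin d → Fin d → ℝ × Rd d → ℝ} {b : Fin d → ℝ × Rd d → ℝ}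
    {c : ℝ × Rd d → ℝ} (hV : ContDiff ℝ 2 V) {z : ℝ × Rd d}
    (ha : ∀ ξ : Fin d → ℝ, 0 ≤ ∑ i, ∑ j, a i j z * ξ i * ξ j) {C N : ℝ} (hN : 0 < N)
    (hL : L0 a b c V z ≤ C + C * V z.2) :
    -(3 / N) * max (1 - V z.2 / N) 0 ^ 2 * (C + C * V z.2 - c z * V z.2)
        + c z * cubeCutoff N (V z.2)
      ≤ L0 a b c (fun x => cubeCutoff N (V x)) z := by
  rw [L0_comp (contDiff_cubeCutoff N) hV, deriv_deriv_cubeCutoff, deriv_cubeCutoff]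
  dsimp only
  have h1 : 0 ≤ 6 / N ^ 2 * max (1 - V z.2 / N) 0 := by positivity
  have h2 : 0 ≤ (3 / N) * max (1 - V z.2 / N) 0 ^ 2 := by positivity
  have h3 := mul_nonneg h1 (ha fun i => pd i V z.2)
  have h4 := mul_le_mul_of_nonneg_left hL h2
  linarith

theorem cubeCutoff_nonneg (N s : ℝ) : 0 ≤ cubeCutoff N s := by rw [cubeCutoff]; positivity

theorem max_one_sub_le_one {N s : ℝ} (hN : 0 < N) (hs : 0 < s) : max (1 - s / N) 0 ≤ 1 :=
  max_le (by linarith [div_pos hs hN]) zero_le_one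

theorem cubeCutoff_le_one {N s : ℝ} (hN : 0 < N) (hs : 0 < s) : cubeCutoff N s ≤ 1 :=
  pow_le_one₀ (le_max_right _ _) (max_one_sub_le_one hN hs)

theorem lt_of_max_one_sub_ne_zero {N s : ℝ} (hN : 0 < N) (h : max (1 - s / N) 0 ≠ 0) : s < N := by
  by_contra! hs
  exact h (max_eq_right (by rw [sub_nonpos, le_div_iff₀ hN, one_mul]; exact hs))

theorem lt_of_cubeCutoff_ne_zero {N s : ℝ} (hN : 0 < N) (h : cubeCutoff N s ≠ 0) : s < N :=
  lt_of_max_one_sub_ne_zero hN fun h0 => h (by simp [cubeCutoff, h0])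

theorem tendsto_max_one_sub (s : ℝ) :
    Tendsto (fun n : ℕ => max (1 - s / ((n : ℝ) + 1)) 0) atTop (𝓝 1) := by
  have h : Tendsto (fun n : ℕ => s / ((n : ℝ) + 1)) atTop (𝓝 0) := by
    simpa [div_eq_mul_inv] using (tendsto_one_div_add_atTop_nhds_zero_nat (𝕜 := ℝ)).const_mul s
  simpa using (h.const_sub 1).max (tendsto_const_nhds (x := (0 : ℝ)))

theorem tendsto_cubeCutoff (s : ℝ) :
    Tendsto (fun n : ℕ => cubeCutoff ((n : ℝ) + 1) s) atTop (𝓝 1) := by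
  simpa [cubeCutoff] using (tendsto_max_one_sub s).pow 3

theorem exists_subset_ball_of_tendsto_cocompact
    (hVinf : Tendsto V (cocompact (Rd d)) atTop) (N : ℝ) :
    ∃ R : ℝ, 0 < R ∧ ∀ x, V x ≤ N → ‖x‖ < R := by
  obtain ⟨s, hs, hsN⟩ := mem_cocompact.1 (hVinf (Ioi_mem_atTop N))
  obtain ⟨R, hR, hsR⟩ := hs.isBounded.subset_ball_lt 0 0
  refine ⟨R, hR, fun x hx => ?_⟩
  by_contra h
  have hxs : x ∉ s := fun hxs => h (by simpa using hsR hxs)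
  exact absurd (hsN hxs) (not_lt.2 hx)

theorem hasCompactSupport_of_ne_zero_imp_lt {f : Rd d → ℝ} {N : ℝ}
    (hVinf : Tendsto V (cocompact (Rd d)) atTop) (hf : ∀ x, f x ≠ 0 → V x < N) :
    HasCompactSupport f := by
  obtain ⟨R, -, hR⟩ := exists_subset_ball_of_tendsto_cocompact hVinf N
  refine HasCompactSupport.of_support_subset_isCompact (isCompact_closedBall (0 : Rd d) R)
    fun x hx => ?_
  simpa using (hR x (hf x hx).le).le

theorem exists_sum_pd_cubeCutoff_sq_le (hV : ContDiff ℝ 2 V)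
    (hVinf : Tendsto V (cocompact (Rd d)) atTop) {N : ℝ} (hN : 0 < N) :
    ∃ K, 0 ≤ K ∧ ∀ x, ∑ i, pd i (fun x => cubeCutoff N (V x)) x ^ 2
      ≤ K * cubeCutoff N (V x) := by
  have hV1 : ContDiff ℝ 1 V := hV.of_le (by norm_num)
  have hVc := hV.continuous
  have hfc : Continuous fun x => max (1 - V x / N) 0 * ∑ i, pd i V x ^ 2 :=
    ((continuous_const.sub (hVc.div_const N)).max continuous_const).mul
      (continuous_finsetSum _ fun i _ => (continuous_pd hV1 i).pow 2)
  obtain ⟨K, hK, hfK⟩ := exists_abs_le_of_hasCompactSupport hfc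
    (hasCompactSupport_of_ne_zero_imp_lt hVinf fun x hx =>
      lt_of_max_one_sub_ne_zero hN (left_ne_zero_of_mul hx))
  refine ⟨(3 / N) ^ 2 * K, by positivity, fun x => ?_⟩
  have h1 := (le_abs_self _).trans (hfK x)
  have h2 : 0 ≤ (3 / N) ^ 2 * max (1 - V x / N) 0 ^ 3 := by positivity
  have h3 := mul_le_mul_of_nonneg_left h1 h2
  simp only [pd_comp ((contDiff_cubeCutoff N).differentiable two_ne_zero)
    (hV.differentiable two_ne_zero), deriv_cubeCutoff, mul_pow, ← Finset.mul_sum]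
  rw [cubeCutoff]
  linarith

end Cutoff

section Lyapunov
variable {d : ℕ}

theorem abs_entry_le {A : Fin d → Fin d → ℝ} (hA : ∀ i j, A i j = A j i) {M : ℝ}
    (h0 : ∀ ξ : Fin d → ℝ, 0 ≤ ∑ i, ∑ j, A i j * ξ i * ξ j)
    (hM : ∀ ξ : Fin d → ℝ, ∑ i, ∑ j, A i j * ξ i * ξ j ≤ M * ∑ i, ξ i ^ 2) (i j : Fin d) :
    |A i j| ≤ M := by
  have hq : ∀ s : ℝ, ∑ k, ∑ l, A k l * (Pi.single (M := fun _ => ℝ) i 1 k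
      + s * Pi.single (M := fun _ => ℝ) j 1 k) * (Pi.single (M := fun _ => ℝ) i 1 l
      + s * Pi.single (M := fun _ => ℝ) j 1 l) = A i i + 2 * s * A i j + s ^ 2 * A j j := by
    intro s
    simp only [Pi.single_apply, mul_add, add_mul, Finset.sum_add_distrib, mul_ite, ite_mul,
      mul_one, mul_zero, zero_mul, Finset.sum_ite_eq', Finset.mem_univ, if_true]
    rw [hA j i]
    ring
  have hn : ∀ s : ℝ, ∑ k, (Pi.single (M := fun _ => ℝ) i 1 k
      + s * Pi.single (M := fun _ => ℝ) j 1 k) ^ 2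
      = 1 + 2 * s * (if i = j then 1 else 0) + s ^ 2 := by
    intro s
    simp only [Pi.single_apply, pow_two, mul_add, add_mul, Finset.sum_add_distrib, mul_ite,
      ite_mul, mul_one, mul_zero, zero_mul, Finset.sum_ite_eq', Finset.mem_univ, if_true]
    by_cases h : i = j
    · simp only [h, if_true]; ring
    · simp only [h, Ne.symm h, if_false]; ring
  have p0 := h0 fun k => Pi.single (M := fun _ => ℝ) i 1 k + 1 * Pi.single (M := fun _ => ℝ) j 1 k
  have p1 := h0 fun k =>
    Pi.single (M := fun _ => ℝ) i 1 k + (-1) * Pi.single (M := fun _ => ℝ) j 1 k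
  have p2 := hM fun k => Pi.single (M := fun _ => ℝ) i 1 k + 1 * Pi.single (M := fun _ => ℝ) j 1 k
  have p3 := hM fun k =>
    Pi.single (M := fun _ => ℝ) i 1 k + (-1) * Pi.single (M := fun _ => ℝ) j 1 k
  rw [hq] at p0 p1 p2 p3
  rw [hn] at p2 p3
  rw [abs_le]
  split_ifs at p2 p3 with h <;> constructor <;> linarith

variable {T : ℝ} {m : Kernel ℝ (Rd d)} [IsFiniteKernel m]
  {a : Fin d → Fin d → ℝ × Rd d → ℝ} {b : Fin d → ℝ × Rd d → ℝ} {c : ℝ × Rd d → ℝ}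
  {u : ℝ × Rd d → ℝ}

/-- Truncation of a coefficient to the cylinder `[0,T] × B(0,R)`. -/
def cyl (T R : ℝ) (g : ℝ × Rd d → ℝ) : ℝ × Rd d → ℝ :=
  (Icc 0 T ×ˢ Metric.ball (0 : Rd d) R).indicator g

theorem cyl_of_mem {R : ℝ} (g : ℝ × Rd d → ℝ) {t : ℝ} (ht : t ∈ Icc 0 T) {x : Rd d}
    (hx : x ∈ Metric.ball (0 : Rd d) R) : cyl T R g (t, x) = g (t, x) :=
  indicator_of_mem (mk_mem_prod ht hx) g

theorem measurable_cyl {R : ℝ} {g : ℝ × Rd d → ℝ} (hg : Measurable g) : Measurable (cyl T R g) :=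
  hg.indicator (measurableSet_Icc.prod measurableSet_ball)

theorem L0_cyl {R : ℝ} {ψ : Rd d → ℝ} (hψ : tsupport ψ ⊆ Metric.ball 0 R) {t : ℝ}
    (ht : t ∈ Icc 0 T) (x : Rd d) :
    L0 (fun i j => cyl T R (a i j)) (fun i => cyl T R (b i)) c ψ (t, x) = L0 a b c ψ (t, x) := by
  by_cases hx : x ∈ Metric.ball (0 : Rd d) R
  · simp only [L0, cyl_of_mem _ ht hx]
  · have h1 : ∀ i, pd i ψ x = 0 := fun i => by
      by_contra h
      exact hx (hψ (support_pd_subset i ψ h))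
    have h2 : ∀ i j, pd2 i j ψ x = 0 := fun i j => by
      by_contra h
      rw [pd2_eq] at h
      exact hx (hψ (tsupport_pd_subset j ψ (support_pd_subset i _ h)))
    simp only [L0, h1, h2, mul_zero]

theorem exists_abs_cyl_le (hasymm : ∀ i j z, a i j z = a j i z)
    (hapos : ∀ z : ℝ × Rd d, ∀ ξ : Fin d → ℝ, 0 ≤ ∑ i, ∑ j, a i j z * ξ i * ξ j)
    (hH1 : CondH1 T a) {R : ℝ} (hR : 0 < R) : ∃ a₀, ∀ i j z, |cyl T R (a i j) z| ≤ a₀ := by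
  obtain ⟨γ, M, -, hM, h⟩ := hH1 R hR
  refine ⟨M, fun i j z => ?_⟩
  by_cases hz : z ∈ Icc 0 T ×ˢ Metric.ball (0 : Rd d) R
  · rw [cyl, indicator_of_mem hz]
    exact abs_entry_le (A := fun i j => a i j z) (fun i j => hasymm i j z) (hapos z)
      (fun ξ => (h z.1 hz.1 z.2 hz.2 ξ).2) i j
  · rw [cyl, indicator_of_notMem hz, abs_zero]
    exact hM.le

theorem weighted_inequality_of_cond (hT : 0 < T)
    (hameas : ∀ i j, Measurable (a i j)) (hbmeas : ∀ i, Measurable (b i))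
    (hasymm : ∀ i j z, a i j z = a j i z)
    (hapos : ∀ z : ℝ × Rd d, ∀ ξ : Fin d → ℝ, 0 ≤ ∑ i, ∑ j, a i j z * ξ i * ξ j)
    (hH1 : CondH1 T a) (hH2 : CondH2 T a)
    (hb : ∀ R, 0 < R → Integrable (cyl T R fun z => ∑ i, b i z ^ 2)
      (volume.restrict (Icc 0 T) ⊗ₘ m))
    (hc : Integrable c (volume.restrict (Icc 0 T) ⊗ₘ m))
    (hu : Measurable u) (hu1 : ∀ z, |u z| ≤ 1) {ν : Measure (Rd d)} [IsFiniteMeasure ν]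
    (hw : ∀ ψ : Rd d → ℝ, IsTest ψ → ∀ᵐ t ∂(volume.restrict (Icc 0 T)),
      ∫ y, ψ y * u (t, y) ∂(m t)
        = ∫ s in (0 : ℝ)..t, ∫ y, L0 a b c ψ (s, y) * u (s, y) ∂(m s))
    (hm : ∀ ψ : Rd d → ℝ, IsTest ψ → ∀ᵐ t ∂(volume.restrict (Icc 0 T)),
      ∫ y, ψ y ∂(m t) = ∫ y, ψ y ∂ν + ∫ s in (0 : ℝ)..t, ∫ y, L0 a b c ψ (s, y) ∂(m s))
    {φ : Rd d → ℝ} (hφ : ContDiff ℝ 2 φ) (hφs : HasCompactSupport φ) (hφ0 : ∀ x, 0 ≤ φ x) {Φ K : ℝ}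
    (hΦ : ∀ x, φ x ≤ Φ) (hK : 0 ≤ K) (hφK : ∀ x, ∑ i, pd i φ x ^ 2 ≤ K * φ x) :
    T * (∫ x, φ x ∂ν) + ∫ z, (T - z.1) * (1 - u z ^ 2) * L0 a b c φ z
        ∂(volume.restrict (Icc 0 T) ⊗ₘ m)
      ≤ ∫ z, (1 - u z ^ 2) * φ z.2 ∂(volume.restrict (Icc 0 T) ⊗ₘ m) := by
  obtain ⟨r, hr, hφr⟩ := hφs.isCompact.isBounded.subset_ball_lt 0 0
  set R := r + 2 with hRdef
  have hR : 0 < R := by positivity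
  have hmem : ∀ x, φ x ≠ 0 → x ∈ Metric.ball (0 : Rd d) r := fun x hx => hφr (subset_tsupport _ hx)
  have hmem' : ∀ x, φ x ≠ 0 → ∀ y, dist x y ≤ 1 → y ∈ Metric.ball (0 : Rd d) R := by
    intro x hx y hy
    have h1 := Metric.mem_ball.1 (hmem x hx)
    rw [Metric.mem_ball]
    have := dist_triangle y x 0
    rw [dist_comm y x] at this
    linarith
  have hmem0 : ∀ x, φ x ≠ 0 → x ∈ Metric.ball (0 : Rd d) R := fun x hx =>
    hmem' x hx x (by simp)
  obtain ⟨a₀, ha₀⟩ := exists_abs_cyl_le hasymm hapos hH1 hR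
  obtain ⟨γ, _, hγ, -, hell⟩ := hH1 R hR
  obtain ⟨Λ, _, hlip⟩ := hH2 R hR
  have hIcc : ∀ {t s : ℝ}, t ∈ Icc 0 T → s ∈ uIcc 0 t → s ∈ Icc 0 T := fun ht hs => by
    rw [uIcc_of_le ht.1] at hs
    exact ⟨hs.1, hs.2.trans ht.2⟩
  have key := weighted_inequality (m := m) (a := fun i j => cyl T R (a i j))
    (b := fun i => cyl T R (b i)) (c := c) (ν := ν) (B := Metric.ball 0 R) hT
    (fun i j z => by simp only [cyl, indicator, hasymm i j])
    (fun i j => measurable_cyl (hameas i j)) ha₀ (fun i => measurable_cyl (hbmeas i))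
    ((hb R hR).congr (Eventually.of_forall fun z => by
      simp only [cyl, indicator]
      split_ifs <;> simp)) hc hφ hφs hφ0 hΦ hK hφK hγ
    (fun t ht x hx ξ => by
      simp only [cyl_of_mem _ ht (hmem0 x hx)]
      exact (hell t ht x (hmem0 x hx) ξ).1)
    (Λ := Λ) (fun t ht x hx y i j hy => by
      rw [cyl_of_mem _ ht (hmem0 x hx), cyl_of_mem _ ht (hmem' x hx y hy), abs_sub_comm]
      exact hlip t ht x (hmem0 x hx) y (hmem' x hx y hy) i j) hu hu1
    (fun x hx y hy => hmem' x hx y (by rwa [dist_comm]))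
    (fun ψ hψ hψB => by
      filter_upwards [hw ψ hψ, ae_restrict_mem measurableSet_Icc] with t h ht
      rw [h]
      refine intervalIntegral.integral_congr fun s hs => ?_
      simp only [L0_cyl hψB (hIcc ht hs)])
    (fun ψ hψ hψB => by
      filter_upwards [hm ψ hψ, ae_restrict_mem measurableSet_Icc] with t h ht
      rw [h]
      congr 1
      refine intervalIntegral.integral_congr fun s hs => ?_
      simp only [L0_cyl hψB (hIcc ht hs)])
  have hφB : tsupport φ ⊆ Metric.ball 0 R := hφr.trans (Metric.ball_subset_ball (by linarith))
  have e : ∫ z, (T - z.1) * (1 - u z ^ 2) * L0 (fun i j => cyl T R (a i j))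
      (fun i => cyl T R (b i)) c φ z ∂(volume.restrict (Icc 0 T) ⊗ₘ m)
      = ∫ z, (T - z.1) * (1 - u z ^ 2) * L0 a b c φ z ∂(volume.restrict (Icc 0 T) ⊗ₘ m) := by
    refine integral_congr_ae ?_
    filter_upwards [ae_fst_mem_Icc] with z hz
    rw [show z = (z.1, z.2) from rfl, L0_cyl hφB hz]
  rwa [e] at key

theorem integrable_L0_of_cond (hameas : ∀ i j, Measurable (a i j)) (hbmeas : ∀ i, Measurable (b i))
    (hasymm : ∀ i j z, a i j z = a j i z)
    (hapos : ∀ z : ℝ × Rd d, ∀ ξ : Fin d → ℝ, 0 ≤ ∑ i, ∑ j, a i j z * ξ i * ξ j)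
    (hH1 : CondH1 T a)
    (hb : ∀ R, 0 < R → Integrable (cyl T R fun z => ∑ i, b i z ^ 2)
      (volume.restrict (Icc 0 T) ⊗ₘ m))
    (hc : Integrable c (volume.restrict (Icc 0 T) ⊗ₘ m))
    {φ : Rd d → ℝ} (hφ : ContDiff ℝ 2 φ) (hφs : HasCompactSupport φ) :
    Integrable (L0 a b c φ) (volume.restrict (Icc 0 T) ⊗ₘ m) := by
  obtain ⟨R, hR, hφB⟩ := hφs.isCompact.isBounded.subset_ball_lt 0 0
  obtain ⟨a₀, ha₀⟩ := exists_abs_cyl_le hasymm hapos hH1 hR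
  refine (integrable_L0 (a := fun i j => cyl T R (a i j)) (b := fun i => cyl T R (b i))
    (fun i j => Integrable.of_bound (measurable_cyl (hameas i j)).aestronglyMeasurable a₀
      (Eventually.of_forall (ha₀ i j))) (fun i => ?_) hc hφ hφs).congr ?_
  · refine ((integrable_const 1).add (hb R hR)).mono'
      (measurable_cyl (hbmeas i)).aestronglyMeasurable
      (Eventually.of_forall fun z => ?_)
    simp only [Pi.add_apply, cyl, indicator]
    split_ifs
    · have h1 : b i z ^ 2 ≤ ∑ i, b i z ^ 2 := Finset.single_le_sum
        (f := fun i => b i z ^ 2) (fun i _ => sq_nonneg _) (Finset.mem_univ i)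
      rw [Real.norm_eq_abs]
      nlinarith [sq_nonneg (|b i z| - 1), sq_abs (b i z)]
    · simp
  · filter_upwards [ae_fst_mem_Icc] with z hz
    rw [show z = (z.1, z.2) from rfl, L0_cyl hφB hz]

theorem lyapunov_inequality (hT : 0 < T)
    (hameas : ∀ i j, Measurable (a i j)) (hbmeas : ∀ i, Measurable (b i))
    (hasymm : ∀ i j z, a i j z = a j i z)
    (hapos : ∀ z : ℝ × Rd d, ∀ ξ : Fin d → ℝ, 0 ≤ ∑ i, ∑ j, a i j z * ξ i * ξ j)
    (hH1 : CondH1 T a) (hH2 : CondH2 T a) (hcmeas : Measurable c)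
    {V : Rd d → ℝ} (hV : ContDiff ℝ 2 V) (hVpos : ∀ x, 0 < V x)
    (hVinf : Tendsto V (cocompact (Rd d)) atTop) {C : ℝ} (hC : 0 < C)
    (hLyap : ∀ t ∈ Icc (0 : ℝ) T, ∀ x : Rd d, L0 a b c V (t, x) ≤ C + C * V x)
    (hb : ∀ R, 0 < R → Integrable (cyl T R fun z => ∑ i, b i z ^ 2)
      (volume.restrict (Icc 0 T) ⊗ₘ m))
    (hc : Integrable c (volume.restrict (Icc 0 T) ⊗ₘ m))
    (hu : Measurable u) (hu1 : ∀ z, |u z| ≤ 1) {ν : Measure (Rd d)} [IsFiniteMeasure ν]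
    (hw : ∀ ψ : Rd d → ℝ, IsTest ψ → ∀ᵐ t ∂(volume.restrict (Icc 0 T)),
      ∫ y, ψ y * u (t, y) ∂(m t)
        = ∫ s in (0 : ℝ)..t, ∫ y, L0 a b c ψ (s, y) * u (s, y) ∂(m s))
    (hm : ∀ ψ : Rd d → ℝ, IsTest ψ → ∀ᵐ t ∂(volume.restrict (Icc 0 T)),
      ∫ y, ψ y ∂(m t) = ∫ y, ψ y ∂ν + ∫ s in (0 : ℝ)..t, ∫ y, L0 a b c ψ (s, y) ∂(m s)) :
    T * ν.real univ + ∫ z, (T - z.1) * (1 - u z ^ 2) * c z ∂(volume.restrict (Icc 0 T) ⊗ₘ m)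
      ≤ ∫ z, (1 - u z ^ 2) ∂(volume.restrict (Icc 0 T) ⊗ₘ m) := by
  set M := volume.restrict (Icc 0 T) ⊗ₘ m with hM
  have hVc := hV.continuous
  have hN : ∀ n : ℕ, (0 : ℝ) < n + 1 := fun n => by positivity
  set φ : ℕ → Rd d → ℝ := fun n x => cubeCutoff (n + 1) (V x) with hφdef
  have hφ2 : ∀ n, ContDiff ℝ 2 (φ n) := fun n => (contDiff_cubeCutoff _).comp hV
  have hφs : ∀ n, HasCompactSupport (φ n) := fun n =>
    hasCompactSupport_of_ne_zero_imp_lt hVinf fun x hx => lt_of_cubeCutoff_ne_zero (hN n) hx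
  have hφ0 : ∀ n x, 0 ≤ φ n x := fun n x => cubeCutoff_nonneg _ _
  have hφ1 : ∀ n x, φ n x ≤ 1 := fun n x => cubeCutoff_le_one (hN n) (hVpos x)
  have hφn : ∀ n x, ‖φ n x‖ ≤ 1 := fun n x => by
    rw [Real.norm_of_nonneg (hφ0 n x)]; exact hφ1 n x
  have hu2 : ∀ z, 0 ≤ 1 - u z ^ 2 := fun z =>
    sub_nonneg.2 ((sq_le_one_iff_abs_le_one _).2 (hu1 z))
  set q : ℕ → Rd d → ℝ := fun n x => 3 / ((n : ℝ) + 1) * max (1 - V x / (n + 1)) 0 ^ 2 with hq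
  have hqc : ∀ n, Continuous (q n) := fun n => by simp only [hq]; fun_prop
  have hq0 : ∀ n x, 0 ≤ q n x := fun n x => by
    have := hN n
    simp only [hq]; positivity
  have hq3 : ∀ n x, q n x ≤ 3 := fun n x => by
    have h1 : 3 / ((n : ℝ) + 1) ≤ 3 := by
      rw [div_le_iff₀ (hN n)]; nlinarith [(Nat.cast_nonneg n : (0 : ℝ) ≤ n)]
    have h2 := pow_le_one₀ (n := 2) (le_max_right (1 - V x / ((n : ℝ) + 1)) 0)
      (max_one_sub_le_one (hN n) (hVpos x))
    have h3 : 0 ≤ max (1 - V x / ((n : ℝ) + 1)) 0 ^ 2 := by positivity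
    simp only [hq]
    nlinarith
  have hqV : ∀ n x, q n x * V x ≤ 3 := fun n x => by
    by_cases h : max (1 - V x / ((n : ℝ) + 1)) 0 = 0
    · simp [hq, h]
    have h1 : V x / (n + 1) ≤ 1 := by
      rw [div_le_one (hN n)]; exact (lt_of_max_one_sub_ne_zero (hN n) h).le
    have h2 := pow_le_one₀ (n := 2) (le_max_right (1 - V x / ((n : ℝ) + 1)) 0)
      (max_one_sub_le_one (hN n) (hVpos x))
    calc q n x * V x = 3 * (max (1 - V x / ((n : ℝ) + 1)) 0 ^ 2 * (V x / (n + 1))) := by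
          simp only [hq]; ring
      _ ≤ 3 * (1 * 1) := by
          have := div_pos (hVpos x) (hN n)
          gcongr
      _ = 3 := by norm_num
  set F : ℕ → ℝ × Rd d → ℝ := fun n z => (T - z.1) * (1 - u z ^ 2) *
    (-q n z.2 * (C + C * V z.2 - c z * V z.2) + c z * φ n z.2) with hF
  have hFb : ∀ n, ∀ᵐ z ∂M, ‖F n z‖ ≤ T * (6 * C + 4 * |c z|) := fun n => by
    filter_upwards [ae_fst_mem_Icc] with z hz
    have h1 : |T - z.1| ≤ T := by rw [abs_le]; constructor <;> linarith [hz.1, hz.2]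
    have h2 := abs_one_sub_sq_le hu1 z
    have h3 : |-q n z.2 * (C + C * V z.2 - c z * V z.2) + c z * φ n z.2|
        ≤ 6 * C + 4 * |c z| := by
      have e : -q n z.2 * (C + C * V z.2 - c z * V z.2) + c z * φ n z.2
          = -(q n z.2 * C) + -(q n z.2 * V z.2 * C) + (q n z.2 * V z.2 + φ n z.2) * c z := by ring
      have hqV0 := mul_nonneg (hq0 n z.2) (hVpos z.2).le
      rw [e]
      refine (abs_add_le _ _).trans (add_le_add ((abs_add_le _ _).trans ?_) ?_)
      · rw [abs_neg, abs_neg, abs_of_nonneg (mul_nonneg (hq0 n _) hC.le),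
          abs_of_nonneg (mul_nonneg hqV0 hC.le)]
        nlinarith [hq3 n z.2, hqV n z.2]
      · rw [abs_mul, abs_of_nonneg (add_nonneg hqV0 (hφ0 n _))]
        have := hqV n z.2
        have := hφ1 n z.2
        gcongr
        linarith
    simp only [hF]
    rw [norm_mul, norm_mul, Real.norm_eq_abs, Real.norm_eq_abs, Real.norm_eq_abs]
    calc |T - z.1| * |1 - u z ^ 2| * _ ≤ T * 1 * (6 * C + 4 * |c z|) := by gcongr
      _ = _ := by ring
  have hFm : ∀ n, AEStronglyMeasurable (F n) M := fun n => by
    have h1 := hqc n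
    have h2 := (hφ2 n).continuous
    exact Measurable.aestronglyMeasurable (by simp only [hF]; fun_prop)
  have hbd : Integrable (fun z => T * (6 * C + 4 * |c z|)) M :=
    ((integrable_const _).add (hc.abs.const_mul 4)).const_mul T
  have hFi : ∀ n, Integrable (F n) M := fun n => hbd.mono' (hFm n) (hFb n)
  have l2 : Tendsto (fun n => ∫ z, F n z ∂M) atTop
      (𝓝 (∫ z, (T - z.1) * (1 - u z ^ 2) * c z ∂M)) := by
    refine tendsto_integral_of_dominated_convergence _ hFm hbd hFb
      (Eventually.of_forall fun z => ?_)
    have hq' : Tendsto (fun n => q n z.2) atTop (𝓝 0) := by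
      have h := ((tendsto_one_div_add_atTop_nhds_zero_nat (𝕜 := ℝ)).const_mul 3).mul
        ((tendsto_max_one_sub (V z.2)).pow 2)
      simpa [hq, div_eq_mul_inv] using h
    have := (((hq'.neg.mul_const (C + C * V z.2 - c z * V z.2)).add
      ((tendsto_cubeCutoff (V z.2)).const_mul (c z))).const_mul ((T - z.1) * (1 - u z ^ 2)))
    simpa [hF, hφdef] using this
  have l1 : Tendsto (fun n => ∫ x, φ n x ∂ν) atTop (𝓝 (∫ _, (1 : ℝ) ∂ν)) :=
    tendsto_integral_of_dominated_convergence (fun _ => (1 : ℝ))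
      (fun n => (hφ2 n).continuous.aestronglyMeasurable) (integrable_const _)
      (fun n => Eventually.of_forall (hφn n)) (Eventually.of_forall fun x => tendsto_cubeCutoff _)
  have hRm : ∀ n, AEStronglyMeasurable (fun z => (1 - u z ^ 2) * φ n z.2) M := fun n => by
    have h2 := (hφ2 n).continuous
    exact Measurable.aestronglyMeasurable (by fun_prop)
  have l3 : Tendsto (fun n => ∫ z, (1 - u z ^ 2) * φ n z.2 ∂M) atTop
      (𝓝 (∫ z, (1 - u z ^ 2) ∂M)) := by
    refine tendsto_integral_of_dominated_convergence (fun _ => (1 : ℝ)) hRm (integrable_const _)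
      (fun n => Eventually.of_forall fun z => ?_) (Eventually.of_forall fun z => ?_)
    · rw [norm_mul]
      exact mul_le_one₀ (abs_one_sub_sq_le hu1 z) (norm_nonneg _) (hφn n _)
    · simpa using (tendsto_cubeCutoff (V z.2)).const_mul (1 - u z ^ 2)
  have l12 := (l1.const_mul T).add l2
  rw [integral_const, smul_eq_mul, mul_one] at l12
  refine le_of_tendsto_of_tendsto' l12 l3 fun n => ?_
  obtain ⟨K, hK, hφK⟩ := exists_sum_pd_cubeCutoff_sq_le hV hVinf (hN n)
  refine le_trans (add_le_add_right ?_ _) (weighted_inequality_of_cond hT hameas hbmeas hasymm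
    hapos hH1 hH2 hb hc hu hu1 hw hm (hφ2 n) (hφs n) (hφ0 n) (hφ1 n) hK hφK)
  have hLi := integrable_L0_of_cond hameas hbmeas hasymm hapos hH1 hb hc (hφ2 n) (hφs n)
  have hLi' : Integrable (fun z => (T - z.1) * (1 - u z ^ 2) * L0 a b c (φ n) z) M := by
    refine (integrable_sub_fst_mul (hLi.bdd_mul (c := 1) (measurable_sub_sq hu).aestronglyMeasurable
      (Eventually.of_forall (abs_one_sub_sq_le hu1)))).congr (Eventually.of_forall fun z => ?_)
    dsimp only
    ring
  refine integral_mono_ae (hFi n) hLi' ?_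
  filter_upwards [ae_fst_mem_Icc] with z hz
  have := le_L0_cubeCutoff hV (hapos z) (hN n) (hLyap z.1 hz z.2)
  refine mul_le_mul_of_nonneg_left ?_ (mul_nonneg (sub_nonneg.2 hz.2) (hu2 z))
  simp only [hq, hφdef]
  linarith

end Lyapunov

section Reduction
variable {d : ℕ} {T : ℝ}

theorem integral_le_of_ae_le_add_intervalIntegral (hT : 0 < T) {G n : ℝ → ℝ} {n₀ : ℝ}
    (hG : IntervalIntegrable G volume 0 T) (hn : IntegrableOn n (Icc 0 T))
    (h : ∀ᵐ t ∂(volume.restrict (Icc 0 T)), n t ≤ n₀ + ∫ s in (0 : ℝ)..t, G s) :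
    ∫ t in Icc 0 T, n t ≤ T * n₀ + ∫ t in Icc 0 T, (T - t) * G t := by
  set N : ℝ → ℝ := fun t => n₀ + ∫ s in (0 : ℝ)..t, G s with hN
  have hu : uIcc 0 T = Icc 0 T := uIcc_of_le hT.le
  have hNac : AbsolutelyContinuousOnInterval N 0 T :=
    (contDiff_const.contDiffOn.absolutelyContinuousOnInterval).fun_add
      (hG.absolutelyContinuousOnInterval_intervalIntegral (by simp))
  have hlin : AbsolutelyContinuousOnInterval (fun t : ℝ => T - t) 0 T :=
    ((contDiff_const.sub contDiff_id).contDiffOn).absolutelyContinuousOnInterval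
  have key := hlin.integral_mul_deriv_eq_deriv_mul hNac
  have hN0 : N 0 = n₀ := by simp [hN]
  have hd : ∀ t : ℝ, deriv (fun t : ℝ => T - t) t = -1 := fun t => by
    simp
  simp only [hd, hN0, sub_self, zero_mul, sub_zero, neg_one_mul, intervalIntegral.integral_neg]
    at key
  rw [intervalIntegral.integral_of_le hT.le, intervalIntegral.integral_of_le hT.le,
    ← integral_Icc_eq_integral_Ioc, ← integral_Icc_eq_integral_Ioc] at key
  have e : ∫ t in Icc 0 T, (T - t) * deriv N t = ∫ t in Icc 0 T, (T - t) * G t := by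
    refine integral_congr_ae ?_
    filter_upwards [ae_restrict_of_ae (s := Icc 0 T) hG.ae_hasDerivAt_integral,
      ae_restrict_mem measurableSet_Icc] with t h4 ht
    rw [hu] at h4
    rw [((h4 ht 0 ⟨le_rfl, hT.le⟩).const_add n₀).deriv]
  have hNi : IntegrableOn N (Icc 0 T) := by
    have := hNac.continuousOn
    rw [hu] at this
    exact this.integrableOn_Icc
  have := integral_mono_ae hn hNi h
  linarith

theorem exists_isFiniteKernel_eq {μ : ℝ → Measure (Rd d)}
    (hμ : ∀ A : Set (Rd d), MeasurableSet A → Measurable fun t => μ t A)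
    (hμ1 : ∀ t ∈ Icc (0 : ℝ) T, μ t univ ≤ 1) :
    ∃ κ : Kernel ℝ (Rd d), IsFiniteKernel κ ∧ ∀ t ∈ Icc 0 T, κ t = μ t := by
  classical
  refine ⟨Kernel.piecewise (measurableSet_Icc (a := (0 : ℝ)) (b := T))
    ⟨μ, Measure.measurable_of_measurable_coe μ hμ⟩ 0, ⟨⟨1, ENNReal.one_lt_top, fun t => ?_⟩⟩,
    fun t ht => ?_⟩
  · rw [Kernel.piecewise_apply]
    split_ifs with ht
    · exact hμ1 t ht
    · simp
  · rw [Kernel.piecewise_apply, if_pos ht]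
    rfl

/-- The density of `κ - η` with respect to `κ + η`. -/
theorem exists_signed_density (κ η : Kernel ℝ (Rd d)) [IsFiniteKernel κ] [IsFiniteKernel η] :
    ∃ u : ℝ × Rd d → ℝ, Measurable u ∧ (∀ z, |u z| ≤ 1) ∧
      ∀ (t : ℝ) (h : Rd d → ℝ), Integrable h ((κ + η) t) →
        ∫ y, h y * u (t, y) ∂((κ + η) t) = ∫ y, h y ∂(κ t) - ∫ y, h y ∂(η t) := by
  have hle : κ ≤ κ + η := le_add_of_nonneg_right bot_le
  have hf := Kernel.measurable_rnDerivAux κ (κ + η)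
  refine ⟨fun z => 2 * min (Kernel.rnDerivAux κ (κ + η) z.1 z.2) 1 - 1,
    ((hf.min measurable_const).const_mul 2).sub_const 1, fun z => ?_, fun t h hh => ?_⟩
  · have h0 := Kernel.rnDerivAux_nonneg hle (a := z.1) (x := z.2)
    have h1 := min_le_right (Kernel.rnDerivAux κ (κ + η) z.1 z.2) 1
    have h2 := le_min h0 zero_le_one
    rw [abs_le]
    constructor <;> linarith
  · have hm1 : Measurable (Function.uncurry fun a x =>
        Real.toNNReal (Kernel.rnDerivAux κ (κ + η) a x)) := hf.real_toNNReal
    have hm2 : Measurable (Function.uncurry fun a x =>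
        Real.toNNReal (1 - Kernel.rnDerivAux κ (κ + η) a x)) := (hf.const_sub 1).real_toNNReal
    have e1 := Kernel.integral_withDensity (κ := κ + η) (a := t) (f := h) hm1
    have e2 := Kernel.integral_withDensity (κ := κ + η) (a := t) (f := h) hm2
    rw [Kernel.withDensity_rnDerivAux] at e1
    rw [Kernel.withDensity_one_sub_rnDerivAux] at e2
    have hb : ∀ᵐ y ∂((κ + η) t), 0 ≤ Kernel.rnDerivAux κ (κ + η) t y ∧
        Kernel.rnDerivAux κ (κ + η) t y ≤ 1 := by
      filter_upwards [Kernel.rnDerivAux_le_one hle (a := t)] with y hy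
      exact ⟨Kernel.rnDerivAux_nonneg hle, hy⟩
    have hft : Measurable fun y => Kernel.rnDerivAux κ (κ + η) t y :=
      Kernel.measurable_rnDerivAux_right κ (κ + η) t
    rw [e1, e2, ← integral_sub]
    · refine integral_congr_ae ?_
      filter_upwards [hb] with y hy
      simp only [NNReal.smul_def, smul_eq_mul, Real.coe_toNNReal _ hy.1,
        Real.coe_toNNReal _ (sub_nonneg.2 hy.2), min_eq_left hy.2]
      ring
    · refine hh.bdd_mul (c := 1) hft.real_toNNReal.coe_nnreal_real.aestronglyMeasurable ?_
      filter_upwards [hb] with y hy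
      rw [Real.coe_toNNReal _ hy.1, Real.norm_of_nonneg hy.1]
      exact hy.2
    · refine hh.bdd_mul (c := 1)
        (hft.const_sub 1).real_toNNReal.coe_nnreal_real.aestronglyMeasurable ?_
      filter_upwards [hb] with y hy
      rw [Real.coe_toNNReal _ (sub_nonneg.2 hy.2), Real.norm_of_nonneg (sub_nonneg.2 hy.2)]
      linarith [hy.1]

variable {κ η : Kernel ℝ (Rd d)} [IsFiniteKernel κ] [IsFiniteKernel η]

theorem integrable_compProd_of_lintegral {σ : Measure ℝ} [IsFiniteMeasure σ] {g : ℝ × Rd d → ℝ}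
    (hg : Measurable g) (h : ∫⁻ t, ∫⁻ x, ENNReal.ofReal |g (t, x)| ∂(κ t) ∂σ < ⊤) :
    Integrable g (σ ⊗ₘ κ) := by
  refine ⟨hg.aestronglyMeasurable, ?_⟩
  rw [hasFiniteIntegral_iff_norm, Measure.lintegral_compProd hg.norm.ennreal_ofReal]
  simpa only [Real.norm_eq_abs] using h

theorem integrable_cyl_of_lintegral {R : ℝ} {g : ℝ × Rd d → ℝ} (hg : Measurable g)
    (hg0 : ∀ z, 0 ≤ g z)
    (h : ∫⁻ t in Icc (0 : ℝ) T, ∫⁻ x in Metric.ball (0 : Rd d) R, ENNReal.ofReal (g (t, x)) ∂(κ t)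
      < ⊤) : Integrable (cyl T R g) (volume.restrict (Icc 0 T) ⊗ₘ κ) := by
  refine integrable_compProd_of_lintegral (measurable_cyl hg) (lt_of_eq_of_lt ?_ h)
  refine setLIntegral_congr_fun measurableSet_Icc fun t ht => ?_
  rw [← lintegral_indicator measurableSet_ball]
  refine lintegral_congr fun x => ?_
  by_cases hx : x ∈ Metric.ball (0 : Rd d) R
  · rw [cyl_of_mem g ht hx, indicator_of_mem hx, abs_of_nonneg (hg0 _)]
  · rw [cyl, indicator_of_notMem fun h => hx h.2, indicator_of_notMem hx]
    simp

theorem intervalIntegrable_integral_kernel {f : ℝ × Rd d → ℝ}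
    (hf : Integrable f (volume.restrict (Icc 0 T) ⊗ₘ κ)) {t : ℝ} (ht : t ∈ Icc 0 T) :
    IntervalIntegrable (fun s => ∫ y, f (s, y) ∂(κ s)) volume 0 t := by
  rw [intervalIntegrable_iff_integrableOn_Icc_of_le ht.1]
  exact IntegrableOn.mono_set (integrable_integral_kernel hf) (Icc_subset_Icc_right ht.2)

theorem integrable_compProd_add {σ : Measure ℝ} [IsFiniteMeasure σ] {f : ℝ × Rd d → ℝ}
    (h1 : Integrable f (σ ⊗ₘ κ)) (h2 : Integrable f (σ ⊗ₘ η)) : Integrable f (σ ⊗ₘ (κ + η)) := by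
  rw [Measure.compProd_add_right]
  exact h1.add_measure h2

/-- Integrated form of the mass balance. -/
theorem compProd_real_univ_le (hT : 0 < T) {c : ℝ × Rd d → ℝ}
    (hc : Integrable c (volume.restrict (Icc 0 T) ⊗ₘ κ)) {n₀ : ℝ}
    (h : ∀ᵐ t ∂(volume.restrict (Icc 0 T)),
      (κ t).real univ ≤ n₀ + ∫ s in (0 : ℝ)..t, ∫ x, c (s, x) ∂(κ s)) :
    (volume.restrict (Icc 0 T) ⊗ₘ κ).real univ
      ≤ T * n₀ + ∫ z, (T - z.1) * c z ∂(volume.restrict (Icc 0 T) ⊗ₘ κ) := by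
  have h1 : Integrable (fun _ : ℝ × Rd d => (1 : ℝ)) (volume.restrict (Icc 0 T) ⊗ₘ κ) :=
    integrable_const _
  have e1 := Measure.integral_compProd h1
  have e2 := Measure.integral_compProd (integrable_sub_fst_mul hc)
  have h1' := integrable_integral_kernel h1
  simp only [integral_const, smul_eq_mul, mul_one, integral_const_mul] at e1 e2 h1'
  rw [e1, e2]
  exact integral_le_of_ae_le_add_intervalIntegral hT
    (intervalIntegrable_integral_kernel hc ⟨hT.le, le_rfl⟩) h1' h

end Reduction

section Uniqueness
variable {d : ℕ} {T : ℝ} {κ η : Kernel ℝ (Rd d)} [IsFiniteKernel κ] [IsFiniteKernel η]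

theorem intervalIntegral_kernel_add {f : ℝ × Rd d → ℝ}
    (h1 : Integrable f (volume.restrict (Icc 0 T) ⊗ₘ κ))
    (h2 : Integrable f (volume.restrict (Icc 0 T) ⊗ₘ η)) {t : ℝ} (ht : t ∈ Icc 0 T) :
    ∫ s in (0 : ℝ)..t, ∫ y, f (s, y) ∂((κ + η) s)
      = (∫ s in (0 : ℝ)..t, ∫ y, f (s, y) ∂(κ s)) + ∫ s in (0 : ℝ)..t, ∫ y, f (s, y) ∂(η s) := by
  rw [← intervalIntegral.integral_add (intervalIntegrable_integral_kernel h1 ht)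
    (intervalIntegrable_integral_kernel h2 ht)]
  refine intervalIntegral.integral_congr_ae ?_
  filter_upwards [(ae_restrict_iff' measurableSet_Icc).1
      ((Measure.integrable_compProd_iff h1.1).1 h1).1,
    (ae_restrict_iff' measurableSet_Icc).1
      ((Measure.integrable_compProd_iff h2.1).1 h2).1] with s i1 i2 hs
  rw [uIoc_of_le ht.1] at hs
  have hs' : s ∈ Icc 0 T := ⟨hs.1.le, hs.2.trans ht.2⟩
  exact integral_add_measure (i1 hs') (i2 hs')

theorem intervalIntegral_kernel_sub {f u : ℝ × Rd d → ℝ}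
    (hu : ∀ (t : ℝ) (h : Rd d → ℝ), Integrable h ((κ + η) t) →
      ∫ y, h y * u (t, y) ∂((κ + η) t) = ∫ y, h y ∂(κ t) - ∫ y, h y ∂(η t))
    (h1 : Integrable f (volume.restrict (Icc 0 T) ⊗ₘ κ))
    (h2 : Integrable f (volume.restrict (Icc 0 T) ⊗ₘ η)) {t : ℝ} (ht : t ∈ Icc 0 T) :
    ∫ s in (0 : ℝ)..t, ∫ y, f (s, y) * u (s, y) ∂((κ + η) s)
      = (∫ s in (0 : ℝ)..t, ∫ y, f (s, y) ∂(κ s)) - ∫ s in (0 : ℝ)..t, ∫ y, f (s, y) ∂(η s) := by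
  rw [← intervalIntegral.integral_sub (intervalIntegrable_integral_kernel h1 ht)
    (intervalIntegrable_integral_kernel h2 ht)]
  refine intervalIntegral.integral_congr_ae ?_
  have h12 := integrable_compProd_add h1 h2
  filter_upwards [(ae_restrict_iff' measurableSet_Icc).1
      ((Measure.integrable_compProd_iff h12.1).1 h12).1] with s i hs
  rw [uIoc_of_le ht.1] at hs
  exact hu s _ (i ⟨hs.1.le, hs.2.trans ht.2⟩)

variable {a : Fin d → Fin d → ℝ × Rd d → ℝ} {b : Fin d → ℝ × Rd d → ℝ} {c : ℝ × Rd d → ℝ}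

/-- Uniqueness for solutions given by finite kernels. -/
theorem ae_kernel_eq (hT : 0 < T)
    (hameas : ∀ i j, Measurable (a i j)) (hbmeas : ∀ i, Measurable (b i))
    (hcmeas : Measurable c) (hc : ∀ z, c z ≤ 0)
    (hasymm : ∀ i j z, a i j z = a j i z)
    (hapos : ∀ z : ℝ × Rd d, ∀ ξ : Fin d → ℝ, 0 ≤ ∑ i, ∑ j, a i j z * ξ i * ξ j)
    (hH1 : CondH1 T a) (hH2 : CondH2 T a)
    {V : Rd d → ℝ} (hV : ContDiff ℝ 2 V) (hVpos : ∀ x, 0 < V x)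
    (hVinf : Tendsto V (cocompact (Rd d)) atTop) {C : ℝ} (hC : 0 < C)
    (hLyap : ∀ t ∈ Icc (0 : ℝ) T, ∀ x : Rd d, L0 a b c V (t, x) ≤ C + C * V x)
    {ν : Measure (Rd d)} [IsFiniteMeasure ν]
    (hbκ : ∀ R, 0 < R → Integrable (cyl T R fun z => ∑ i, b i z ^ 2)
      (volume.restrict (Icc 0 T) ⊗ₘ κ))
    (hbη : ∀ R, 0 < R → Integrable (cyl T R fun z => ∑ i, b i z ^ 2)
      (volume.restrict (Icc 0 T) ⊗ₘ η))
    (hcκ : Integrable c (volume.restrict (Icc 0 T) ⊗ₘ κ))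
    (hcη : Integrable c (volume.restrict (Icc 0 T) ⊗ₘ η))
    (hκ : ∀ ψ : Rd d → ℝ, IsTest ψ → ∀ᵐ t ∂(volume.restrict (Icc 0 T)),
      ∫ y, ψ y ∂(κ t) = ∫ y, ψ y ∂ν + ∫ s in (0 : ℝ)..t, ∫ y, L0 a b c ψ (s, y) ∂(κ s))
    (hη : ∀ ψ : Rd d → ℝ, IsTest ψ → ∀ᵐ t ∂(volume.restrict (Icc 0 T)),
      ∫ y, ψ y ∂(η t) = ∫ y, ψ y ∂ν + ∫ s in (0 : ℝ)..t, ∫ y, L0 a b c ψ (s, y) ∂(η s))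
    (hκ1 : ∀ᵐ t ∂(volume.restrict (Icc 0 T)),
      (κ t).real univ ≤ ν.real univ + ∫ s in (0 : ℝ)..t, ∫ x, c (s, x) ∂(κ s))
    (hη1 : ∀ᵐ t ∂(volume.restrict (Icc 0 T)),
      (η t).real univ ≤ ν.real univ + ∫ s in (0 : ℝ)..t, ∫ x, c (s, x) ∂(η s)) :
    ∀ᵐ t ∂(volume.restrict (Icc 0 T)), κ t = η t := by
  obtain ⟨u, hu, hu1, hud⟩ := exists_signed_density κ η
  have hcm := integrable_compProd_add hcκ hcη
  have hL : ∀ ψ, IsTest ψ → Integrable (L0 a b c ψ) (volume.restrict (Icc 0 T) ⊗ₘ κ) ∧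
      Integrable (L0 a b c ψ) (volume.restrict (Icc 0 T) ⊗ₘ η) := fun ψ hψ => by
    have h2 : ContDiff ℝ 2 ψ := by exact_mod_cast contDiff_infty.1 hψ.1 2
    exact ⟨integrable_L0_of_cond hameas hbmeas hasymm hapos hH1 hbκ hcκ h2 hψ.2,
      integrable_L0_of_cond hameas hbmeas hasymm hapos hH1 hbη hcη h2 hψ.2⟩
  have hψi : ∀ ψ : Rd d → ℝ, IsTest ψ → ∀ ρ : Measure (Rd d), IsFiniteMeasure ρ →
      Integrable ψ ρ := fun ψ hψ ρ _ => hψ.1.continuous.integrable_of_hasCompactSupport hψ.2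
  have hw : ∀ ψ : Rd d → ℝ, IsTest ψ → ∀ᵐ t ∂(volume.restrict (Icc 0 T)),
      ∫ y, ψ y * u (t, y) ∂((κ + η) t)
        = ∫ s in (0 : ℝ)..t, ∫ y, L0 a b c ψ (s, y) * u (s, y) ∂((κ + η) s) := by
    intro ψ hψ
    filter_upwards [hκ ψ hψ, hη ψ hψ, ae_restrict_mem measurableSet_Icc] with t h1 h2 ht
    rw [hud t ψ (hψi ψ hψ _ inferInstance),
      intervalIntegral_kernel_sub hud (hL ψ hψ).1 (hL ψ hψ).2 ht, h1, h2]
    ring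
  have hm : ∀ ψ : Rd d → ℝ, IsTest ψ → ∀ᵐ t ∂(volume.restrict (Icc 0 T)),
      ∫ y, ψ y ∂((κ + η) t) = ∫ y, ψ y ∂(ν + ν)
        + ∫ s in (0 : ℝ)..t, ∫ y, L0 a b c ψ (s, y) ∂((κ + η) s) := by
    intro ψ hψ
    filter_upwards [hκ ψ hψ, hη ψ hψ, ae_restrict_mem measurableSet_Icc] with t h1 h2 ht
    rw [intervalIntegral_kernel_add (hL ψ hψ).1 (hL ψ hψ).2 ht,
      integral_add_measure (hψi ψ hψ _ inferInstance) (hψi ψ hψ _ inferInstance)]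
    have e : ∫ y, ψ y ∂((κ + η) t) = ∫ y, ψ y ∂(κ t) + ∫ y, ψ y ∂(η t) :=
      integral_add_measure (hψi ψ hψ _ inferInstance) (hψi ψ hψ _ inferInstance)
    rw [e, h1, h2]
    ring
  have hly := lyapunov_inequality hT hameas hbmeas hasymm hapos hH1 hH2 hcmeas hV hVpos hVinf hC
    hLyap (fun R hR => integrable_compProd_add (hbκ R hR) (hbη R hR)) hcm hu hu1 hw hm
  have hmass := add_le_add (compProd_real_univ_le hT hcκ hκ1) (compProd_real_univ_le hT hcη hη1)
  have eM : (volume.restrict (Icc 0 T) ⊗ₘ (κ + η)).real univ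
      = (volume.restrict (Icc 0 T) ⊗ₘ κ).real univ
        + (volume.restrict (Icc 0 T) ⊗ₘ η).real univ := by
    rw [Measure.compProd_add_right, measureReal_add_apply]
  have ec : ∫ z, (T - z.1) * c z ∂(volume.restrict (Icc 0 T) ⊗ₘ (κ + η))
      = ∫ z, (T - z.1) * c z ∂(volume.restrict (Icc 0 T) ⊗ₘ κ)
        + ∫ z, (T - z.1) * c z ∂(volume.restrict (Icc 0 T) ⊗ₘ η) := by
    rw [Measure.compProd_add_right]
    exact integral_add_measure (integrable_sub_fst_mul hcκ) (integrable_sub_fst_mul hcη)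
  have eν : (ν + ν).real univ = ν.real univ + ν.real univ := measureReal_add_apply
  set M := volume.restrict (Icc 0 T) ⊗ₘ (κ + η) with hM
  have hu2 : ∀ z, u z ^ 2 ≤ 1 := fun z => (sq_le_one_iff_abs_le_one _).2 (hu1 z)
  have hui : Integrable (fun z => u z ^ 2) M :=
    Integrable.of_bound (hu.pow_const 2).aestronglyMeasurable 1 (Eventually.of_forall fun z => by
      rw [Real.norm_of_nonneg (sq_nonneg _)]; exact hu2 z)
  have hcT : Integrable (fun z => (T - z.1) * c z) M := integrable_sub_fst_mul hcm
  have hcTu : Integrable (fun z => (T - z.1) * c z * u z ^ 2) M :=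
    hcT.mul_bdd (c := 1) (hu.pow_const 2).aestronglyMeasurable (Eventually.of_forall fun z => by
      rw [Real.norm_of_nonneg (sq_nonneg _)]; exact hu2 z)
  have e1 : ∫ z, (1 - u z ^ 2) ∂M = M.real univ - ∫ z, u z ^ 2 ∂M := by
    rw [integral_sub (integrable_const _) hui]
    simp
  have e2 : ∫ z, (T - z.1) * (1 - u z ^ 2) * c z ∂M
      = ∫ z, (T - z.1) * c z ∂M - ∫ z, (T - z.1) * c z * u z ^ 2 ∂M := by
    rw [← integral_sub hcT hcTu]
    exact integral_congr_ae (Eventually.of_forall fun z => by dsimp only; ring)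
  have hle : ∫ z, (T - z.1) * c z * u z ^ 2 ∂M ≤ 0 := by
    refine integral_nonpos_of_ae ?_
    filter_upwards [ae_fst_mem_Icc] with z hz
    exact mul_nonpos_of_nonpos_of_nonneg
      (mul_nonpos_of_nonneg_of_nonpos (sub_nonneg.2 hz.2) (hc z)) (sq_nonneg _)
  have hzero : ∫ z, u z ^ 2 ∂M = 0 := by
    refine le_antisymm ?_ (integral_nonneg fun z => sq_nonneg _)
    rw [e1, e2, eν] at hly
    rw [← eM, ← add_add_add_comm, ← ec] at hmass
    linarith
  rw [integral_eq_zero_iff_of_nonneg (fun z => sq_nonneg _) hui] at hzero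
  filter_upwards [Measure.ae_ae_of_ae_compProd hzero] with t ht
  ext A hA
  have h := hud t (A.indicator fun _ => 1) ((integrable_const 1).indicator hA)
  rw [integral_indicator_const _ hA, integral_indicator_const _ hA, integral_eq_zero_of_ae] at h
  · simp only [smul_eq_mul, mul_one] at h
    exact (measureReal_eq_measureReal_iff).1 (by linarith)
  · filter_upwards [ht] with y hy
    rw [show u (t, y) = 0 from pow_eq_zero_iff two_ne_zero |>.1 hy]
    simp

theorem MemSP.exists_kernel {ν : Measure (Rd d)} {μ : ℝ → Measure (Rd d)}
    (hμ : MemSP T a b c ν μ) (hbmeas : ∀ i, Measurable (b i)) (hcmeas : Measurable c) :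
    ∃ κ : Kernel ℝ (Rd d), IsFiniteKernel κ ∧ (∀ t ∈ Icc 0 T, κ t = μ t) ∧
      (∀ R, 0 < R → Integrable (cyl T R fun z => ∑ i, b i z ^ 2)
        (volume.restrict (Icc 0 T) ⊗ₘ κ)) ∧
      Integrable c (volume.restrict (Icc 0 T) ⊗ₘ κ) ∧
      (∀ ψ : Rd d → ℝ, IsTest ψ → ∀ᵐ t ∂(volume.restrict (Icc 0 T)),
        ∫ y, ψ y ∂(κ t) = ∫ y, ψ y ∂ν + ∫ s in (0 : ℝ)..t, ∫ y, L0 a b c ψ (s, y) ∂(κ s)) ∧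
      ∀ᵐ t ∂(volume.restrict (Icc 0 T)),
        (κ t).real univ ≤ ν.real univ + ∫ s in (0 : ℝ)..t, ∫ x, c (s, x) ∂(κ s) := by
  obtain ⟨hmeas, hle, -, -, -, hfpk, hc, hb, -, hmass⟩ := hμ
  obtain ⟨κ, hκf, hκ⟩ := exists_isFiniteKernel_eq hmeas hle
  have hI : ∀ {t : ℝ}, t ∈ Icc 0 T → ∀ f : ℝ × Rd d → ℝ,
      ∫ s in (0 : ℝ)..t, ∫ y, f (s, y) ∂(κ s) = ∫ s in (0 : ℝ)..t, ∫ y, f (s, y) ∂(μ s) := by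
    intro t ht f
    refine intervalIntegral.integral_congr fun s hs => ?_
    rw [uIcc_of_le ht.1] at hs
    simp only [hκ s ⟨hs.1, hs.2.trans ht.2⟩]
  refine ⟨κ, hκf, hκ, fun R hR => ?_, ?_, fun ψ hψ => ?_, ?_⟩
  · refine integrable_cyl_of_lintegral (by fun_prop)
      (fun z => Finset.sum_nonneg fun i _ => sq_nonneg _) (lt_of_eq_of_lt ?_ (hb R hR))
    exact setLIntegral_congr_fun measurableSet_Icc fun t ht => by simp only [hκ t ht]
  · refine integrable_compProd_of_lintegral hcmeas (lt_of_eq_of_lt ?_ hc)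
    exact setLIntegral_congr_fun measurableSet_Icc fun t ht => by simp only [hκ t ht]
  · filter_upwards [hfpk ψ hψ, ae_restrict_mem measurableSet_Icc] with t h ht
    rw [hκ t ht, h, hI ht]
  · filter_upwards [hmass, ae_restrict_mem measurableSet_Icc] with t h ht
    rw [hκ t ht, hI ht]
    exact h

end Uniqueness

end Auxiliary

/-- Under (H1), (H2), local `L^p`-integrability of `b` and `c` for some
`p > d+2`, and existence of a Lyapunov function `V ∈ C²(ℝ^d)` with `V > 0`, `V(x) → ∞` as
`|x| → ∞` and `L₀V ≤ C + C·V` on `[0,T] × ℝ^d`, any two elements of `𝓢𝓟_ν` coincide for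
Lebesgue-a.e. `t ∈ [0,T]`. -/
theorem fpk_uniqueness_lyapunov
    {d : ℕ} (T : ℝ) (hT : 0 < T)
    (a : Fin d → Fin d → ℝ × Rd d → ℝ) (b : Fin d → ℝ × Rd d → ℝ)
    (c : ℝ × Rd d → ℝ)
    (hameas : ∀ i j, Measurable (a i j)) (hbmeas : ∀ i, Measurable (b i))
    (hcmeas : Measurable c) (hc : ∀ z, c z ≤ 0)
    (hasymm : ∀ i j z, a i j z = a j i z)
    (hapos : ∀ z : ℝ × Rd d, ∀ ξ : Fin d → ℝ, 0 ≤ ∑ i, ∑ j, a i j z * ξ i * ξ j)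
    (hH1 : CondH1 T a) (hH2 : CondH2 T a)
    (p : ℝ) (hp : (d : ℝ) + 2 < p)
    (hbLp : ∀ i, MemLplocDtDx T p (b i)) (hcLp : MemLplocDtDx T (p / 2) c)
    (V : Rd d → ℝ) (hV : ContDiff ℝ 2 V) (hVpos : ∀ x, 0 < V x)
    (hVinf : Filter.Tendsto V (Filter.cocompact (Rd d)) Filter.atTop)
    (C : ℝ) (hC : 0 < C)
    (hLyap : ∀ t ∈ Set.Icc (0 : ℝ) T, ∀ x : Rd d,
      L0 a b c V (t, x) ≤ C + C * V x)
    (ν : Measure (Rd d)) [IsProbabilityMeasure ν]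
    (μ μ' : ℝ → Measure (Rd d))
    (hμ : MemSP T a b c ν μ) (hμ' : MemSP T a b c ν μ') :
    ∀ᵐ t ∂(volume.restrict (Set.Icc (0 : ℝ) T)), μ t = μ' t := by
  obtain ⟨κ, hκf, hκ, hbκ, hcκ, hκ0, hκ1⟩ := hμ.exists_kernel hbmeas hcmeas
  obtain ⟨η, hηf, hη, hbη, hcη, hη0, hη1⟩ := hμ'.exists_kernel hbmeas hcmeas
  filter_upwards [ae_kernel_eq hT hameas hbmeas hcmeas hc hasymm hapos hH1 hH2 hV hVpos hVinf hC
    hLyap hbκ hbη hcκ hcη hκ0 hη0 hκ1 hη1, ae_restrict_mem measurableSet_Icc] with t h ht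
  rw [← hκ t ht, ← hη t ht, h]

end
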